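/- Let m,n be positive integers and d = m+n. There exists a sequence (μ_k)_{k≥1} of a-invariant Borel probability measures on X_d = SL_d(ℝ)/SL_d(ℤ) such that lim_{k→∞} h_{μ_k}(a) = m+n−1 and the sequence (μ_k) converges in the weak* topology to the zero measure. -/

import Mathlib

open MeasureTheory Matrix ENNReal Filter Topology

noncomputable section

/-- The supremum norm of a matrix (the maximum of the absolute values of its entries),
obtained from the sup norm on the corresponding function space. -/
def supNorm {p q : ℕ} (M : Matrix (Fin p) (Fin q) ℝ) : ℝ := ‖(Matrix.of.symm M)‖

/-- The diagonal element `a_t = diag(e^{t/m} I_m, e^{-t/n} I_n)`. -/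
def aMat (m n : ℕ) (t : ℝ) : Matrix (Fin (m + n)) (Fin (m + n)) ℝ :=
  Matrix.reindex finSumFinEquiv finSumFinEquiv
    (Matrix.fromBlocks (Real.exp (t / m) • (1 : Matrix (Fin m) (Fin m) ℝ)) 0 0
      (Real.exp (-(t / n)) • (1 : Matrix (Fin n) (Fin n) ℝ)))

/-- The unipotent element `u_A` with upper-right block `A`. -/
def uMat (m n : ℕ) (A : Fin m → Fin n → ℝ) : Matrix (Fin (m + n)) (Fin (m + n)) ℝ :=
  Matrix.reindex finSumFinEquiv finSumFinEquiv
    (Matrix.fromBlocks 1 (Matrix.of A) 0 1)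

lemma uMat_det (m n : ℕ) (A : Fin m → Fin n → ℝ) : (uMat m n A).det = 1 := by
  simp [uMat, Matrix.det_fromBlocks_zero₂₁]

lemma aMat_det (m n : ℕ) (hm : 0 < m) (hn : 0 < n) (t : ℝ) : (aMat m n t).det = 1 := by
  have hm' : (m : ℝ) ≠ 0 := Nat.cast_ne_zero.mpr hm.ne'
  have hn' : (n : ℝ) ≠ 0 := Nat.cast_ne_zero.mpr hn.ne'
  simp only [aMat, Matrix.det_reindex_self, Matrix.det_fromBlocks_zero₂₁,
    Matrix.det_smul, Matrix.det_one, Fintype.card_fin, mul_one]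
  rw [← Real.exp_nat_mul, ← Real.exp_nat_mul, ← Real.exp_add]
  rw [mul_div_cancel₀ _ hm']
  rw [show (n : ℝ) * -(t / n) = -t by field_simp [mul_comm]]
  simp

/-- `a_t` as an element of `SL_{m+n}(ℝ)`. -/
def aSL (m n : ℕ) (hm : 0 < m) (hn : 0 < n) (t : ℝ) :
    Matrix.SpecialLinearGroup (Fin (m + n)) ℝ :=
  ⟨aMat m n t, aMat_det m n hm hn t⟩

/-- `u_A` as an element of `SL_{m+n}(ℝ)`. -/
def uSL (m n : ℕ) (A : Fin m → Fin n → ℝ) : Matrix.SpecialLinearGroup (Fin (m + n)) ℝ :=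
  ⟨uMat m n A, uMat_det m n A⟩

instance SLtop (d : ℕ) : TopologicalSpace (Matrix.SpecialLinearGroup (Fin d) ℝ) :=
  instTopologicalSpaceSubtype

/-- `SL_d(ℤ)` viewed as a subgroup of `SL_d(ℝ)`. -/
def Gamma (d : ℕ) : Subgroup (Matrix.SpecialLinearGroup (Fin d) ℝ) :=
  (Matrix.SpecialLinearGroup.map (n := Fin d) (Int.castRingHom ℝ)).range

/-- The space of unimodular lattices `X_d = SL_d(ℝ)/SL_d(ℤ)`. -/
abbrev XSp (d : ℕ) := Matrix.SpecialLinearGroup (Fin d) ℝ ⧸ Gamma d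

instance (d : ℕ) : MeasurableSpace (XSp d) := borel _

/-- The first successive minimum `λ₁` of the lattice `g ℤ^d` (with respect to the sup norm):
the infimum of all `r` such that the lattice contains a nonzero vector of norm at most `r`. -/
def lam1M (d : ℕ) (g : Matrix (Fin d) (Fin d) ℝ) : ℝ :=
  sInf {r : ℝ | ∃ v : Fin d → ℤ, v ≠ 0 ∧ ‖g.mulVec (fun i => (v i : ℝ))‖ ≤ r}

/-- The first successive minimum `λ₁` of a unimodular lattice `x ∈ X_d`. -/
def lam1X (d : ℕ) (x : XSp d) : ℝ :=
  sInf {r : ℝ | ∃ g : Matrix.SpecialLinearGroup (Fin d) ℝ,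
    (QuotientGroup.mk g : XSp d) = x ∧
    ∃ v : Fin d → ℤ, v ≠ 0 ∧
      ‖(g : Matrix (Fin d) (Fin d) ℝ).mulVec (fun i => (v i : ℝ))‖ ≤ r}

/-- The lattice `g ℤ^d` as a subset of `ℝ^d`. -/
def latticeSet (d : ℕ) (g : Matrix (Fin d) (Fin d) ℝ) : Set (Fin d → ℝ) :=
  Set.range fun v : Fin d → ℤ => g.mulVec (fun i => (v i : ℝ))

/-- Shannon entropy of a finite indexed partition with respect to a measure. -/
def partEnt {α : Type*} [MeasurableSpace α] (μ : Measure α) {ι : Type*} [Fintype ι]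
    (P : ι → Set α) : ℝ :=
  ∑ i, Real.negMulLog (μ (P i)).toReal

/-- The join `⋁_{j<N} T^{-j} P` of a finite partition, indexed by itineraries. -/
def joinPart {α : Type*} (T : α → α) {k : ℕ} (P : Fin k → Set α) (N : ℕ) :
    (Fin N → Fin k) → Set α :=
  fun ω => ⋂ j : Fin N, T^[(j : ℕ)] ⁻¹' P (ω j)

/-- A finite measurable partition of the space. -/
def IsFinPart {α : Type*} [MeasurableSpace α] {k : ℕ} (P : Fin k → Set α) : Prop :=
  (∀ i, MeasurableSet (P i)) ∧ Pairwise (Function.onFun Disjoint P) ∧ (⋃ i, P i) = Set.univ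

/-- Kolmogorov–Sinai (measure-theoretic) entropy of a transformation `T` with respect to `μ`:
the supremum over finite measurable partitions `P` of `inf_N H_μ(⋁_{j<N} T^{-j}P)/N`. -/
def ksEntropy {α : Type*} [MeasurableSpace α] (T : α → α) (μ : Measure α) : ℝ :=
  ⨆ (k : ℕ) (P : Fin k → Set α) (_ : IsFinPart P),
    ⨅ N : ℕ, partEnt μ (joinPart T P (N + 1)) / (N + 1)

/-- The time-one map `x ↦ a x` on the space of lattices `X_{m+n}`. -/
def aAct (m n : ℕ) (hm : 0 < m) (hn : 0 < n) : XSp (m + n) → XSp (m + n) :=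
  fun x => aSL m n hm hn 1 • x

/-- The (topological) support of a measure: points all of whose open neighborhoods have
positive measure. -/
def μsupport {α : Type*} [TopologicalSpace α] [MeasurableSpace α] (μ : Measure α) : Set α :=
  {x | ∀ U : Set α, IsOpen U → x ∈ U → 0 < μ U}

noncomputable section

/-! ### Entropy of finite valued maps -/

section Entropy
variable {X : Type*} [MeasurableSpace X]

/-- Shannon entropy of a map with values in a finite type. -/
def HU (μ : Measure X) {ι : Type*} [Fintype ι] (U : X → ι) : ℝ :=
  ∑ i, Real.negMulLog (μ.real (U ⁻¹' {i}))

def FibMeas {ι : Type*} (U : X → ι) : Prop := ∀ i, MeasurableSet (U ⁻¹' {i})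

lemma FibMeas.preimage {ι : Type*} [Finite ι] {U : X → ι} (h : FibMeas U) (s : Set ι) :
    MeasurableSet (U ⁻¹' s) := by
  have : U ⁻¹' s = ⋃ i ∈ s, U ⁻¹' {i} := by ext; simp
  rw [this]
  exact MeasurableSet.biUnion (Set.to_countable s) fun i _ => h i

lemma FibMeas.measurable {ι : Type*} [Finite ι] {U : X → ι} (h : FibMeas U) :
    @Measurable X ι _ ⊤ U := fun s _ => h.preimage s

lemma FibMeas.comp {ι κ : Type*} [Finite ι] {U : X → ι} (h : FibMeas U) (f : ι → κ) :
    FibMeas (fun x => f (U x)) := fun i => by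
  have := h.preimage (f ⁻¹' {i})
  exact this

lemma integral_fib {ι : Type*} [Fintype ι] (μ : Measure X) [IsProbabilityMeasure μ] {U : X → ι}
    (h : FibMeas U) (φ : ι → ℝ) : ∫ x, φ (U x) ∂μ = ∑ i, μ.real (U ⁻¹' {i}) * φ i := by
  classical
  letI : MeasurableSpace ι := ⊤
  have hm : Measurable U := h.measurable
  rw [← integral_map (φ := U) (f := φ) hm.aemeasurable
    (measurable_of_countable φ).aestronglyMeasurable]
  haveI : IsProbabilityMeasure (μ.map U) := Measure.isProbabilityMeasure_map hm.aemeasurable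
  rw [integral_fintype .of_finite]
  refine Finset.sum_congr rfl fun i _ => ?_
  rw [map_measureReal_apply hm (measurableSet_singleton i), smul_eq_mul]

lemma sum_fib {ι : Type*} [Fintype ι] (μ : Measure X) [IsProbabilityMeasure μ] {U : X → ι}
    (h : FibMeas U) : ∑ i, μ.real (U ⁻¹' {i}) = 1 := by
  have := integral_fib μ h (fun _ => (1 : ℝ))
  simpa using this.symm

lemma HU_eq_integral {ι : Type*} [Fintype ι] (μ : Measure X) [IsProbabilityMeasure μ] {U : X → ι}
    (h : FibMeas U) : HU μ U = ∫ x, -Real.log (μ.real (U ⁻¹' {U x})) ∂μ := by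
  rw [integral_fib μ h (fun i => -Real.log (μ.real (U ⁻¹' {i})))]
  simp [HU, Real.negMulLog]

lemma HU_nonneg {ι : Type*} [Fintype ι] (μ : Measure X) [IsProbabilityMeasure μ] (U : X → ι) :
    0 ≤ HU μ U := Finset.sum_nonneg fun i _ =>
  Real.negMulLog_nonneg measureReal_nonneg measureReal_le_one

/-- Gibbs inequality. -/
lemma gibbs {ι : Type*} [Fintype ι] (p q : ι → ℝ) (hp : ∀ i, 0 ≤ p i) (hq : ∀ i, 0 ≤ q i)
    (hp1 : ∑ i, p i = 1) (hq1 : ∑ i, q i ≤ 1) (hpq : ∀ i, 0 < p i → 0 < q i) :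
    ∑ i, Real.negMulLog (p i) ≤ ∑ i, p i * (-Real.log (q i)) := by
  have : ∀ i, Real.negMulLog (p i) - p i * (-Real.log (q i)) ≤ q i - p i := by
    intro i
    rcases (hp i).eq_or_lt with h0 | h0
    · simp [← h0, hq i]
    · have hq0 := hpq i h0
      have h2 : Real.log (q i / p i) ≤ q i / p i - 1 :=
        Real.log_le_sub_one_of_pos (div_pos hq0 h0)
      rw [Real.log_div hq0.ne' h0.ne'] at h2
      have h3 := mul_le_mul_of_nonneg_left h2 h0.le
      have h4 : p i * (q i / p i - 1) = q i - p i := by field_simp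
      rw [h4] at h3
      simp only [Real.negMulLog]
      linarith
  have h := Finset.sum_le_sum fun i (_ : i ∈ Finset.univ) => this i
  simp only [Finset.sum_sub_distrib] at h
  linarith

lemma HU_le_log_card {ι : Type*} [Fintype ι] (μ : Measure X) [IsProbabilityMeasure μ] {U : X → ι}
    (h : FibMeas U) (S : Finset ι) (hS : ∀ i ∉ S, μ.real (U ⁻¹' {i}) = 0) :
    HU μ U ≤ Real.log S.card := by
  classical
  have hs1 := sum_fib μ h
  have hne : 0 < S.card := by
    rw [Finset.card_pos, Finset.nonempty_iff_ne_empty]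
    rintro rfl
    rw [Finset.sum_eq_zero (fun i _ => hS i (by simp))] at hs1
    exact zero_ne_one hs1
  have hne' : (0:ℝ) < S.card := by exact_mod_cast hne
  have := gibbs (fun i => μ.real (U ⁻¹' {i})) (fun i => if i ∈ S then (S.card : ℝ)⁻¹ else 0)
    (fun i => measureReal_nonneg) (fun i => by split_ifs <;> positivity) hs1
    (by simp [Finset.sum_ite_mem, hne'.ne']) (fun i hi => by
      have : i ∈ S := by
        by_contra hc
        exact hi.ne' (hS i hc)
      simp [this, hne])
  refine this.trans ?_
  have h2 : ∑ i, μ.real (U ⁻¹' {i}) * -Real.log (if i ∈ S then (S.card : ℝ)⁻¹ else 0)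
      = ∑ i, μ.real (U ⁻¹' {i}) * Real.log S.card := by
    refine Finset.sum_congr rfl fun i _ => ?_
    by_cases hi : i ∈ S
    · simp [hi]
    · simp [hS i hi]
  rw [h2, ← Finset.sum_mul, hs1, one_mul]

/-- Data processing. -/
lemma HU_comp_le {ι κ : Type*} [Fintype ι] [Fintype κ] (μ : Measure X) [IsProbabilityMeasure μ]
    {U : X → ι} (h : FibMeas U) (f : ι → κ) : HU μ (fun x => f (U x)) ≤ HU μ U := by
  rw [HU_eq_integral μ (h.comp f), HU, integral_fib μ h
    (fun i => -Real.log (μ.real ((fun x => f (U x)) ⁻¹' {f i})))]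
  refine Finset.sum_le_sum fun i _ => ?_
  rcases (measureReal_nonneg (μ := μ) (s := U ⁻¹' {i})).eq_or_lt with h0 | h0
  · simp [← h0]
  · rw [Real.negMulLog, neg_mul, mul_neg]
    apply neg_le_neg
    apply mul_le_mul_of_nonneg_left _ h0.le
    apply Real.log_le_log h0
    apply measureReal_mono _ (measure_ne_top _ _)
    intro x hx
    simp only [Set.mem_preimage, Set.mem_singleton_iff] at hx ⊢
    rw [hx]

lemma HU_equiv {ι κ : Type*} [Fintype ι] [Fintype κ] (μ : Measure X) [IsProbabilityMeasure μ]
    {U : X → ι} (h : FibMeas U) (f : ι → κ) (hf : Function.Injective f) :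
    HU μ (fun x => f (U x)) = HU μ U := by
  apply le_antisymm (HU_comp_le μ h f)
  rcases isEmpty_or_nonempty ι with hι | hι
  · simp [HU, measureReal_nonneg]
    apply Finset.sum_nonneg
    intro i _
    exact Real.negMulLog_nonneg measureReal_nonneg measureReal_le_one
  · have := HU_comp_le μ (h.comp f) (Function.invFun f)
    simpa [Function.leftInverse_invFun hf _] using this

/-- The `N`-name of a point. -/
def nameN {ι : Type*} (S : X → X) (W : X → ι) (N : ℕ) (x : X) : Fin N → ι := fun j => W (S^[j] x)

lemma fibMeas_nameN {ι : Type*} [Finite ι] {S : X → X} (hS : Measurable S) {W : X → ι}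
    (h : FibMeas W) (N : ℕ) : FibMeas (nameN S W N) := by
  intro w
  have : nameN S W N ⁻¹' {w} = ⋂ j : Fin N, S^[(j:ℕ)] ⁻¹' (W ⁻¹' {w j}) := by
    ext x; simp [nameN, funext_iff]
  rw [this]
  exact MeasurableSet.iInter fun j => (hS.iterate j) (h _)

lemma integral_name {ι : Type*} [Fintype ι] (μ : Measure X) [IsProbabilityMeasure μ]
    {S : X → X} (hS : MeasurePreserving S μ μ) {W : X → ι} (h : FibMeas W) (N : ℕ) (j : Fin N)
    (φ : ι → ℝ) : ∑ w, μ.real (nameN S W N ⁻¹' {w}) * φ (w j)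
      = ∑ i, μ.real (W ⁻¹' {i}) * φ i := by
  rw [← integral_fib μ (fibMeas_nameN hS.measurable h N) (fun w => φ (w j)),
    ← integral_fib μ h]
  simp only [nameN]
  letI : MeasurableSpace ι := ⊤
  have hm : Measurable W := h.measurable
  have hφ : Measurable fun x => φ (W x) := (measurable_of_countable φ).comp hm
  have hj := hS.iterate (j : ℕ)
  conv_rhs => rw [← hj.map_eq]
  rw [integral_map hj.measurable.aemeasurable hφ.aestronglyMeasurable]

lemma name_pos {ι : Type*} (μ : Measure X) [IsProbabilityMeasure μ]
    {S : X → X} (hS : MeasurePreserving S μ μ) {W : X → ι} (h : FibMeas W) (N : ℕ) (j : Fin N)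
    (w : Fin N → ι) (hw : 0 < μ.real (nameN S W N ⁻¹' {w})) : 0 < μ.real (W ⁻¹' {w j}) := by
  refine hw.trans_le ?_
  have hj := hS.iterate (j : ℕ)
  rw [← hj.measureReal_preimage (h _).nullMeasurableSet]
  apply measureReal_mono _ (measure_ne_top _ _)
  intro x hx
  simp only [Set.mem_preimage, Set.mem_singleton_iff, nameN, funext_iff] at hx ⊢
  exact hx j

/-- Key inequality: conditional subadditivity. -/
lemma HU_name_le {ι κ : Type*} [Fintype ι] [Fintype κ] (μ : Measure X) [IsProbabilityMeasure μ]
    {S : X → X} (hS : MeasurePreserving S μ μ) {W : X → ι} (h : FibMeas W) (f : ι → κ) (N : ℕ) :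
    HU μ (nameN S W N) ≤ HU μ (nameN S (fun x => f (W x)) N)
      + N * (HU μ W - HU μ (fun x => f (W x))) := by
  classical
  set V : X → κ := fun x => f (W x) with hV
  have hVm : FibMeas V := h.comp f
  set p : ι → ℝ := fun i => μ.real (W ⁻¹' {i}) with hp
  set r : κ → ℝ := fun i => μ.real (V ⁻¹' {i}) with hr
  set PW : (Fin N → ι) → ℝ := fun w => μ.real (nameN S W N ⁻¹' {w}) with hPW
  set PV : (Fin N → κ) → ℝ := fun w => μ.real (nameN S V N ⁻¹' {w}) with hPV
  have hrs : ∀ y, r y = ∑ i with f i = y, p i := by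
    intro y
    have h1 := integral_fib μ h (fun i => if f i = y then (1:ℝ) else 0)
    have h2 := integral_fib μ hVm (fun i => if i = y then (1:ℝ) else 0)
    rw [h2] at h1
    have h3 : ∑ i, μ.real (V ⁻¹' {i}) * (if i = y then (1:ℝ) else 0) = r y := by
      simp only [mul_ite, mul_one, mul_zero, Finset.sum_ite_eq', Finset.mem_univ, if_true, r]
    rw [← h3, h1, Finset.sum_filter]
    refine Finset.sum_congr rfl fun i _ => ?_
    split_ifs <;> simp [p]
  have hPVpos : ∀ w, 0 < PW w → 0 < PV (f ∘ w) := by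
    intro w hw
    refine hw.trans_le ?_
    apply measureReal_mono _ (measure_ne_top _ _)
    intro x hx
    simp only [Set.mem_preimage, Set.mem_singleton_iff, nameN, funext_iff] at hx ⊢
    intro j
    simp [hV, hx j]
  have hppos : ∀ w j, 0 < PW w → 0 < p (w j) := fun w j hw => name_pos μ hS h N j w hw
  have hrpos : ∀ w j, 0 < PW w → 0 < r (f (w j)) := fun w j hw =>
    name_pos μ hS hVm N j (f ∘ w) (hPVpos w hw)
  have hg := gibbs PW (fun w => PV (f ∘ w) * ∏ j, (p (w j) / r (f (w j))))
    (fun w => measureReal_nonneg)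
    (fun w => mul_nonneg measureReal_nonneg (Finset.prod_nonneg fun j _ =>
      div_nonneg measureReal_nonneg measureReal_nonneg))
    (sum_fib μ (fibMeas_nameN hS.measurable h N))
    (by
      have e1 : ∑ w : Fin N → ι, PV (f ∘ w) * ∏ j, (p (w j) / r (f (w j)))
          = ∑ y : Fin N → κ, ∑ w ∈ Fintype.piFinset (fun j => Finset.univ.filter
              (fun i => f i = y j)), PV y * ∏ j, (p (w j) / r (y j)) := by
        rw [← Finset.sum_fiberwise_of_maps_to (s := Finset.univ) (t := Finset.univ)
          (g := fun w : Fin N → ι => f ∘ w) (fun _ _ => Finset.mem_univ _)]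
        refine Finset.sum_congr rfl fun y _ => ?_
        have : (Finset.univ.filter fun w : Fin N → ι => f ∘ w = y)
            = Fintype.piFinset (fun j => Finset.univ.filter (fun i => f i = y j)) := by
          ext w; simp [funext_iff]
        rw [← this]
        refine Finset.sum_congr rfl fun w hw => ?_
        simp only [Finset.mem_filter, Finset.mem_univ, true_and] at hw
        subst hw
        rfl
      rw [e1]
      have e2 : ∀ y : Fin N → κ, ∑ w ∈ Fintype.piFinset (fun j => Finset.univ.filter
              (fun i => f i = y j)), PV y * ∏ j, (p (w j) / r (y j)) ≤ PV y := by
        intro y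
        rw [← Finset.mul_sum, ← Finset.prod_univ_sum (fun j => Finset.univ.filter
              (fun i => f i = y j)) (fun j i => p i / r (y j))]
        have : ∏ j, ∑ i with f i = y j, p i / r (y j) ≤ 1 := by
          apply Finset.prod_le_one
          · intro j _
            exact Finset.sum_nonneg fun i _ => div_nonneg measureReal_nonneg measureReal_nonneg
          · intro j _
            rw [← Finset.sum_div, ← hrs]
            exact div_self_le_one _
        calc _ ≤ PV y * 1 := mul_le_mul_of_nonneg_left this measureReal_nonneg
          _ = PV y := mul_one _
      refine (Finset.sum_le_sum fun y _ => e2 y).trans ?_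
      exact (sum_fib μ (fibMeas_nameN hS.measurable hVm N)).le)
    (by
      intro w hw
      exact mul_pos (hPVpos w hw) (Finset.prod_pos fun j _ => div_pos (hppos w j hw) (hrpos w j hw)))
  have hL : HU μ (nameN S W N) = ∑ w, Real.negMulLog (PW w) := rfl
  rw [hL]
  refine hg.trans (le_of_eq ?_)
  have e3 : ∀ w, PW w * (-Real.log (PV (f ∘ w) * ∏ j, (p (w j) / r (f (w j)))))
      = PW w * (-Real.log (PV (f ∘ w))) + ∑ j, PW w * (-Real.log (p (w j)) + Real.log (r (f (w j)))) := by
    intro w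
    rcases (measureReal_nonneg (μ := μ) (s := nameN S W N ⁻¹' {w})).eq_or_lt with h0 | h0
    · have h0' : PW w = 0 := h0.symm
      simp [h0']
    · have h0' : 0 < PW w := h0
      rw [Real.log_mul (hPVpos w h0').ne' (Finset.prod_pos fun j _ =>
        div_pos (hppos w j h0') (hrpos w j h0')).ne', Real.log_prod
        (fun j _ => (div_pos (hppos w j h0') (hrpos w j h0')).ne')]
      rw [neg_add, mul_add, ← Finset.mul_sum, ← Finset.sum_neg_distrib]
      congr 2
      refine Finset.sum_congr rfl fun j _ => ?_
      rw [Real.log_div (hppos w j h0').ne' (hrpos w j h0').ne']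
      ring
  rw [Finset.sum_congr rfl fun w _ => e3 w, Finset.sum_add_distrib, Finset.sum_comm]
  have e4 : ∑ w, PW w * (-Real.log (PV (f ∘ w))) = HU μ (nameN S V N) := by
    rw [HU_eq_integral μ (fibMeas_nameN hS.measurable hVm N)]
    rw [← integral_fib μ (fibMeas_nameN hS.measurable h N) (fun w => -Real.log (PV (f ∘ w)))]
    rfl
  have e5 : ∀ j : Fin N, ∑ w, PW w * (-Real.log (p (w j)) + Real.log (r (f (w j))))
      = HU μ W - HU μ V := by
    intro j
    rw [integral_name μ hS h N j (fun i => -Real.log (p i) + Real.log (r (f i)))]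
    simp only [mul_add, Finset.sum_add_distrib]
    have e6 : HU μ V = ∑ i, μ.real (W ⁻¹' {i}) * -Real.log (r (f i)) := by
      rw [HU_eq_integral μ hVm, ← integral_fib μ h (fun i => -Real.log (r (f i)))]
    rw [e6]
    simp [HU, Real.negMulLog, hp]
  rw [e4, Finset.sum_congr rfl fun j _ => e5 j]
  simp [mul_sub]

lemma HU_name_subadd {ι : Type*} [Fintype ι] (μ : Measure X) [IsProbabilityMeasure μ]
    {S : X → X} (hS : MeasurePreserving S μ μ) {W : X → ι} (h : FibMeas W) (N : ℕ) :
    HU μ (nameN S W N) ≤ N * HU μ W := by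
  have h1 := HU_name_le μ hS h (fun _ => ()) N
  have h2 : HU μ (nameN S (fun _ => ()) N) ≤ Real.log ((Finset.univ : Finset (Fin N → Unit)).card) :=
    HU_le_log_card μ (fibMeas_nameN hS.measurable (fun i => by simp) N) Finset.univ (by simp)
  have h3 : HU μ (fun _ : X => ()) ≥ 0 := HU_nonneg μ _
  simp at h2
  have h4 : (N:ℝ) * HU μ (fun _ : X => ()) ≥ 0 := by positivity
  linarith

/-- names of blocks -/
lemma HU_name_block {ι : Type*} [Fintype ι] (μ : Measure X) [IsProbabilityMeasure μ]
    {T : X → X} (hT : MeasurePreserving T μ μ) {W : X → ι} (h : FibMeas W) (p N : ℕ) :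
    HU μ (nameN (T^[p]) (nameN T W p) N) = HU μ (nameN T W (N * p)) := by
  have := HU_equiv μ (fibMeas_nameN hT.measurable h (N * p))
    (fun w : Fin (N * p) → ι => fun (i : Fin N) (j : Fin p) => w (finProdFinEquiv (i, j)))
    (by
      intro w w' hw
      ext k
      obtain ⟨⟨i, j⟩, rfl⟩ := finProdFinEquiv.surjective k
      exact congrFun (congrFun hw i) j)
  rw [← this]
  congr 1
  ext x i j
  simp only [nameN, finProdFinEquiv]
  rw [← Function.iterate_mul, ← Function.iterate_add_apply]
  rfl

end Entropy
end

noncomputable section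

lemma exists_name {X : Type*} [MeasurableSpace X] {k : ℕ} {P : Fin k → Set X} (hP : IsFinPart P) :
    ∃ ξ : X → Fin k, FibMeas ξ ∧ ∀ (T : X → X) (μ : Measure X) (N : ℕ),
      partEnt μ (joinPart T P N) = HU μ (nameN T ξ N) := by
  obtain ⟨h1, h2, h3⟩ := hP
  have hex : ∀ x, ∃ i, x ∈ P i := fun x => by
    have : x ∈ ⋃ i, P i := h3 ▸ Set.mem_univ x
    simpa using this
  choose ξ hξ using hex
  have hiff : ∀ x i, ξ x = i ↔ x ∈ P i := by
    intro x i
    constructor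
    · rintro rfl; exact hξ x
    · intro hx
      by_contra hne
      exact Set.disjoint_left.1 (h2 hne) (hξ x) hx
  refine ⟨ξ, fun i => ?_, fun T μ N => ?_⟩
  · have : ξ ⁻¹' {i} = P i := by ext x; simp [hiff]
    rw [this]; exact h1 i
  · unfold partEnt HU
    refine Finset.sum_congr rfl fun w _ => ?_
    have : joinPart T P N w = nameN T ξ N ⁻¹' {w} := by
      ext x; simp [joinPart, nameN, funext_iff, hiff]
    rw [this]; rfl

lemma upper_block {X : Type*} [MetricSpace X] [MeasurableSpace X] [BorelSpace X] {T : X → X}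
    (μ : Measure X) [IsProbabilityMeasure μ] (hT : MeasurePreserving T μ μ)
    (Z : Set X) (hZ : IsCompact Z) (Y : Set X) (hY : μ Yᶜ = 0)
    (hYZ : ∀ x ∈ Y, ∀ j : ℕ, T^[j] x ∈ Z) (L : ℕ) (A : ℝ) (hA : 1 ≤ A)
    (hcov : ∀ ε > 0, ∃ C : ℝ, ∀ N : ℕ, ∃ F : Finset (Set X), (F.card : ℝ) ≤ C * A ^ N ∧
      (Y ⊆ ⋃ D ∈ F, D) ∧ ∀ D ∈ F, ∀ x ∈ D ∩ Y, ∀ x' ∈ D ∩ Y, ∀ t ≤ N * L,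
        dist (T^[t] x) (T^[t] x') < ε)
    {ι : Type*} [Fintype ι] (U : X → ι) (hU : FibMeas U) (q : ℕ) :
    ∃ C : ℝ, 1 ≤ C ∧ ∀ N : ℕ, HU μ (nameN (T^[q * L]) U N) ≤
      Real.log C + N * (q * Real.log A + Real.log 2 + 1) := by
  classical
  -- closed subsets
  obtain ⟨η, hη, hη'⟩ : ∃ η > 0, ∀ x : ℝ, |x| < η → Real.negMulLog x < 1 / (Fintype.card ι + 1) := by
    have hc : Tendsto Real.negMulLog (𝓝 0) (𝓝 0) := by
      have := Real.continuous_negMulLog.tendsto 0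
      simpa using this
    have h2 : ∀ᶠ x in 𝓝 (0:ℝ), Real.negMulLog x < 1 / (Fintype.card ι + 1) :=
      hc.eventually_lt_const (by positivity)
    obtain ⟨η, hη, h⟩ := Metric.eventually_nhds_iff.1 h2
    exact ⟨η, hη, fun x hx => h (by simpa [dist_eq_norm] using hx)⟩
  have hF : ∀ i, ∃ F ⊆ U ⁻¹' {i}, IsClosed F ∧ μ (U ⁻¹' {i} \ F) < ENNReal.ofReal η := by
    intro i
    exact (hU i).exists_isClosed_diff_lt (measure_ne_top _ _) (by simpa using hη)
  choose F hFsub hFcl hFlt using hF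
  set W : X → ι ⊕ ι := fun x => if x ∈ F (U x) then Sum.inl (U x) else Sum.inr (U x) with hW
  have hWl : ∀ i, W ⁻¹' {Sum.inl i} = F i := by
    intro i; ext x
    simp only [hW, Set.mem_preimage, Set.mem_singleton_iff]
    constructor
    · intro h; split_ifs at h with h1
      cases h; exact h1
    · intro h
      have hx : U x = i := hFsub i h
      rw [hx, if_pos h]
  have hWr : ∀ i, W ⁻¹' {Sum.inr i} = U ⁻¹' {i} \ F i := by
    intro i; ext x
    simp only [hW, Set.mem_preimage, Set.mem_singleton_iff, Set.mem_diff]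
    constructor
    · intro h; split_ifs at h with h1
      cases h; exact ⟨rfl, h1⟩
    · rintro ⟨rfl, h⟩
      rw [if_neg h]
  have hWm : FibMeas W := by
    rintro (i | i)
    · rw [hWl]; exact (hFcl i).measurableSet
    · rw [hWr]; exact (hU i).diff (hFcl i).measurableSet
  set f : ι ⊕ ι → Option ι := fun s => Sum.elim some (fun _ => none) s with hf
  set V : X → Option ι := fun x => f (W x) with hV
  have hVm : FibMeas V := hWm.comp f
  have hVs : ∀ i, V ⁻¹' {some i} = F i := by
    intro i
    rw [← hWl]; ext x
    simp only [hV, hf, Set.mem_preimage, Set.mem_singleton_iff]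
    rcases W x with j | j <;> simp
  have hdiff : HU μ W - HU μ V ≤ 1 := by
    unfold HU
    rw [Fintype.sum_sum_type, Fintype.sum_option]
    have e1 : ∑ i, Real.negMulLog (μ.real (W ⁻¹' {Sum.inl i}))
        = ∑ i, Real.negMulLog (μ.real (V ⁻¹' {some i})) := by
      refine Finset.sum_congr rfl fun i _ => ?_
      rw [hWl, hVs]
    have e2 : 0 ≤ Real.negMulLog (μ.real (V ⁻¹' {none})) :=
      Real.negMulLog_nonneg measureReal_nonneg measureReal_le_one
    have e3 : ∑ i, Real.negMulLog (μ.real (W ⁻¹' {Sum.inr i})) ≤ ∑ i : ι, 1 / ((Fintype.card ι : ℝ) + 1) := by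
      refine Finset.sum_le_sum fun i _ => (hη' _ ?_).le
      rw [hWr, abs_of_nonneg measureReal_nonneg]
      exact (ENNReal.lt_ofReal_iff_toReal_lt (measure_ne_top _ _)).1 (hFlt i)
    have e4 : ∑ i : ι, 1 / ((Fintype.card ι : ℝ) + 1) ≤ 1 := by
      simp
      rw [← div_eq_mul_inv, div_le_one (by positivity)]; linarith
    linarith
  -- separation
  obtain ⟨ε, hε, hsep⟩ : ∃ ε > 0, ∀ i j, ∀ x ∈ F i ∩ Z, ∀ y ∈ F j ∩ Z, dist x y < ε → i = j := by
    have h1 : ∀ i j, ∃ ε > 0, ∀ x ∈ F i ∩ Z, ∀ y ∈ F j ∩ Z, dist x y < ε → i = j := by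
      intro i j
      by_cases hij : i = j
      · exact ⟨1, one_pos, fun _ _ _ _ _ => hij⟩
      · obtain ⟨r, hr, h⟩ := Metric.exists_pos_forall_lt_edist (hZ.inter_left (hFcl i))
          ((hFcl j).inter hZ.isClosed) (by
            rw [Set.disjoint_left]
            intro x hx hx'
            have a : U x = i := hFsub i hx.1
            have b : U x = j := hFsub j hx'.1
            exact hij (a.symm.trans b))
        refine ⟨r, by exact_mod_cast hr, fun x hx y hy hxy => ?_⟩
        have := h x hx y hy
        rw [edist_dist, ENNReal.lt_ofReal_iff_toReal_lt (by simp)] at this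
        simp at this
        exact absurd hxy (not_lt.2 this.le)
    choose ε hε h using h1
    rcases isEmpty_or_nonempty ι with hι | hι
    · exact ⟨1, one_pos, fun i => (hι.false i).elim⟩
    · refine ⟨Finset.univ.inf' Finset.univ_nonempty (fun p : ι × ι => ε p.1 p.2), ?_, ?_⟩
      · rw [gt_iff_lt, Finset.lt_inf'_iff]
        exact fun p _ => hε _ _
      · intro i j x hx y hy hxy
        exact h i j x hx y hy (hxy.trans_le (Finset.inf'_le (fun p : ι × ι => ε p.1 p.2)
          (Finset.mem_univ (i, j))))
  obtain ⟨C, hC⟩ := hcov ε hε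
  refine ⟨max C 1, le_max_right _ _, fun N => ?_⟩
  have hS : MeasurePreserving (T^[q * L]) μ μ := hT.iterate _
  have h1 : HU μ (nameN (T^[q * L]) U N) ≤ HU μ (nameN (T^[q * L]) W N) := by
    have := HU_comp_le μ (fibMeas_nameN hS.measurable hWm N)
      (fun w : Fin N → ι ⊕ ι => fun j => Sum.elim id id (w j))
    convert this using 2
    ext x j
    simp only [nameN, hW]
    split_ifs <;> rfl
  have h2 := HU_name_le μ hS hWm f N
  obtain ⟨G, hGc, hGcov, hGd⟩ := hC (q * N)
  set c : Set X → Fin N → Option ι := fun D j =>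
    if h : ∃ x ∈ D ∩ Y, V ((T^[q * L])^[j] x) ≠ none then V ((T^[q * L])^[j] h.choose) else none with hc
  set S : Finset (Fin N → Option ι) := G.biUnion fun D =>
    Fintype.piFinset fun j => {none, c D j} with hSdef
  have hScard : (S.card : ℝ) ≤ max C 1 * A ^ (q * N) * 2 ^ N := by
    have e1 : S.card ≤ G.card * 2 ^ N := by
      refine Finset.card_biUnion_le_card_mul _ _ _ fun D _ => ?_
      rw [Fintype.card_piFinset]
      calc ∏ j : Fin N, ({none, c D j} : Finset (Option ι)).card ≤ ∏ j : Fin N, 2 :=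
            Finset.prod_le_prod' fun j _ => Finset.card_le_two
        _ = 2 ^ N := by simp
    have e2 : (S.card : ℝ) ≤ G.card * 2 ^ N := by exact_mod_cast e1
    refine e2.trans ?_
    gcongr
    exact hGc.trans (by gcongr; exact le_max_left _ _)
  have hmem : ∀ x ∈ Y, nameN (T^[q * L]) V N x ∈ S := by
    intro x hx
    obtain ⟨D, hD, hxD⟩ := Set.mem_iUnion₂.1 (hGcov hx)
    refine Finset.mem_biUnion.2 ⟨D, hD, ?_⟩
    rw [Fintype.mem_piFinset]
    intro j
    simp only [nameN, Finset.mem_insert, Finset.mem_singleton]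
    by_cases hn : V ((T^[q * L])^[j] x) = none
    · exact Or.inl hn
    · right
      have hex : ∃ x ∈ D ∩ Y, V ((T^[q * L])^[j] x) ≠ none := ⟨x, ⟨hxD, hx⟩, hn⟩
      simp only [hc, dif_pos hex]
      obtain ⟨hy, hyn⟩ := hex.choose_spec
      set y := hex.choose
      obtain ⟨i, hi⟩ := Option.ne_none_iff_exists'.1 hn
      obtain ⟨i', hi'⟩ := Option.ne_none_iff_exists'.1 hyn
      rw [hi, hi']
      have a1 : (T^[q * L])^[j] x ∈ F i := by rw [← hVs]; exact hi
      have a2 : (T^[q * L])^[j] y ∈ F i' := by rw [← hVs]; exact hi'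
      rw [← Function.iterate_mul] at a1 a2
      congr 1
      refine hsep i i' _ ⟨a1, hYZ _ hx _⟩ _ ⟨a2, hYZ _ hy.2 _⟩
        (hGd D hD x ⟨hxD, hx⟩ y hy _ ?_)
      calc q * L * j ≤ q * L * N := Nat.mul_le_mul_left _ j.2.le
        _ = q * N * L := by ring
  have h3 : HU μ (nameN (T^[q * L]) V N) ≤ Real.log S.card := by
    refine HU_le_log_card μ (fibMeas_nameN hS.measurable hVm N) S fun w hw => ?_
    have : nameN (T^[q * L]) V N ⁻¹' {w} ⊆ Yᶜ := by
      intro x hx hxY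
      exact hw (hx ▸ hmem x hxY)
    simp [measureReal_def, measure_mono_null this hY]
  have hSpos : (0:ℝ) < S.card := by
    have : Y.Nonempty := by
      by_contra hne
      rw [Set.not_nonempty_iff_eq_empty] at hne
      rw [hne] at hY; simp at hY
    obtain ⟨x, hx⟩ := this
    exact_mod_cast Finset.card_pos.2 ⟨_, hmem x hx⟩
  have hA0 : 0 < A := by linarith
  have hC0 : 0 < max C 1 := lt_max_of_lt_right one_pos
  have h4 : Real.log S.card ≤ Real.log (max C 1) + (q * N) * Real.log A + N * Real.log 2 := by
    refine (Real.log_le_log hSpos hScard).trans (le_of_eq ?_)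
    rw [Real.log_mul (by positivity) (by positivity), Real.log_mul (by positivity) (by positivity),
      Real.log_pow, Real.log_pow]
    push_cast; ring
  have h5 : (N:ℝ) * (HU μ W - HU μ V) ≤ N * 1 := by gcongr
  calc _ ≤ _ := h1
    _ ≤ _ := h2
    _ ≤ (Real.log (max C 1) + (q * N) * Real.log A + N * Real.log 2) + N * 1 := by
      gcongr
      exact h3.trans h4
    _ = _ := by ring

theorem upper_entropy {X : Type*} [MetricSpace X] [MeasurableSpace X] [BorelSpace X] {T : X → X}
    (μ : Measure X) [IsProbabilityMeasure μ] (hT : MeasurePreserving T μ μ)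
    (Z : Set X) (hZ : IsCompact Z) (Y : Set X) (hY : μ Yᶜ = 0)
    (hYZ : ∀ x ∈ Y, ∀ j : ℕ, T^[j] x ∈ Z) (L : ℕ) (hL : 0 < L) (A : ℝ) (hA : 1 ≤ A)
    (hcov : ∀ ε > 0, ∃ C : ℝ, ∀ N : ℕ, ∃ F : Finset (Set X), (F.card : ℝ) ≤ C * A ^ N ∧
      (Y ⊆ ⋃ D ∈ F, D) ∧ ∀ D ∈ F, ∀ x ∈ D ∩ Y, ∀ x' ∈ D ∩ Y, ∀ t ≤ N * L,
        dist (T^[t] x) (T^[t] x') < ε)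
    {k : ℕ} (P : Fin k → Set X) (hP : IsFinPart P) :
    ⨅ N : ℕ, partEnt μ (joinPart T P (N + 1)) / (N + 1) ≤ Real.log A / L := by
  obtain ⟨ξ, hξ, hent⟩ := exists_name hP
  simp only [hent]
  have hbdd : BddBelow (Set.range fun N : ℕ => HU μ (nameN T ξ (N + 1)) / ((N:ℝ) + 1)) := by
    refine ⟨0, ?_⟩
    rintro _ ⟨N, rfl⟩
    exact div_nonneg (HU_nonneg _ _) (by positivity)
  have hLr : (0:ℝ) < L := by exact_mod_cast hL
  refine le_of_forall_pos_le_add fun ε hε => ?_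
  obtain ⟨q, hq⟩ := exists_nat_gt ((Real.log 2 + 1) * 2 / (ε * L))
  have hq0 : (0:ℝ) < q := by
    refine lt_of_le_of_lt ?_ hq
    have := Real.log_nonneg one_le_two
    positivity
  obtain ⟨C, hC1, hC⟩ := upper_block μ hT Z hZ Y hY hYZ L A hA hcov (nameN T ξ (q * L))
    (fibMeas_nameN hT.measurable hξ _) q
  obtain ⟨N, hN⟩ := exists_nat_gt (Real.log C * 2 / (ε * (q * L)))
  have hN0 : (0:ℝ) < N := by
    refine lt_of_le_of_lt ?_ hN
    have := Real.log_nonneg hC1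
    positivity
  have h1 := hC N
  rw [HU_name_block μ hT hξ] at h1
  have hpos : 0 < N * (q * L) := by
    have h1 : 0 < N := by exact_mod_cast hN0
    have h2 : 0 < q := by exact_mod_cast hq0
    positivity
  refine (ciInf_le hbdd (N * (q * L) - 1)).trans ?_
  have h2 : N * (q * L) - 1 + 1 = N * (q * L) := Nat.sub_add_cancel hpos
  have h3 : ((N * (q * L) - 1 : ℕ) : ℝ) + 1 = N * (q * L) := by
    have : (((N * (q * L) - 1 : ℕ) + 1 : ℕ) : ℝ) = ((N * (q * L) : ℕ) : ℝ) := by rw [h2]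
    push_cast at this; exact this
  rw [h3, h2, div_le_iff₀ (by positivity)]
  refine h1.trans ?_
  rw [div_lt_iff₀ (by positivity)] at hq hN
  have e : (Real.log A / L + ε) * (N * (q * L)) = N * (q * Real.log A) + N * (q * (ε * L)) := by
    field_simp
  rw [e]
  have h6 := mul_lt_mul_of_pos_left hq hN0
  nlinarith
end

noncomputable section

/-! ### Uniform measures on finite families and weak limits -/

def unifM {X : Type*} [MeasurableSpace X] {I : Type*} [Fintype I] (s : I → X) : Measure X :=
  (Fintype.card I : ℝ≥0∞)⁻¹ • ∑ i, Measure.dirac (s i)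

lemma unifM_prob {X : Type*} [MeasurableSpace X] {I : Type*} [Fintype I] [Nonempty I] (s : I → X) :
    IsProbabilityMeasure (unifM s) := by
  constructor
  simp [unifM]
  exact ENNReal.inv_mul_cancel (by simp) (by simp)

lemma unifM_real {X : Type*} [MeasurableSpace X] {I : Type*} [Fintype I] (s : I → X)
    {A : Set X} (hA : MeasurableSet A) [DecidablePred fun i => s i ∈ A] :
    (unifM s).real A = ((Finset.univ.filter fun i => s i ∈ A).card : ℝ) / Fintype.card I := by
  simp [unifM, measureReal_def, Measure.dirac_apply' _ hA, Set.indicator_apply, Finset.sum_boole,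
    ENNReal.toReal_mul]
  rw [div_eq_inv_mul]

lemma unifM_compl {X : Type*} [MeasurableSpace X] {I : Type*} [Fintype I] (s : I → X)
    {A : Set X} (hA : MeasurableSet A) (h : ∀ i, s i ∈ A) : unifM s Aᶜ = 0 := by
  simp [unifM, Measure.dirac_apply' _ hA.compl, Set.indicator_apply, h]

lemma unifM_integral {X : Type*} [MeasurableSpace X] {I : Type*} [Fintype I] (s : I → X)
    {f : X → ℝ} (hf : StronglyMeasurable f) :
    ∫ x, f x ∂(unifM s) = (∑ i, f (s i)) / Fintype.card I := by
  rw [unifM, integral_smul_measure, integral_finsetSum_measure]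
  · simp [integral_dirac' f _ hf, div_eq_inv_mul]
  · intro i _
    exact (integrable_dirac' hf (by simp))

theorem exists_limit_measure {X : Type*} [MetricSpace X] [MeasurableSpace X] [BorelSpace X]
    {T : X → X} (hT : Continuous T) (Z : Set X) (hZ : IsCompact Z) {Ω : ℕ → Type}
    [∀ N, Fintype (Ω N)] [∀ N, Nonempty (Ω N)] (z : ∀ N, Ω N → X) (b : ℕ → ℕ)
    (hb : ∀ N, 0 < b N) (hbt : Tendsto b atTop atTop)
    (hz : ∀ N ω j, T^[j] (z N ω) ∈ Z) :
    ∃ (U : Filter ℕ) (μ : Measure X), U.NeBot ∧ U ≤ atTop ∧ IsProbabilityMeasure μ ∧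
      MeasurePreserving T μ μ ∧
      (∀ F, IsClosed F → (∀ N ω j, T^[j] (z N ω) ∈ F) → μ Fᶜ = 0) ∧
      (∀ E, MeasurableSet E → μ (frontier E) = 0 →
        Tendsto (fun N => (unifM fun p : Fin (b N) × Ω N => T^[p.1] (z N p.2)).real E) U
          (𝓝 (μ.real E))) := by
  classical
  haveI : ∀ N, Nonempty (Fin (b N)) := fun N => ⟨⟨0, hb N⟩⟩
  let s : ∀ N, Fin (b N) × Ω N → X := fun N p => T^[p.1] (z N p.2)
  let ν : ℕ → ProbabilityMeasure X := fun N => ⟨unifM (s N), unifM_prob _⟩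
  have htight : IsTightMeasureSet {((μ : ProbabilityMeasure X) : Measure X) | μ ∈ Set.range ν} := by
    rw [isTightMeasureSet_iff_exists_isCompact_measure_compl_le]
    intro ε hε
    refine ⟨Z, hZ, ?_⟩
    rintro _ ⟨_, ⟨N, rfl⟩, rfl⟩
    have : unifM (s N) Zᶜ = 0 := unifM_compl _ hZ.measurableSet (fun p => hz _ _ _)
    exact this.le.trans bot_le
  have hcpt := isCompact_closure_of_isTightMeasureSet htight
  let U : Ultrafilter ℕ := Filter.hyperfilter ℕ
  have hUle : (U : Filter ℕ) ≤ atTop := by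
    rw [← Nat.cofinite_eq_atTop]; exact Filter.hyperfilter_le_cofinite
  obtain ⟨μ, -, hμ⟩ := hcpt.ultrafilter_le_nhds (U.map ν) (by
    rw [le_principal_iff]
    exact Filter.mem_map.2 (Filter.univ_mem' fun N => subset_closure ⟨N, rfl⟩))
  have hlim : Tendsto ν U (𝓝 μ) := hμ
  refine ⟨U, μ, inferInstance, hUle, inferInstance, ?_, ?_, ?_⟩
  · refine ⟨hT.measurable, ?_⟩
    haveI : IsProbabilityMeasure (Measure.map T (μ : Measure X)) :=
      Measure.isProbabilityMeasure_map hT.measurable.aemeasurable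
    apply ext_of_forall_integral_eq_of_IsFiniteMeasure
    intro f
    rw [integral_map hT.measurable.aemeasurable f.continuous.aestronglyMeasurable]
    have h1 := ProbabilityMeasure.tendsto_iff_forall_integral_tendsto.1 hlim f
    have h2 := ProbabilityMeasure.tendsto_iff_forall_integral_tendsto.1 hlim
      (f.compContinuous ⟨T, hT⟩)
    have h3 : Tendsto (fun N => ∫ x, f (T x) ∂(ν N : Measure X) - ∫ x, f x ∂(ν N : Measure X))
        U (𝓝 0) := by
      have hbr : Tendsto (fun N => 2 * ‖f‖ / (b N : ℝ)) U (𝓝 0) :=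
        (Tendsto.const_div_atTop (tendsto_natCast_atTop_atTop.comp hbt) _).mono_left hUle
      refine squeeze_zero_norm (fun N => ?_) hbr
      have e1 : ∫ x, f (T x) ∂(ν N : Measure X) = (∑ p, f (T (s N p))) / Fintype.card (Fin (b N) × Ω N) :=
        unifM_integral (s N) (f.continuous.comp hT).stronglyMeasurable
      have e2 : ∫ x, f x ∂(ν N : Measure X) = (∑ p, f (s N p)) / Fintype.card (Fin (b N) × Ω N) :=
        unifM_integral (s N) f.continuous.stronglyMeasurable
      rw [e1, e2, ← sub_div, ← Finset.sum_sub_distrib, Fintype.sum_prod_type_right]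
      have e3 : ∀ ω, ∑ j : Fin (b N), (f (T (s N (j, ω))) - f (s N (j, ω)))
          = f (T^[b N] (z N ω)) - f (z N ω) := by
        intro ω
        have := Finset.sum_range_sub (fun j => f (T^[j] (z N ω))) (b N)
        rw [← Fin.sum_univ_eq_sum_range (fun j => f (T^[j+1] (z N ω)) - f (T^[j] (z N ω)))] at this
        simpa [s, Function.iterate_succ_apply'] using this
      rw [Finset.sum_congr rfl fun ω _ => e3 ω]
      have hbp : (0:ℝ) < b N := by exact_mod_cast hb N
      have hcp : (0:ℝ) < Fintype.card (Ω N) := by exact_mod_cast Fintype.card_pos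
      rw [norm_div]
      have e4 : ‖∑ ω, (f (T^[b N] (z N ω)) - f (z N ω))‖ ≤ Fintype.card (Ω N) * (2 * ‖f‖) := by
        refine (norm_sum_le _ _).trans ?_
        have : ∀ ω ∈ (Finset.univ : Finset (Ω N)), ‖f (T^[b N] (z N ω)) - f (z N ω)‖ ≤ 2 * ‖f‖ := by
          intro ω _
          refine (norm_sub_le _ _).trans ?_
          have := f.norm_coe_le_norm (T^[b N] (z N ω))
          have := f.norm_coe_le_norm (z N ω)
          linarith
        simpa using Finset.sum_le_sum this
      have e5 : ‖(b N : ℝ) * (Fintype.card (Ω N) : ℝ)‖ = b N * Fintype.card (Ω N) :=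
        Real.norm_of_nonneg (by positivity)
      rw [Fintype.card_prod, Fintype.card_fin, Nat.cast_mul, e5,
        div_le_div_iff₀ (by positivity) hbp]
      nlinarith [mul_le_mul_of_nonneg_right e4 hbp.le]
    have h4 : Tendsto (fun N => ∫ x, f (T x) ∂(ν N : Measure X) - ∫ x, f x ∂(ν N : Measure X))
        U (𝓝 (∫ x, f (T x) ∂(μ : Measure X) - ∫ x, f x ∂(μ : Measure X))) := h2.sub h1
    have := tendsto_nhds_unique h4 h3
    linarith
  · intro F hF h
    have h1 := ProbabilityMeasure.limsup_measure_closed_le_of_tendsto hlim hF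
    have h2 : ∀ N, (ν N : Measure X) F = 1 := fun N =>
      (prob_compl_eq_zero_iff hF.measurableSet).1
        (unifM_compl (s N) hF.measurableSet (fun p => h _ _ _))
    simp only [h2, limsup_const] at h1
    exact (prob_compl_eq_zero_iff hF.measurableSet).2 (le_antisymm prob_le_one h1)
  · intro E hE hE0
    have := ProbabilityMeasure.tendsto_measure_of_null_frontier_of_tendsto' hlim hE0
    exact (ENNReal.tendsto_toReal (measure_ne_top _ _)).comp this

end

noncomputable section

/-! ### Lower bound for the entropy of limit measures -/

lemma avgEnt {I J κ : Type*} [Fintype I] [Fintype J] [Fintype κ] [Nonempty I] [Nonempty J]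
    [DecidableEq κ] (s : I → J → κ) (C : ℕ) (hC : 0 < C)
    (h : ∀ i k, (Finset.univ.filter fun θ => s i θ = k).card ≤ C) :
    Real.log (Fintype.card J) - Real.log C ≤
      ∑ k, Real.negMulLog ((∑ i, ∑ θ, if s i θ = k then (1:ℝ) else 0) /
        (Fintype.card I * Fintype.card J)) := by
  have hI : (0:ℝ) < Fintype.card I := by exact_mod_cast Fintype.card_pos
  have hJ : (0:ℝ) < Fintype.card J := by exact_mod_cast Fintype.card_pos
  have hC' : (0:ℝ) < C := by exact_mod_cast hC
  set p : I → κ → ℝ := fun i k => (∑ θ, if s i θ = k then (1:ℝ) else 0) / Fintype.card J with hp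
  have hp0 : ∀ i k, 0 ≤ p i k := fun i k => by
    apply div_nonneg _ hJ.le
    exact Finset.sum_nonneg fun θ _ => by split_ifs <;> norm_num
  have hple : ∀ i k, p i k ≤ C / Fintype.card J := by
    intro i k
    simp only [hp]
    gcongr
    rw [Finset.sum_boole]
    exact_mod_cast h i k
  have hps : ∀ i, ∑ k, p i k = 1 := by
    intro i
    simp only [hp]
    rw [← Finset.sum_div, Finset.sum_comm]
    simp [hJ.ne']
  have e1 : ∀ k, (∑ i, ∑ θ, if s i θ = k then (1:ℝ) else 0) / (Fintype.card I * Fintype.card J)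
      = ∑ i : I, (Fintype.card I : ℝ)⁻¹ • p i k := by
    intro k
    simp only [hp, smul_eq_mul]
    rw [← Finset.mul_sum, ← Finset.sum_div]
    field_simp
  have e2 : ∀ k, ∑ i : I, (Fintype.card I : ℝ)⁻¹ • Real.negMulLog (p i k) ≤
      Real.negMulLog (∑ i : I, (Fintype.card I : ℝ)⁻¹ • p i k) := by
    intro k
    refine Real.concaveOn_negMulLog.le_map_sum (fun i _ => by positivity) ?_ (fun i _ => hp0 i k)
    simp [hI.ne']
  have e3 : ∀ i k, p i k * (Real.log (Fintype.card J) - Real.log C) ≤ Real.negMulLog (p i k) := by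
    intro i k
    rcases (hp0 i k).eq_or_lt with h0 | h0
    · simp [← h0]
    · rw [Real.negMulLog, neg_mul, ← mul_neg]
      apply mul_le_mul_of_nonneg_left _ h0.le
      have := Real.log_le_log h0 (hple i k)
      rw [Real.log_div hC'.ne' hJ.ne'] at this
      linarith
  calc Real.log (Fintype.card J) - Real.log C
      = ∑ i : I, (Fintype.card I : ℝ)⁻¹ * ∑ k, p i k * (Real.log (Fintype.card J) - Real.log C) := by
        simp only [← Finset.sum_mul, hps, one_mul]
        simp [hI.ne']
    _ ≤ ∑ i : I, (Fintype.card I : ℝ)⁻¹ * ∑ k, Real.negMulLog (p i k) := by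
        refine Finset.sum_le_sum fun i _ => mul_le_mul_of_nonneg_left
          (Finset.sum_le_sum fun k _ => e3 i k) (by positivity)
    _ = ∑ k, ∑ i : I, (Fintype.card I : ℝ)⁻¹ • Real.negMulLog (p i k) := by
        simp only [Finset.mul_sum, smul_eq_mul]
        rw [Finset.sum_comm]
    _ ≤ _ := Finset.sum_le_sum fun k _ => by rw [e1]; exact e2 k

def splice {K M l : ℕ} (i0 : ℕ) (η : Fin M → Fin K) (θ : Fin l → Fin K) : Fin M → Fin K :=
  fun k => if h : i0 ≤ k.1 ∧ k.1 < i0 + l then θ ⟨k.1 - i0, by omega⟩ else η k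

def takeB {K M l : ℕ} (i0 : ℕ) (h : i0 + l ≤ M) (η : Fin M → Fin K) : Fin l → Fin K :=
  fun i => η ⟨i0 + i.1, by omega⟩

lemma takeB_splice {K M l : ℕ} (i0 : ℕ) (h : i0 + l ≤ M) (η : Fin M → Fin K) (θ : Fin l → Fin K) :
    takeB i0 h (splice i0 η θ) = θ := by
  ext i
  have : i0 ≤ i0 + i.1 ∧ i0 + i.1 < i0 + l := by omega
  simp [takeB, splice, this]

lemma splice_splice {K M l : ℕ} (i0 : ℕ) (h : i0 + l ≤ M) (η : Fin M → Fin K) (θ : Fin l → Fin K) :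
    splice i0 (splice i0 η θ) (takeB i0 h η) = η := by
  ext k
  by_cases hk : i0 ≤ k.1 ∧ k.1 < i0 + l
  · have : i0 + (k.1 - i0) = k.1 := by omega
    simp [takeB, splice, hk, this]
  · simp [splice, hk]

lemma sum_splice {K M l : ℕ} (i0 : ℕ) (h : i0 + l ≤ M) (F : (Fin M → Fin K) → ℝ) :
    ∑ η : Fin M → Fin K, ∑ θ : Fin l → Fin K, F (splice i0 η θ) = K ^ l * ∑ ω, F ω := by
  let e : (Fin M → Fin K) × (Fin l → Fin K) → (Fin M → Fin K) × (Fin l → Fin K) :=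
    fun p => (splice i0 p.1 p.2, takeB i0 h p.1)
  have he : Function.Involutive e := by
    rintro ⟨η, θ⟩
    simp only [e]
    rw [takeB_splice, splice_splice]
  rw [← Fintype.sum_prod_type', Finset.mul_sum]
  have := Equiv.sum_comp he.toPerm (fun p : (Fin M → Fin K) × (Fin l → Fin K) => F p.1)
  simp only [Function.Involutive.coe_toPerm, e] at this
  rw [this, Fintype.sum_prod_type]
  simp

lemma frontier_null_iInter {X : Type*} [TopologicalSpace X] [MeasurableSpace X] (μ : Measure X)
    {ι : Type*} [Fintype ι] (s : ι → Set X) (h : ∀ i, μ (frontier (s i)) = 0) :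
    μ (frontier (⋂ i, s i)) = 0 := by
  classical
  have : ∀ S : Finset ι, μ (frontier (⋂ i ∈ S, s i)) = 0 := by
    intro S
    induction S using Finset.induction_on with
    | empty => simp
    | insert a S ha ih =>
      rw [Finset.set_biInter_insert]
      refine measure_mono_null (frontier_inter_subset _ _) (measure_union_null ?_ ?_)
      · exact measure_mono_null Set.inter_subset_left (h a)
      · exact measure_mono_null Set.inter_subset_right ih
  simpa using this Finset.univ

lemma exists_fine_name {X : Type*} [MetricSpace X] [MeasurableSpace X] [BorelSpace X]
    (μ : Measure X) [IsProbabilityMeasure μ] (Z : Set X) (hZ : IsCompact Z) (ε : ℝ) (hε : 0 < ε) :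
    ∃ (k : ℕ) (ξ : X → Fin k), FibMeas ξ ∧ (∀ i, μ (frontier (ξ ⁻¹' {i})) = 0) ∧
      ∀ x ∈ Z, ∀ y ∈ Z, ξ x = ξ y → dist x y < ε := by
  classical
  have h1 : ∀ x : X, ∃ r ∈ Set.Ioo 0 (ε / 2), μ (frontier (Metric.thickening r {x})) = 0 :=
    fun x => exists_null_frontier_thickening μ {x} (by positivity)
  choose r hr hr0 using h1
  simp only [Metric.thickening_singleton] at hr0
  obtain ⟨t, htZ, ht⟩ := hZ.elim_nhds_subcover (fun x => Metric.ball x (r x))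
    (fun x _ => Metric.ball_mem_nhds x (hr x).1)
  let ζ : X → (t → Bool) := fun x i => decide (x ∈ Metric.ball i.1 (r i.1))
  let e := Fintype.equivFin (t → Bool)
  have hfib : ∀ i, (fun x => e (ζ x)) ⁻¹' {i} = ⋂ a : t,
      (if e.symm i a then Metric.ball a.1 (r a.1) else (Metric.ball a.1 (r a.1))ᶜ) := by
    intro i
    ext x
    have : (e (ζ x) = i) ↔ ζ x = e.symm i := by
      rw [← e.apply_eq_iff_eq_symm_apply]
    simp only [Set.mem_preimage, Set.mem_singleton_iff, this, Set.mem_iInter, funext_iff, ζ]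
    refine forall_congr' fun a => ?_
    cases e.symm i a <;> simp
  refine ⟨_, fun x => e (ζ x), ?_, ?_, ?_⟩
  · intro i
    rw [hfib]
    refine MeasurableSet.iInter fun a => ?_
    split_ifs
    · exact measurableSet_ball
    · exact measurableSet_ball.compl
  · intro i
    rw [hfib]
    apply frontier_null_iInter
    intro a
    split_ifs
    · exact hr0 _
    · rw [frontier_compl]; exact hr0 _
  · intro x hx y hy hxy
    obtain ⟨a, ha, hxa⟩ := Set.mem_iUnion₂.1 (ht hx)
    have h2 : ζ x = ζ y := e.injective hxy
    have h3 := congrFun h2 ⟨a, ha⟩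
    simp only [ζ, decide_eq_decide] at h3
    have hya := h3.1 hxa
    rw [Metric.mem_ball] at hxa hya
    have := (hr a).2
    calc dist x y ≤ dist x a + dist y a := dist_triangle_right _ _ _
      _ < ε := by linarith

def extD {K : ℕ} (hK : 0 < K) {M : ℕ} (ω : Fin M → Fin K) : ℕ → Fin K :=
  fun k => if h : k < M then ω ⟨k, h⟩ else ⟨0, hK⟩

theorem lower_measure {X : Type*} [MetricSpace X] [MeasurableSpace X] [BorelSpace X]
    {T : X → X} (hT : Continuous T) (Z : Set X) (hZ : IsCompact Z) (K L : ℕ) (hK : 0 < K)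
    (hL : 0 < L) (z : (ℕ → Fin K) → X) (hz : ∀ ω j, T^[j] (z ω) ∈ Z) (ε : ℝ) (hε : 0 < ε)
    (C : ℕ) (c : ℕ → (ℕ → Fin K) → Fin C)
    (hsep : ∀ i0 l ω ω', (∀ i, i < i0 ∨ i0 + l ≤ i → ω i = ω' i) → c i0 ω = c i0 ω' → ω ≠ ω' →
      ∃ t ≤ l * L, ε ≤ dist (T^[i0 * L + t] (z ω)) (T^[i0 * L + t] (z ω'))) :
    ∃ μ : Measure X, IsProbabilityMeasure μ ∧ MeasurePreserving T μ μ ∧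
      (∀ F, IsClosed F → (∀ ω j, T^[j] (z ω) ∈ F) → μ Fᶜ = 0) ∧
      ∃ (k : ℕ) (P : Fin k → Set X), IsFinPart P ∧
        ∀ N : ℕ, Real.log K / L ≤ partEnt μ (joinPart T P (N + 1)) / (N + 1) := by
  classical
  haveI : Nonempty (Fin K) := ⟨⟨0, hK⟩⟩
  have hC : 0 < C := (c 0 (fun _ => ⟨0, hK⟩)).pos
  have hLr : (0:ℝ) < L := by exact_mod_cast hL
  obtain ⟨U, μ, hU, hUle, hμ, hμT, hμF, hμE⟩ := exists_limit_measure hT Z hZ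
    (Ω := fun N => Fin (2 * (N + 1)) → Fin K) (fun N ω => z (extD hK ω)) (fun N => (N + 1) * L)
    (fun N => by positivity)
    (tendsto_atTop_mono (fun N => (Nat.le_succ N).trans (Nat.le_mul_of_pos_right _ hL)) tendsto_id)
    (fun N ω j => hz _ _)
  refine ⟨μ, hμ, hμT, fun F hF h => hμF F hF fun N ω j => h _ _, ?_⟩
  obtain ⟨k, ξ, hξ, hξ0, hξd⟩ := exists_fine_name μ Z hZ ε hε
  have hfr : ∀ q w, μ (frontier (nameN T ξ q ⁻¹' {w})) = 0 := by
    intro q w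
    have : nameN T ξ q ⁻¹' {w} = ⋂ j : Fin q, T^[(j:ℕ)] ⁻¹' (ξ ⁻¹' {w j}) := by
      ext x; simp [nameN, funext_iff]
    rw [this]
    apply frontier_null_iInter
    intro j
    refine measure_mono_null ((hT.iterate j).frontier_preimage_subset _) ?_
    rw [(hμT.iterate j).measure_preimage isClosed_frontier.measurableSet.nullMeasurableSet]
    exact hξ0 _
  -- main estimate
  have key : ∀ l : ℕ, l * Real.log K - Real.log C ≤ HU μ (nameN T ξ ((l + 1) * L + 1)) := by
    intro l
    set q := (l + 1) * L + 1 with hq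
    have hlim : Tendsto (fun N => HU (unifM fun p : Fin ((N + 1) * L) × (Fin (2 * (N + 1)) → Fin K) =>
        T^[p.1] (z (extD hK p.2))) (nameN T ξ q)) U (𝓝 (HU μ (nameN T ξ q))) := by
      unfold HU
      refine tendsto_finset_sum _ fun w _ => ?_
      exact (Real.continuous_negMulLog.tendsto _).comp
        (hμE _ (fibMeas_nameN hT.measurable hξ q w) (hfr q w))
    refine ge_of_tendsto hlim ?_
    have hev : ∀ᶠ N in U, l ≤ N := hUle (eventually_ge_atTop l)
    filter_upwards [hev] with N hN
    haveI : Nonempty (Fin ((N + 1) * L)) := ⟨⟨0, by positivity⟩⟩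
    let i0 : Fin ((N + 1) * L) → ℕ := fun j => (j.1 + (L - 1)) / L
    have hi0a : ∀ j, j.1 ≤ i0 j * L := by
      intro j
      have h1 := Nat.div_add_mod (j.1 + (L - 1)) L
      have h2 := Nat.mod_lt (j.1 + (L - 1)) hL
      have h3 : L * i0 j = i0 j * L := mul_comm _ _
      simp only [i0] at h3 ⊢
      omega
    have hi0b : ∀ j, i0 j * L ≤ j.1 + (L - 1) := fun j => Nat.div_mul_le_self _ _
    have hi0c : ∀ j, i0 j + l ≤ 2 * (N + 1) := by
      intro j
      have : i0 j < N + 1 + 1 := by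
        apply Nat.div_lt_of_lt_mul
        have := j.2
        have h3 : L * (N + 1 + 1) = (N + 1) * L + L := by ring
        omega
      omega
    let s : Fin ((N + 1) * L) × (Fin (2 * (N + 1)) → Fin K) → (Fin l → Fin K) → (Fin q → Fin k) :=
      fun p θ => nameN T ξ q (T^[p.1] (z (extD hK (splice (i0 p.1) p.2 θ))))
    have havg := avgEnt s C hC (by
      rintro ⟨j, η⟩ w
      have hinj : Set.InjOn (fun θ : Fin l → Fin K => c (i0 j) (extD hK (splice (i0 j) η θ)))
          (Finset.univ.filter fun θ => s (j, η) θ = w : Finset (Fin l → Fin K)) := by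
        intro θ hθ θ' hθ' hcc
        simp only [Finset.coe_filter, Finset.mem_univ, true_and, Set.mem_setOf_eq] at hθ hθ'
        by_contra hne
        obtain ⟨t, ht, hd⟩ := hsep (i0 j) l (extD hK (splice (i0 j) η θ))
          (extD hK (splice (i0 j) η θ')) (by
            intro i hi
            simp only [extD]
            split_ifs with hM
            · have : ¬ (i0 j ≤ i ∧ i < i0 j + l) := by omega
              simp [splice, this]
            · rfl) hcc (by
            intro heq
            apply hne
            rw [← takeB_splice (i0 j) (hi0c j) η θ, ← takeB_splice (i0 j) (hi0c j) η θ']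
            congr 1
            ext1 a
            have := congrFun heq a.1
            simpa [extD] using this)
        have hidx : i0 j * L + t - j.1 < q := by
          have := hi0b j
          have h3 : (l + 1) * L = l * L + L := by ring
          omega
        have hname := congrFun (hθ.trans hθ'.symm) ⟨i0 j * L + t - j.1, hidx⟩
        simp only [s, nameN] at hname
        rw [← Function.iterate_add_apply, ← Function.iterate_add_apply] at hname
        have hsum : i0 j * L + t - j.1 + j.1 = i0 j * L + t := by
          have := hi0a j; omega
        rw [hsum] at hname
        exact absurd (hξd _ (hz _ _) _ (hz _ _) hname) (not_lt.2 hd)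
      have := Finset.card_le_card_of_injOn _ (fun θ _ => Finset.mem_univ _) hinj
      simpa using this)
    have hcard : Real.log (Fintype.card (Fin l → Fin K)) = l * Real.log K := by simp
    rw [hcard] at havg
    refine havg.trans (le_of_eq ?_)
    unfold HU
    refine Finset.sum_congr rfl fun w _ => ?_
    congr 1
    rw [unifM_real _ (fibMeas_nameN hT.measurable hξ q w)]
    have hb : (0:ℝ) < Fintype.card (Fin ((N + 1) * L) × (Fin (2 * (N + 1)) → Fin K)) := by
      exact_mod_cast Fintype.card_pos
    have hKl : (0:ℝ) < K ^ l := by positivity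
    have hcard2 : (Fintype.card (Fin l → Fin K) : ℝ) = K ^ l := by simp
    rw [hcard2, div_eq_div_iff (by positivity) (by positivity)]
    have hsum : (∑ i, ∑ θ, if s i θ = w then (1:ℝ) else 0)
        = K ^ l * ((Finset.univ.filter fun p : Fin ((N + 1) * L) × (Fin (2 * (N + 1)) → Fin K) =>
            T^[p.1] (z (extD hK p.2)) ∈ nameN T ξ q ⁻¹' {w}).card : ℝ) := by
      rw [← Finset.sum_boole, Fintype.sum_prod_type, Fintype.sum_prod_type, Finset.mul_sum]
      refine Finset.sum_congr rfl fun j _ => ?_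
      have h := sum_splice (i0 j) (hi0c j) (fun ω => if T^[j.1] (z (extD hK ω)) ∈ nameN T ξ q ⁻¹' {w}
        then (1:ℝ) else 0)
      rw [← h]
      refine Finset.sum_congr rfl fun y _ => Finset.sum_congr rfl fun θ _ => ?_
      simp only [s, Set.mem_preimage, Set.mem_singleton_iff]
    rw [hsum]
    ring
  refine ⟨k, fun i => ξ ⁻¹' {i}, ⟨hξ, ?_, ?_⟩, ?_⟩
  · intro i j hij
    simp only [Function.onFun]
    rw [Set.disjoint_left]
    intro x hx hx'
    exact hij (hx.symm.trans hx')
  · ext x; simp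
  · intro N
    have hent : partEnt μ (joinPart T (fun i => ξ ⁻¹' {i}) (N + 1)) = HU μ (nameN T ξ (N + 1)) := by
      unfold partEnt HU
      refine Finset.sum_congr rfl fun w _ => ?_
      have : joinPart T (fun i => ξ ⁻¹' {i}) (N + 1) w = nameN T ξ (N + 1) ⁻¹' {w} := by
        ext x; simp [joinPart, nameN, funext_iff]
      rw [this]; rfl
    rw [hent, div_le_div_iff₀ hLr (by positivity)]
    set n := N + 1 with hn
    have hnr : ((N:ℝ) + 1) = n := by simp [hn]
    rw [hnr]
    have hk : ∀ k' : ℕ, 2 ≤ k' → (k' * n - 2 : ℝ) * Real.log K - Real.log C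
        ≤ k' * (HU μ (nameN T ξ n) * L) := by
      intro k' hk'
      obtain ⟨l, hl⟩ : ∃ l, k' * n = l + 2 := ⟨k' * n - 2, by
        have : 2 * 1 ≤ k' * n := Nat.mul_le_mul hk' (by omega)
        omega⟩
      have h1 := key l
      have h2 : HU μ (nameN T ξ ((l + 1) * L + 1)) ≤ HU μ (nameN T ξ ((k' * L) * n)) := by
        have hle : (l + 1) * L + 1 ≤ (k' * L) * n := by
          have : (k' * L) * n = (l + 2) * L := by rw [← hl]; ring
          rw [this]
          have : (l + 2) * L = (l + 1) * L + L := by ring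
          omega
        have := HU_comp_le μ (fibMeas_nameN hT.measurable hξ ((k' * L) * n))
          (fun w : Fin ((k' * L) * n) → Fin k => fun i : Fin ((l + 1) * L + 1) => w (Fin.castLE hle i))
        exact this
      have h3 : HU μ (nameN T ξ ((k' * L) * n)) ≤ ((k' * L : ℕ) : ℝ) * HU μ (nameN T ξ n) := by
        rw [← HU_name_block μ hμT hξ]
        exact HU_name_subadd μ (hμT.iterate n) (fibMeas_nameN hT.measurable hξ n) _
      have h4 : (k' * n - 2 : ℝ) = l := by
        have : ((k' * n : ℕ) : ℝ) = ((l + 2 : ℕ) : ℝ) := by rw [hl]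
        push_cast at this
        linarith
      rw [h4]
      push_cast at h3
      nlinarith
    by_contra hcon
    push Not at hcon
    set δ := Real.log K * n - HU μ (nameN T ξ n) * L with hδ
    have hδ0 : 0 < δ := by linarith
    obtain ⟨k', hk'⟩ := exists_nat_gt ((2 * Real.log K + Real.log C) / δ)
    rw [div_lt_iff₀ hδ0] at hk'
    have h5 := hk (k' + 2) (by omega)
    push_cast at h5
    have h6 : 0 ≤ δ := hδ0.le
    nlinarith
end

noncomputable section


/-! ## Topology of the space of lattices -/

abbrev SLR (d : ℕ) := Matrix.SpecialLinearGroup (Fin d) ℝ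

instance SL_topgroup (d : ℕ) : IsTopologicalGroup (SLR d) :=
  Matrix.SpecialLinearGroup.topologicalGroup

lemma SL_closedEmb (d : ℕ) :
    IsClosedEmbedding (fun g : SLR d => (g : Matrix (Fin d) (Fin d) ℝ)) :=
  Matrix.SpecialLinearGroup.isClosedEmbedding_val

instance SL_sc (d : ℕ) : SecondCountableTopology (SLR d) := by
  have : SecondCountableTopology (Matrix (Fin d) (Fin d) ℝ) :=
    inferInstanceAs (SecondCountableTopology (Fin d → Fin d → ℝ))
  exact (SL_closedEmb d).isEmbedding.secondCountableTopology

instance SL_lc (d : ℕ) : LocallyCompactSpace (SLR d) := by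
  have : LocallyCompactSpace (Matrix (Fin d) (Fin d) ℝ) :=
    inferInstanceAs (LocallyCompactSpace (Fin d → Fin d → ℝ))
  exact (SL_closedEmb d).locallyCompactSpace

instance Gamma_closed (d : ℕ) : IsClosed ((Gamma d : Subgroup (SLR d)) : Set (SLR d)) := by
  have h : IsClosedEmbedding (Matrix.SpecialLinearGroup.map (n := Fin d) (Int.castRingHom ℝ)) :=
    Topology.IsClosedEmbedding.specialLinearGroup_map (f := Int.castRingHom ℝ)
      (by simpa using Int.isClosedEmbedding_coe_real)
  simpa [Gamma] using h.isClosed_range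

instance X_borel (d : ℕ) : BorelSpace (XSp d) := ⟨rfl⟩
instance X_t2 (d : ℕ) : T2Space (XSp d) := inferInstance
instance X_sc (d : ℕ) : SecondCountableTopology (XSp d) := inferInstance
instance X_lc (d : ℕ) : LocallyCompactSpace (XSp d) := inferInstance
instance X_csmul (d : ℕ) : ContinuousSMul (SLR d) (XSp d) := inferInstance
instance X_t3 (d : ℕ) : T3Space (XSp d) := inferInstance
instance X_metr (d : ℕ) : TopologicalSpace.MetrizableSpace (XSp d) :=
  TopologicalSpace.metrizableSpace_of_t3_secondCountable _

/-- class of a matrix -/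
def qm {d : ℕ} (g : SLR d) : XSp d := QuotientGroup.mk g

lemma qm_cont (d : ℕ) : Continuous (qm : SLR d → XSp d) := QuotientGroup.continuous_mk

lemma qm_open (d : ℕ) : IsOpenMap (qm : SLR d → XSp d) := QuotientGroup.isOpenMap_coe

lemma qm_surj {d : ℕ} (x : XSp d) : ∃ g : SLR d, qm g = x := QuotientGroup.mk_surjective x

lemma smul_qm {d : ℕ} (h g : SLR d) : h • qm g = qm (h * g) := rfl

lemma qm_eq {d : ℕ} {g h : SLR d} : qm g = qm h ↔ ∃ γ : Matrix.SpecialLinearGroup (Fin d) ℤ,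
    h = g * Matrix.SpecialLinearGroup.map (Int.castRingHom ℝ) γ := by
  unfold qm
  rw [QuotientGroup.eq]
  constructor
  · rintro ⟨γ, hγ⟩; exact ⟨γ, by rw [hγ]; group⟩
  · rintro ⟨γ, rfl⟩; exact ⟨γ, by group⟩

def BddSL (d : ℕ) (R : ℝ) : Set (SLR d) := {g | ∀ i j, |g.1 i j| ≤ R}

lemma BddSL_compact (d : ℕ) (R : ℝ) : IsCompact (BddSL d R) := by
  have h : IsCompact {M : Matrix (Fin d) (Fin d) ℝ | ∀ i j, |M i j| ≤ R} := by
    have : IsCompact (Set.pi Set.univ fun _ : Fin d => Set.pi Set.univ fun _ : Fin d =>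
        Set.Icc (-R) R) := isCompact_univ_pi fun _ => isCompact_univ_pi fun _ => isCompact_Icc
    have e : {M : Matrix (Fin d) (Fin d) ℝ | ∀ i j, |M i j| ≤ R} =
        (Set.pi Set.univ fun _ : Fin d => Set.pi Set.univ fun _ : Fin d =>
        Set.Icc (-R) R : Set (Fin d → Fin d → ℝ)) := by
      ext M
      simp only [Set.mem_setOf_eq, abs_le]
      exact ⟨fun h i _ j _ => h i j, fun h i j => h i trivial j trivial⟩
    rw [e]
    exact this
  exact (SL_closedEmb d).isCompact_preimage h

end

noncomputable section


/-! ## Matrix basics -/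

section basics
variable {m n : ℕ}

/-- the exponent -/
def kap (m n : ℕ) : ℝ := 1 / m + 1 / n

lemma kap_pos (hm : 0 < m) (hn : 0 < n) : 0 < kap m n := by unfold kap; positivity

lemma kap_mul (hm : 0 < m) (hn : 0 < n) : kap m n * (m * n) = m + n := by
  unfold kap; field_simp; ring

lemma sum_split (f : Fin (m + n) → ℝ) :
    ∑ i, f i = (∑ i, f (Fin.castAdd n i)) + ∑ j, f (Fin.natAdd m j) := Fin.sum_univ_add f

lemma aMat_11 (t : ℝ) (i k : Fin m) :
    aMat m n t (Fin.castAdd n i) (Fin.castAdd n k) = if i = k then Real.exp (t / m) else 0 := by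
  simp [aMat, Matrix.one_apply]
lemma aMat_12 (t : ℝ) (i : Fin m) (k : Fin n) :
    aMat m n t (Fin.castAdd n i) (Fin.natAdd m k) = 0 := by
  simp [aMat]
lemma aMat_21 (t : ℝ) (i : Fin n) (k : Fin m) :
    aMat m n t (Fin.natAdd m i) (Fin.castAdd n k) = 0 := by
  simp [aMat]
lemma aMat_22 (t : ℝ) (i k : Fin n) :
    aMat m n t (Fin.natAdd m i) (Fin.natAdd m k) = if i = k then Real.exp (-(t / n)) else 0 := by
  simp [aMat, Matrix.one_apply]
lemma uMat_11 (A : Fin m → Fin n → ℝ) (i k : Fin m) :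
    uMat m n A (Fin.castAdd n i) (Fin.castAdd n k) = if i = k then 1 else 0 := by
  simp [uMat, Matrix.one_apply]
lemma uMat_12 (A : Fin m → Fin n → ℝ) (i : Fin m) (k : Fin n) :
    uMat m n A (Fin.castAdd n i) (Fin.natAdd m k) = A i k := by
  simp [uMat]
lemma uMat_21 (A : Fin m → Fin n → ℝ) (i : Fin n) (k : Fin m) :
    uMat m n A (Fin.natAdd m i) (Fin.castAdd n k) = 0 := by
  simp [uMat]
lemma uMat_22 (A : Fin m → Fin n → ℝ) (i k : Fin n) :
    uMat m n A (Fin.natAdd m i) (Fin.natAdd m k) = if i = k then 1 else 0 := by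
  simp [uMat, Matrix.one_apply]

lemma aMat_mv1 (t : ℝ) (x : Fin (m + n) → ℝ) (i : Fin m) :
    (aMat m n t *ᵥ x) (Fin.castAdd n i) = Real.exp (t / m) * x (Fin.castAdd n i) := by
  rw [Matrix.mulVec, dotProduct, sum_split]
  simp [aMat_11, aMat_12]
lemma aMat_mv2 (t : ℝ) (x : Fin (m + n) → ℝ) (i : Fin n) :
    (aMat m n t *ᵥ x) (Fin.natAdd m i) = Real.exp (-(t / n)) * x (Fin.natAdd m i) := by
  rw [Matrix.mulVec, dotProduct, sum_split]
  simp [aMat_21, aMat_22]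
lemma uMat_mv1 (A : Fin m → Fin n → ℝ) (x : Fin (m + n) → ℝ) (i : Fin m) :
    (uMat m n A *ᵥ x) (Fin.castAdd n i) = x (Fin.castAdd n i) + ∑ j, A i j * x (Fin.natAdd m j) := by
  rw [Matrix.mulVec, dotProduct, sum_split]
  simp [uMat_11, uMat_12]
lemma uMat_mv2 (A : Fin m → Fin n → ℝ) (x : Fin (m + n) → ℝ) (i : Fin n) :
    (uMat m n A *ᵥ x) (Fin.natAdd m i) = x (Fin.natAdd m i) := by
  rw [Matrix.mulVec, dotProduct, sum_split]
  simp [uMat_21, uMat_22]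

lemma vec_ext {x y : Fin (m + n) → ℝ} (h1 : ∀ i, x (Fin.castAdd n i) = y (Fin.castAdd n i))
    (h2 : ∀ j, x (Fin.natAdd m j) = y (Fin.natAdd m j)) : x = y := by
  funext i
  refine Fin.addCases h1 h2 i

lemma SL_ext_mv {d : ℕ} {g h : SLR d} (H : ∀ x, g.1 *ᵥ x = h.1 *ᵥ x) : g = h := by
  apply Subtype.ext
  exact Matrix.mulVec_injective (funext H)

lemma SL_mul_mv {d : ℕ} (g h : SLR d) (x : Fin d → ℝ) : (g * h).1 *ᵥ x = g.1 *ᵥ (h.1 *ᵥ x) := by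
  rw [Matrix.mulVec_mulVec]; rfl

lemma SL_one_mv {d : ℕ} (x : Fin d → ℝ) : (1 : SLR d).1 *ᵥ x = x := by
  show (1 : Matrix (Fin d) (Fin d) ℝ) *ᵥ x = x
  exact Matrix.one_mulVec x

lemma uSL_add (A B : Fin m → Fin n → ℝ) : uSL m n (A + B) = uSL m n A * uSL m n B := by
  apply SL_ext_mv; intro x
  rw [SL_mul_mv]
  simp only [uSL]
  apply vec_ext
  · intro i; simp only [uMat_mv1, uMat_mv2, Pi.add_apply, add_mul, Finset.sum_add_distrib]; ring
  · intro j; simp only [uMat_mv2]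

lemma uSL_zero : uSL m n (0 : Fin m → Fin n → ℝ) = 1 := by
  apply SL_ext_mv; intro x
  rw [SL_one_mv]
  simp only [uSL]
  apply vec_ext
  · intro i; simp [uMat_mv1]
  · intro j; simp only [uMat_mv2]

variable (hm : 0 < m) (hn : 0 < n)

lemma aSL_add (s t : ℝ) : aSL m n hm hn (s + t) = aSL m n hm hn s * aSL m n hm hn t := by
  apply SL_ext_mv; intro x
  rw [SL_mul_mv]
  simp only [aSL]
  apply vec_ext
  · intro i; simp only [aMat_mv1]; rw [← mul_assoc, ← Real.exp_add, add_div]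
  · intro i; simp only [aMat_mv2]; rw [← mul_assoc, ← Real.exp_add, add_div, neg_add]

lemma aSL_zero : aSL m n hm hn 0 = 1 := by
  apply SL_ext_mv; intro x
  rw [SL_one_mv]
  simp only [aSL]
  apply vec_ext
  · intro i; simp [aMat_mv1]
  · intro j; simp [aMat_mv2]

lemma aSL_neg (t : ℝ) : aSL m n hm hn (-t) = (aSL m n hm hn t)⁻¹ := by
  rw [eq_inv_iff_mul_eq_one, ← aSL_add]; simp [aSL_zero]

lemma aSL_uSL (t : ℝ) (A : Fin m → Fin n → ℝ) : aSL m n hm hn t * uSL m n A =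
    uSL m n (fun i j => Real.exp (kap m n * t) * A i j) * aSL m n hm hn t := by
  apply SL_ext_mv; intro x
  rw [SL_mul_mv, SL_mul_mv]
  simp only [aSL, uSL]
  apply vec_ext
  · intro i
    simp only [aMat_mv1, aMat_mv2, uMat_mv1, mul_add, Finset.mul_sum]
    congr 1
    refine Finset.sum_congr rfl fun j _ => ?_
    have : Real.exp (t / m) = Real.exp (kap m n * t) * Real.exp (-(t / n)) := by
      rw [← Real.exp_add]; congr 1; unfold kap; ring
    rw [this]; ring
  · intro j; simp only [aMat_mv2, uMat_mv2]

lemma aAct_iter (j : ℕ) (x : XSp (m + n)) :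
    (aAct m n hm hn)^[j] x = aSL m n hm hn j • x := by
  induction j with
  | zero => simp [aSL_zero]
  | succ k ih =>
    rw [Function.iterate_succ_apply', ih]
    unfold aAct
    rw [smul_smul, ← aSL_add]; push_cast; rw [add_comm (1:ℝ)]

lemma aAct_cont : Continuous (aAct m n hm hn) := by
  unfold aAct; exact continuous_const_smul _

/-- conjugate of a matrix by `a_t` -/
lemma conj_entry (t : ℝ) (w : SLR (m + n)) :
    (∀ i k, (aSL m n hm hn t * w * aSL m n hm hn (-t)).1 (Fin.castAdd n i) (Fin.castAdd n k)
      = w.1 (Fin.castAdd n i) (Fin.castAdd n k)) ∧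
    (∀ i k, (aSL m n hm hn t * w * aSL m n hm hn (-t)).1 (Fin.castAdd n i) (Fin.natAdd m k)
      = Real.exp (kap m n * t) * w.1 (Fin.castAdd n i) (Fin.natAdd m k)) ∧
    (∀ i k, (aSL m n hm hn t * w * aSL m n hm hn (-t)).1 (Fin.natAdd m i) (Fin.castAdd n k)
      = Real.exp (-(kap m n * t)) * w.1 (Fin.natAdd m i) (Fin.castAdd n k)) ∧
    (∀ i k, (aSL m n hm hn t * w * aSL m n hm hn (-t)).1 (Fin.natAdd m i) (Fin.natAdd m k)
      = w.1 (Fin.natAdd m i) (Fin.natAdd m k)) := by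
  have e : (aSL m n hm hn t * w * aSL m n hm hn (-t)).1
    = aMat m n t * w.1 * aMat m n (-t) := rfl
  rw [e]
  have e1 : Real.exp (kap m n * t) = Real.exp (t / m) * Real.exp (t / n) := by
    rw [← Real.exp_add]; congr 1; unfold kap; ring
  have e2 : Real.exp (-(kap m n * t)) = Real.exp (-(t / m)) * Real.exp (-(t / n)) := by
    rw [← Real.exp_add]; congr 1; unfold kap; ring
  have e3 : Real.exp (t / m) * Real.exp (-(t / m)) = 1 := by rw [← Real.exp_add]; simp
  have e4 : Real.exp (t / n) * Real.exp (-(t / n)) = 1 := by rw [← Real.exp_add]; simp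
  refine ⟨fun i k => ?_, fun i k => ?_, fun i k => ?_, fun i k => ?_⟩ <;>
    (simp only [Matrix.mul_apply, sum_split, aMat_11, aMat_12, aMat_21, aMat_22, e1, e2]
     simp [neg_div])
  · linear_combination (w.1 (Fin.castAdd n i) (Fin.castAdd n k)) * e3
  · ring
  · ring
  · linear_combination (w.1 (Fin.natAdd m i) (Fin.natAdd m k)) * e4

end basics

/-- lattice vector -/
def lv {d : ℕ} (g : SLR d) (z : Fin d → ℤ) : Fin d → ℝ := g.1 *ᵥ (fun i => (z i : ℝ))

lemma lv_mul {d : ℕ} (h g : SLR d) (z : Fin d → ℤ) : lv (h * g) z = h.1 *ᵥ lv g z :=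
  SL_mul_mv h g _

lemma lv_sub {d : ℕ} (g : SLR d) (z w : Fin d → ℤ) : lv g (z - w) = lv g z - lv g w := by
  unfold lv
  rw [← Matrix.mulVec_sub]; congr 1; funext i; simp

lemma mv_bound {d : ℕ} (M : Matrix (Fin d) (Fin d) ℝ) {R : ℝ} (hM : ∀ i j, |M i j| ≤ R)
    (x : Fin d → ℝ) (i : Fin d) : |(M *ᵥ x) i| ≤ d * R * ‖x‖ := by
  rw [Matrix.mulVec, dotProduct]
  refine (Finset.abs_sum_le_sum_abs _ _).trans ?_
  have : ∀ j ∈ Finset.univ, |M i j * x j| ≤ R * ‖x‖ := fun j _ => by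
    rw [abs_mul]
    exact mul_le_mul (hM i j) (norm_le_pi_norm x j) (abs_nonneg _) ((abs_nonneg _).trans (hM i j))
  refine (Finset.sum_le_sum this).trans (le_of_eq ?_)
  simp; ring

/-- all nonzero lattice vectors have norm at least `δ` -/
def Good {d : ℕ} (δ : ℝ) (g : SLR d) : Prop := ∀ z : Fin d → ℤ, z ≠ 0 → δ ≤ ‖lv g z‖

/-- action of integer matrices -/
def zm {d : ℕ} (γ : Matrix.SpecialLinearGroup (Fin d) ℤ) : SLR d :=
  Matrix.SpecialLinearGroup.map (Int.castRingHom ℝ) γ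

lemma zm_mv {d : ℕ} (γ : Matrix.SpecialLinearGroup (Fin d) ℤ) (z : Fin d → ℤ) :
    (zm γ).1 *ᵥ (fun i => (z i : ℝ)) = fun i => ((γ.1 *ᵥ z) i : ℝ) := by
  funext i
  simp only [Matrix.mulVec, dotProduct]
  push_cast
  exact Finset.sum_congr rfl fun _ _ => rfl

lemma lv_zm {d : ℕ} (g : SLR d) (γ : Matrix.SpecialLinearGroup (Fin d) ℤ) (z : Fin d → ℤ) :
    lv (g * zm γ) z = lv g (γ.1 *ᵥ z) := by
  rw [lv_mul]; unfold lv; rw [zm_mv]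

lemma zm_ne {d : ℕ} (γ : Matrix.SpecialLinearGroup (Fin d) ℤ) {z : Fin d → ℤ} (hz : z ≠ 0) :
    γ.1 *ᵥ z ≠ 0 := by
  intro h
  apply hz
  have : (γ⁻¹.1 * γ.1) *ᵥ z = 0 := by rw [← Matrix.mulVec_mulVec, h, Matrix.mulVec_zero]
  have e : γ⁻¹.1 * γ.1 = 1 := by
    have := congrArg Subtype.val (inv_mul_cancel γ)
    exact this
  rwa [e, Matrix.one_mulVec] at this

lemma Good_zm {d : ℕ} {δ : ℝ} {g : SLR d} (h : Good δ g)
    (γ : Matrix.SpecialLinearGroup (Fin d) ℤ) : Good δ (g * zm γ) := by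
  intro z hz
  rw [lv_zm]
  exact h _ (zm_ne γ hz)

lemma qm_zm {d : ℕ} (g : SLR d) (γ : Matrix.SpecialLinearGroup (Fin d) ℤ) :
    qm (g * zm γ) = qm g := (qm_eq.2 ⟨γ, rfl⟩).symm

/-- if two matrices have the same class, lattice vectors correspond -/
lemma lv_of_qm_eq {d : ℕ} {g h : SLR d} (e : qm g = qm h) {z : Fin d → ℤ} (hz : z ≠ 0) :
    ∃ z' : Fin d → ℤ, z' ≠ 0 ∧ lv g z' = lv h z := by
  obtain ⟨γ, rfl⟩ := qm_eq.1 e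
  exact ⟨γ.1 *ᵥ z, zm_ne γ hz, (lv_zm g γ z).symm⟩

lemma int_vec_norm {d : ℕ} {z : Fin d → ℤ} (hz : z ≠ 0) : 1 ≤ ‖(fun i => (z i : ℝ))‖ := by
  obtain ⟨i, hi⟩ := Function.ne_iff.1 hz
  refine le_trans ?_ (norm_le_pi_norm (fun i => (z i : ℝ)) i)
  rw [Real.norm_eq_abs]
  have := Int.one_le_abs (show z i ≠ 0 from hi)
  exact_mod_cast this

lemma SL_inv_mv {d : ℕ} (g : SLR d) (x : Fin d → ℝ) : g⁻¹.1 *ᵥ (g.1 *ᵥ x) = x := by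
  rw [← SL_mul_mv, inv_mul_cancel, SL_one_mv]

lemma SL_mv_inv {d : ℕ} (g : SLR d) (x : Fin d → ℝ) : g.1 *ᵥ (g⁻¹.1 *ᵥ x) = x := by
  rw [← SL_mul_mv, mul_inv_cancel, SL_one_mv]

/-- inverse bound -/
lemma inv_bdd (d : ℕ) (R : ℝ) : ∃ R' : ℝ, 1 ≤ R' ∧ ∀ g ∈ BddSL d R, ∀ i j, |g⁻¹.1 i j| ≤ R' := by
  have hc : IsCompact ((fun g : SLR d => g⁻¹) '' BddSL d R) :=
    (BddSL_compact d R).image continuous_inv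
  have h : ∀ i j, ∃ C, ∀ g ∈ BddSL d R, |g⁻¹.1 i j| ≤ C := by
    intro i j
    have hcont : Continuous (fun g : SLR d => |g⁻¹.1 i j|) := by
      have h1 : Continuous fun g : SLR d => (g⁻¹).1 := (SL_closedEmb d).continuous.comp continuous_inv
      exact (h1.matrix_elem i j).abs
    obtain ⟨C, hC⟩ := ((BddSL_compact d R).image hcont).bddAbove
    exact ⟨C, fun g hg => hC ⟨g, hg, rfl⟩⟩
  choose C hC using h
  refine ⟨1 + ∑ i, ∑ j, |C i j|, ?_, ?_⟩
  · have : 0 ≤ ∑ i, ∑ j, |C i j| := Finset.sum_nonneg fun _ _ => Finset.sum_nonneg fun _ _ => abs_nonneg _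
    linarith
  · intro g hg i j
    have h1 : |C i j| ≤ ∑ j, |C i j| :=
      Finset.single_le_sum (f := fun j => |C i j|) (fun _ _ => abs_nonneg _) (Finset.mem_univ j)
    have h2 : ∑ j, |C i j| ≤ ∑ i, ∑ j, |C i j| :=
      Finset.single_le_sum (f := fun i => ∑ j, |C i j|)
        (fun _ _ => Finset.sum_nonneg fun _ _ => abs_nonneg _) (Finset.mem_univ i)
    have h3 := (hC i j g hg).trans (le_abs_self _)
    linarith

end

noncomputable section


/-! ## Mahler criterion -/

lemma vol_pre_det {d : ℕ} (M : Matrix (Fin d) (Fin d) ℝ) (hM : M.det ≠ 0) (s : Set (Fin d → ℝ)) :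
    volume ((fun x => M *ᵥ x) ⁻¹' s) = ENNReal.ofReal |M.det⁻¹| * volume s := by
  have h := Measure.addHaar_preimage_linearMap (volume : Measure (Fin d → ℝ))
    (f := Matrix.toLin' M) (by rwa [LinearMap.det_toLin']) s
  rw [LinearMap.det_toLin'] at h
  exact h

lemma mink {d : ℕ} (g : SLR d) (s : Fin d → ℝ) (hs : ∀ i, 0 < s i) (h : 1 < ∏ i, s i) :
    ∃ z : Fin d → ℤ, z ≠ 0 ∧ ∀ i, |lv g z i| < s i := by
  set b := Pi.basisFun ℝ (Fin d)
  set S : Set (Fin d → ℝ) := (fun x => g.1 *ᵥ x) ⁻¹' (Set.pi Set.univ fun i => Set.Ioo (-s i) (s i))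
  have hmem : ∀ x, x ∈ S ↔ ∀ i, |(g.1 *ᵥ x) i| < s i := by
    intro x; simp [S, Set.mem_pi, abs_lt]
  have hvolS : volume S = ENNReal.ofReal (∏ i, (2 * s i)) := by
    rw [vol_pre_det _ (by rw [g.2]; norm_num), Real.volume_pi_Ioo, g.2]
    rw [ENNReal.ofReal_prod_of_nonneg (fun i _ => by have := hs i; positivity)]
    simp only [inv_one, abs_one, ENNReal.ofReal_one, one_mul]
    refine Finset.prod_congr rfl fun i _ => ?_
    congr 1; ring
  have hcount : Countable (Submodule.span ℤ (Set.range b)).toAddSubgroup := by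
    show Countable (Submodule.span ℤ (Set.range b))
    infer_instance
  have hF : volume (ZSpan.fundamentalDomain b) = 1 := by
    rw [ZSpan.volume_fundamentalDomain]
    have : (Matrix.of b) = (1 : Matrix (Fin d) (Fin d) ℝ) := by
      ext i j; simp [b, Matrix.one_apply, Pi.single_apply, eq_comm]
    rw [this]; simp
  obtain ⟨x, hx0, hxS⟩ := exists_ne_zero_mem_lattice_of_measure_mul_two_pow_lt_measure
    (μ := (volume : Measure (Fin d → ℝ)))
    (L := (Submodule.span ℤ (Set.range b)).toAddSubgroup) (s := S)
    (ZSpan.isAddFundamentalDomain b volume) (by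
      intro x hx; rw [hmem] at hx ⊢
      intro i; rw [Matrix.mulVec_neg]; simpa using hx i)
    (by
      have : Convex ℝ (Set.pi Set.univ fun i => Set.Ioo (-s i) (s i)) :=
        convex_pi fun i _ => convex_Ioo _ _
      exact this.linear_preimage (Matrix.toLin' g.1))
    (by
      rw [hF, hvolS, one_mul, Finset.prod_mul_distrib]
      simp only [Finset.prod_const, Finset.card_univ, Fintype.card_fin, Module.finrank_fin_fun]
      rw [← ENNReal.ofReal_ofNat, ← ENNReal.ofReal_pow (by norm_num)]
      have h2 : (0:ℝ) < 2 ^ d := by positivity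
      apply (ENNReal.ofReal_lt_ofReal_iff (by nlinarith)).2
      nlinarith)
  have hx := (b.mem_span_iff_repr_mem ℤ (x : Fin d → ℝ)).1 x.2
  choose z hz using hx
  have hxz : (x : Fin d → ℝ) = fun i => (z i : ℝ) := by
    funext i
    have := hz i
    simp [b] at this
    exact this.symm
  refine ⟨z, ?_, ?_⟩
  · rintro rfl
    apply hx0
    apply Subtype.ext
    rw [hxz]; funext i; simp
  · rw [hmem, hxz] at hxS; exact hxS

lemma short_span {d : ℕ} {δ : ℝ} (hδ : 0 < δ) : ∃ R : ℝ, 0 < R ∧ ∀ g : SLR d, Good δ g →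
    Submodule.span ℝ {x | ∃ z : Fin d → ℤ, ‖lv g z‖ ≤ R ∧ x = lv g z} = ⊤ := by
  set r : ℝ := δ / (2 * (d + 1)) with hr
  have hr0 : 0 < r := by positivity
  refine ⟨(r⁻¹) ^ d + (r⁻¹) ^ (d - 1) + r + 1, by positivity, fun g hg => ?_⟩
  set R : ℝ := (r⁻¹) ^ d + (r⁻¹) ^ (d - 1) + r + 1 with hR
  by_contra hne
  obtain ⟨f, hf0, hf⟩ := Submodule.exists_le_ker_of_lt_top _ (lt_top_iff_ne_top.2 hne)
  have hf' : ∀ x, f x = ∑ i, f (Pi.single i 1) * x i := by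
    intro x
    conv_lhs => rw [← Finset.univ_sum_single x]
    rw [map_sum]
    refine Finset.sum_congr rfl fun i _ => ?_
    have : Pi.single i (x i) = x i • (Pi.single i 1 : Fin d → ℝ) := by
      rw [← Pi.single_smul]; simp
    rw [this, map_smul, smul_eq_mul, mul_comm]
  have hd : Nonempty (Fin d) := by
    by_contra hd
    rw [not_nonempty_iff] at hd
    apply hf0
    ext x
    exact (hd.false x).elim
  obtain ⟨i0, hi0⟩ := Finite.exists_max (fun i => |f (Pi.single i 1)|)
  have hc0 : 0 < |f (Pi.single i0 1)| := by
    rcases (abs_nonneg (f (Pi.single i0 1))).lt_or_eq with h | h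
    · exact h
    · exfalso; apply hf0
      ext i
      have := hi0 i
      rw [← h] at this
      simpa using abs_nonpos_iff.1 this
  obtain ⟨z, hz0, hz⟩ := mink g (fun i => if i = i0 then R else r)
    (fun i => by split_ifs <;> positivity) (by
      rw [← Finset.mul_prod_erase _ _ (Finset.mem_univ i0)]
      rw [Finset.prod_congr rfl (g := fun _ => r) (fun i hi => by
        rw [if_neg (Finset.ne_of_mem_erase hi)])]
      simp only [if_true, Finset.prod_const, Finset.card_erase_of_mem (Finset.mem_univ i0),
        Finset.card_univ, Fintype.card_fin]
      have h1 : (r⁻¹) ^ (d - 1) * r ^ (d - 1) = 1 := by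
        rw [← mul_pow, inv_mul_cancel₀ hr0.ne', one_pow]
      have h2 : 0 < r ^ (d - 1) := by positivity
      have h3 : 0 < (r⁻¹) ^ d := by positivity
      rw [hR]
      nlinarith [mul_pos h3 h2, mul_pos hr0 h2])
  have hzn : ∀ i, |lv g z i| ≤ R := by
    intro i
    have := hz i
    split_ifs at this
    · exact this.le
    · have h3 : 0 < (r⁻¹) ^ d := by positivity
      have h4 : 0 < (r⁻¹) ^ (d-1) := by positivity
      rw [hR]; linarith
  have hRpos : 0 < R := by positivity
  have hfz : f (lv g z) = 0 := by
    apply hf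
    apply Submodule.subset_span
    exact ⟨z, (pi_norm_le_iff_of_nonneg hRpos.le).2 hzn, rfl⟩
  rw [hf', ← Finset.add_sum_erase _ _ (Finset.mem_univ i0)] at hfz
  have hb : |f (Pi.single i0 1)| * |lv g z i0| ≤ |f (Pi.single i0 1)| * (d * r) := by
    rw [← abs_mul]
    have : f (Pi.single i0 1) * lv g z i0
      = - ∑ i ∈ Finset.univ.erase i0, f (Pi.single i 1) * lv g z i := by linarith
    rw [this, abs_neg]
    refine (Finset.abs_sum_le_sum_abs _ _).trans ?_
    have : ∀ i ∈ Finset.univ.erase i0, |f (Pi.single i 1) * lv g z i| ≤ |f (Pi.single i0 1)| * r := by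
      intro i hi
      rw [abs_mul]
      have h1 := hz i
      rw [if_neg (Finset.ne_of_mem_erase hi)] at h1
      exact mul_le_mul (hi0 i) h1.le (abs_nonneg _) hc0.le
    refine (Finset.sum_le_sum this).trans ?_
    rw [Finset.sum_const, nsmul_eq_mul, Finset.card_erase_of_mem (Finset.mem_univ i0),
      Finset.card_univ, Fintype.card_fin]
    have : ((d - 1 : ℕ) : ℝ) ≤ d := by exact_mod_cast Nat.sub_le _ _
    nlinarith [mul_nonneg hc0.le hr0.le]
  have hb' := le_of_mul_le_mul_left hb hc0
  have hd1 : (1:ℝ) ≤ d := by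
    have : 0 < d := by obtain ⟨i⟩ := hd; exact i.pos
    exact_mod_cast this
  have hlast : ‖lv g z‖ ≤ d * r := by
    refine (pi_norm_le_iff_of_nonneg (by positivity)).2 fun i => ?_
    rw [Real.norm_eq_abs]
    by_cases h : i = i0
    · rw [h]; exact hb'
    · have := hz i
      rw [if_neg h] at this
      nlinarith
  have := hg z hz0
  have : (d:ℝ) * r < δ := by
    rw [hr]; rw [mul_div_assoc', div_lt_iff₀ (by positivity)]; nlinarith
  linarith

lemma short_basis {d : ℕ} {δ : ℝ} (hδ : 0 < δ) : ∃ R : ℝ, 0 < R ∧ ∀ g : SLR d, Good δ g →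
    ∃ W : Matrix (Fin d) (Fin d) ℤ, W.det ≠ 0 ∧
      ∀ i j, |(g.1 * W.map (fun x => (x : ℝ))) i j| ≤ R := by
  obtain ⟨R, hR, h⟩ := short_span (d := d) hδ
  refine ⟨R, hR, fun g hg => ?_⟩
  obtain ⟨b, hbS, hbspan, hbli⟩ := exists_linearIndependent ℝ
    {x | ∃ z : Fin d → ℤ, ‖lv g z‖ ≤ R ∧ x = lv g z}
  rw [h g hg] at hbspan
  let B : Module.Basis b ℝ (Fin d → ℝ) := Module.Basis.mk hbli (by simp [hbspan])
  let e : b ≃ Fin d := B.indexEquiv (Pi.basisFun ℝ (Fin d))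
  have hz : ∀ k : Fin d, ∃ z : Fin d → ℤ, ‖lv g z‖ ≤ R ∧ ((e.symm k : b) : Fin d → ℝ) = lv g z :=
    fun k => hbS (e.symm k).2
  choose z hzn hze using hz
  let W : Matrix (Fin d) (Fin d) ℤ := Matrix.of fun i k => z k i
  have hent : ∀ i k, (g.1 * W.map (fun x => (x : ℝ))) i k = lv g (z k) i := by
    intro i k; rfl
  refine ⟨W, ?_, fun i k => ?_⟩
  · have hu : IsUnit (g.1 * W.map (fun x => (x : ℝ))) := by
      rw [← Matrix.linearIndependent_cols_iff_isUnit]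
      have := hbli.comp e.symm e.symm.injective
      have ec : (g.1 * W.map (fun x => (x : ℝ))).col = Subtype.val ∘ e.symm := by
        funext k i
        show (g.1 * W.map (fun x => (x : ℝ))) i k = ((e.symm k : b) : Fin d → ℝ) i
        rw [hent, hze]
      rw [ec]
      exact this
    rw [Matrix.isUnit_iff_isUnit_det, Matrix.det_mul, g.2, one_mul] at hu
    intro hW
    have hc : (W.map (fun x => (x : ℝ))).det = ((W.det : ℤ) : ℝ) := by
      have := (Int.castRingHom ℝ).map_det W
      simpa using this.symm
    rw [hc, hW] at hu
    simp at hu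
  · rw [hent]
    exact (norm_le_pi_norm (lv g (z k)) i).trans (hzn k)


lemma int_quot {d : ℕ} (Q : ℕ) (W W0 : Matrix (Fin d) (Fin d) ℤ) (h0 : W0.det ≠ 0)
    (hdet : W.det = W0.det) (hk : W0.det ∣ (Q : ℤ))
    (hmod : ∀ i j, (Q : ℤ) ∣ W i j - W0 i j) :
    ∃ γ : Matrix.SpecialLinearGroup (Fin d) ℤ, W = γ.1 * W0 := by
  have hdiv : ∀ i j, W0.det ∣ (W * W0.adjugate) i j := by
    intro i j
    have h1 : W * W0.adjugate = (W - W0) * W0.adjugate + W0.det • 1 := by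
      rw [Matrix.sub_mul, Matrix.mul_adjugate]; abel
    rw [h1]
    simp only [Matrix.add_apply, Matrix.smul_apply, smul_eq_mul]
    refine dvd_add ?_ (dvd_mul_right _ _)
    rw [Matrix.mul_apply]
    exact Finset.dvd_sum fun l _ => Dvd.dvd.mul_right (hk.trans (hmod i l)) _
  choose γ hγ using hdiv
  have hγ' : W * W0.adjugate = W0.det • (Matrix.of γ) := by
    ext i j; rw [hγ i j]; rfl
  have e : W0.det • (Matrix.of γ * W0) = W0.det • W := by
    rw [← Matrix.smul_mul, ← hγ', Matrix.mul_assoc, Matrix.adjugate_mul,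
      Matrix.mul_smul, Matrix.mul_one]
  have e2 : Matrix.of γ * W0 = W := by
    ext i j
    have := congrFun (congrFun e i) j
    simp only [Matrix.smul_apply, smul_eq_mul] at this
    exact mul_left_cancel₀ h0 this
  refine ⟨⟨Matrix.of γ, ?_⟩, e2.symm⟩
  have := congrArg Matrix.det e2
  rw [Matrix.det_mul, hdet] at this
  exact mul_right_cancel₀ h0 (by rw [this, one_mul])

theorem mahlerX {d : ℕ} {δ : ℝ} (hδ : 0 < δ) : ∃ R : ℝ, 1 ≤ R ∧ ∀ g : SLR d, Good δ g →
    ∃ γ, g * zm γ ∈ BddSL d R := by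
  classical
  obtain ⟨R, hR, hb⟩ := short_basis (d := d) hδ
  set M : ℕ := ⌈(d.factorial : ℝ) * R ^ d⌉₊ with hM
  set Q : ℕ := M.factorial with hQ
  have hQ0 : NeZero Q := ⟨Nat.factorial_ne_zero M⟩
  let key : Matrix (Fin d) (Fin d) ℤ → (Fin (2 * M + 1)) × (Fin d → Fin d → ZMod Q) := fun W =>
    (⟨(W.det + M).toNat % (2 * M + 1), Nat.mod_lt _ (by omega)⟩, fun i j => (W i j : ZMod Q))
  have hrep : ∀ k, ∃ W0 : Matrix (Fin d) (Fin d) ℤ,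
      (∃ W, key W = k ∧ W.det ≠ 0 ∧ |W.det| ≤ M) →
      key W0 = k ∧ W0.det ≠ 0 ∧ |W0.det| ≤ M := by
    intro k
    by_cases h : ∃ W, key W = k ∧ W.det ≠ 0 ∧ |W.det| ≤ M
    · obtain ⟨W, hW⟩ := h; exact ⟨W, fun _ => hW⟩
    · exact ⟨0, fun h' => absurd h' h⟩
  choose W0 hW0 using hrep
  let Wr : Matrix (Fin d) (Fin d) ℤ → Matrix (Fin d) (Fin d) ℝ := fun W => W.map (fun x => (x : ℝ))
  set β : ℝ := ∑ k, ∑ i, ∑ j, |(Wr (W0 k))⁻¹ i j| with hβ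
  have hβ0 : 0 ≤ β := Finset.sum_nonneg fun _ _ => Finset.sum_nonneg fun _ _ =>
    Finset.sum_nonneg fun _ _ => abs_nonneg _
  refine ⟨d * R * β + 1, by have : 0 ≤ d * R * β := by positivity
                            linarith, fun g hg => ?_⟩
  obtain ⟨W, hWdet, hWb⟩ := hb g hg
  have hdetr : ∀ W : Matrix (Fin d) (Fin d) ℤ, (Wr W).det = ((W.det : ℤ) : ℝ) := by
    intro W
    have := (Int.castRingHom ℝ).map_det W
    simpa [Wr] using this.symm
  have hWM : |W.det| ≤ M := by
    have h1 := Matrix.det_le (A := g.1 * Wr W) (abv := AbsoluteValue.abs) (x := R)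
      (fun i j => hWb i j)
    rw [Matrix.det_mul, g.2, one_mul, hdetr] at h1
    have h2 : ((|W.det| : ℤ) : ℝ) ≤ M := by
      rw [Int.cast_abs]
      refine le_trans ?_ (Nat.le_ceil _)
      simpa using h1
    exact_mod_cast h2
  set k := key W with hk
  obtain ⟨hk0, hdet0, hdetM⟩ := hW0 k ⟨W, rfl, hWdet, hWM⟩
  have hkk : key W = key (W0 k) := hk0.symm
  have hdeq : W.det = (W0 k).det := by
    have := congrArg (fun p => (p.1 : ℕ)) hkk
    simp only [key] at this
    rw [abs_le] at hWM hdetM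
    rw [Nat.mod_eq_of_lt (by omega), Nat.mod_eq_of_lt (by omega)] at this
    omega
  obtain ⟨γ, hγ⟩ := int_quot Q W (W0 k) hdet0 hdeq (by
    have h1 : (W0 k).det.natAbs ∣ Q := by
      apply Nat.dvd_factorial
      · exact Int.natAbs_pos.2 hdet0
      · rw [abs_le] at hdetM; omega
    exact Int.natAbs_dvd.1 (by exact_mod_cast h1)) (by
    intro i j
    have := congrArg (fun p => p.2 i j) hkk
    simp only [key] at this
    exact (ZMod.intCast_eq_intCast_iff_dvd_sub _ _ _).1 this.symm)
  refine ⟨γ, fun i j => ?_⟩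
  have hu : IsUnit (Wr (W0 k)).det := by
    rw [hdetr]; simpa using hdet0
  have e1 : (g * zm γ).1 = (g.1 * Wr W) * (Wr (W0 k))⁻¹ := by
    have e2 : Wr W = (zm γ).1 * Wr (W0 k) := by
      rw [hγ]
      ext i j
      simp only [Wr, Matrix.map_apply, Matrix.mul_apply]
      push_cast
      rfl
    rw [e2, Matrix.mul_assoc, Matrix.mul_assoc, Matrix.mul_nonsing_inv _ hu, Matrix.mul_one]
    rfl
  rw [e1, Matrix.mul_apply]
  refine (Finset.abs_sum_le_sum_abs _ _).trans ?_
  have : ∀ l ∈ Finset.univ, |(g.1 * Wr W) i l * (Wr (W0 k))⁻¹ l j| ≤ R * β := by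
    intro l _
    rw [abs_mul]
    refine mul_le_mul (hWb i l) ?_ (abs_nonneg _) hR.le
    have h1 : |(Wr (W0 k))⁻¹ l j| ≤ ∑ j, |(Wr (W0 k))⁻¹ l j| :=
      Finset.single_le_sum (f := fun j => |(Wr (W0 k))⁻¹ l j|) (fun _ _ => abs_nonneg _)
        (Finset.mem_univ j)
    have h2 : ∑ j, |(Wr (W0 k))⁻¹ l j| ≤ ∑ l, ∑ j, |(Wr (W0 k))⁻¹ l j| :=
      Finset.single_le_sum (f := fun l => ∑ j, |(Wr (W0 k))⁻¹ l j|)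
        (fun _ _ => Finset.sum_nonneg fun _ _ => abs_nonneg _) (Finset.mem_univ l)
    have h3 : ∑ l, ∑ j, |(Wr (W0 k))⁻¹ l j| ≤ β :=
      Finset.single_le_sum (f := fun k => ∑ l, ∑ j, |(Wr (W0 k))⁻¹ l j|)
        (fun _ _ => Finset.sum_nonneg fun _ _ => Finset.sum_nonneg fun _ _ => abs_nonneg _)
        (Finset.mem_univ k)
    linarith
  refine (Finset.sum_le_sum this).trans ?_
  simp
  linarith

/-- bounded matrices are good -/
lemma bdd_good (d : ℕ) (R : ℝ) : ∃ δ : ℝ, 0 < δ ∧ ∀ g ∈ BddSL d R, Good δ g := by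
  obtain ⟨R', hR', h⟩ := inv_bdd d R
  refine ⟨(d * R' + 1)⁻¹, by positivity, fun g hg z hz => ?_⟩
  have h1 := int_vec_norm hz
  have h2 : ‖(fun i => (z i : ℝ))‖ ≤ d * R' * ‖lv g z‖ := by
    refine (pi_norm_le_iff_of_nonneg (by positivity)).2 fun i => ?_
    have := mv_bound g⁻¹.1 (h g hg) (lv g z) i
    unfold lv at this
    rw [SL_inv_mv] at this
    exact this
  rw [inv_le_iff_one_le_mul₀ (by positivity)]
  nlinarith [norm_nonneg (lv g z)]

end

noncomputable section


/-! ## Volume of slabs and counting lattice points -/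

lemma det_updateRow_one {d : ℕ} (k : Fin d) (b : Fin d → ℝ) :
    ((1 : Matrix (Fin d) (Fin d) ℝ).updateRow k b).det = b k := by
  rw [← Matrix.cramer_transpose_apply]; simp

lemma det_updateCol_one {d : ℕ} (k : Fin d) (b : Fin d → ℝ) :
    ((1 : Matrix (Fin d) (Fin d) ℝ).updateCol k b).det = b k := by
  rw [← Matrix.cramer_apply]; simp

lemma slab_vol {n : ℕ} (b : Fin n → ℝ) (k : Fin n) (hb : b k ≠ 0) (c ε : ℝ) (hε : 0 ≤ ε) :
    volume {x : Fin n → ℝ | (∀ j, |x j| ≤ 1) ∧ |c + ∑ j, b j * x j| ≤ ε}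
      ≤ ENNReal.ofReal (2 ^ n * ε / |b k|) := by
  set M : Matrix (Fin n) (Fin n) ℝ := (1 : Matrix (Fin n) (Fin n) ℝ).updateRow k b
  have hdet : M.det = b k := det_updateRow_one k b
  set lo : Fin n → ℝ := fun j => if j = k then -ε - c else -1
  set hi : Fin n → ℝ := fun j => if j = k then ε - c else 1
  have hsub : {x : Fin n → ℝ | (∀ j, |x j| ≤ 1) ∧ |c + ∑ j, b j * x j| ≤ ε}
      ⊆ (fun x => M *ᵥ x) ⁻¹' (Set.Icc lo hi) := by
    rintro x ⟨hx, hx2⟩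
    have hMk : (M *ᵥ x) k = ∑ j, b j * x j := by
      simp [M, Matrix.mulVec, dotProduct, Matrix.updateRow_self]
    have hMj : ∀ j, j ≠ k → (M *ᵥ x) j = x j := by
      intro j hj
      simp [M, Matrix.mulVec, dotProduct, Matrix.updateRow_ne hj, Matrix.one_apply]
    rw [abs_le] at hx2
    constructor
    · intro j
      by_cases h : j = k
      · subst h; simp only [lo, if_true, hMk]; linarith
      · simp only [lo, if_neg h, hMj j h]; exact (abs_le.1 (hx j)).1
    · intro j
      by_cases h : j = k
      · subst h; simp only [hi, if_true, hMk]; linarith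
      · simp only [hi, if_neg h, hMj j h]; exact (abs_le.1 (hx j)).2
  refine (measure_mono hsub).trans ?_
  rw [vol_pre_det M (by rwa [hdet]), hdet, Real.volume_Icc_pi,
    ← ENNReal.ofReal_prod_of_nonneg, ← ENNReal.ofReal_mul (abs_nonneg _)]
  · apply ENNReal.ofReal_le_ofReal
    rw [← Finset.mul_prod_erase _ _ (Finset.mem_univ k),
      Finset.prod_congr rfl (g := fun _ => (2:ℝ)) (fun i hi' => by
        simp only [hi, lo, if_neg (Finset.ne_of_mem_erase hi')]; norm_num)]
    simp only [hi, lo, if_true, Finset.prod_const, Finset.card_erase_of_mem (Finset.mem_univ k),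
      Finset.card_univ, Fintype.card_fin]
    have h2 : (2:ℝ) ^ n = 2 ^ (n - 1) * 2 := by
      rw [← pow_succ]; congr 1; have := k.pos; omega
    rw [h2, abs_inv]
    apply le_of_eq
    have : |b k| ≠ 0 := abs_ne_zero.2 hb
    field_simp
    ring
  · intro i _
    by_cases h : i = k
    · simp only [hi, lo, if_pos h]; linarith
    · simp only [hi, lo, if_neg h]; norm_num

lemma slab_vol_m {m n : ℕ} (b : Fin n → ℝ) (k : Fin n) (hb : b k ≠ 0) (c : Fin m → ℝ) (ε : ℝ)
    (hε : 0 ≤ ε) :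
    volume {t : Fin m → Fin n → ℝ | (∀ i j, |t i j| ≤ 1) ∧ ∀ i, |c i + ∑ j, b j * t i j| ≤ ε}
      ≤ ENNReal.ofReal ((2 ^ n * ε / |b k|) ^ m) := by
  have e : {t : Fin m → Fin n → ℝ | (∀ i j, |t i j| ≤ 1) ∧ ∀ i, |c i + ∑ j, b j * t i j| ≤ ε}
    = Set.pi Set.univ fun i => {x : Fin n → ℝ | (∀ j, |x j| ≤ 1) ∧ |c i + ∑ j, b j * x j| ≤ ε} := by
    ext t
    simp only [Set.mem_setOf_eq, Set.mem_pi, Set.mem_univ, true_implies]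
    exact ⟨fun h i => ⟨h.1 i, h.2 i⟩, fun h => ⟨fun i => (h i).1, fun i => (h i).2⟩⟩
  rw [e, volume_pi_pi]
  refine (Finset.prod_le_prod' fun i _ => slab_vol b k hb (c i) ε hε).trans ?_
  rw [Finset.prod_const, Finset.card_univ, Fintype.card_fin, ENNReal.ofReal_pow]
  positivity

lemma box_vol {m n : ℕ} (τ : Fin n → ℝ) (hτ : ∀ j, 0 ≤ τ j) (t0 : Fin m → Fin n → ℝ) :
    volume {t : Fin m → Fin n → ℝ | ∀ i j, |t i j - t0 i j| ≤ τ j}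
      = ENNReal.ofReal ((∏ j, (2 * τ j)) ^ m) := by
  have e : {t : Fin m → Fin n → ℝ | ∀ i j, |t i j - t0 i j| ≤ τ j}
    = Set.pi Set.univ fun i => Set.Icc (fun j => t0 i j - τ j) (fun j => t0 i j + τ j) := by
    ext t
    simp only [Set.mem_setOf_eq, Set.mem_pi, Set.mem_univ, true_implies, Set.mem_Icc, abs_le,
      Pi.le_def]
    constructor
    · intro h i; exact ⟨fun j => by linarith [(h i j).1], fun j => by linarith [(h i j).2]⟩
    · intro h i j; exact ⟨by linarith [(h i).1 j], by linarith [(h i).2 j]⟩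
  rw [e, volume_pi_pi]
  simp only [Real.volume_Icc_pi]
  rw [Finset.prod_congr rfl (g := fun _ => ENNReal.ofReal (∏ j, (2 * τ j))) (fun i _ => by
    rw [ENNReal.ofReal_prod_of_nonneg (fun j _ => by have := hτ j; positivity)]
    refine Finset.prod_congr rfl fun j _ => ?_
    congr 1; ring)]
  rw [Finset.prod_const, Finset.card_univ, Fintype.card_fin, ENNReal.ofReal_pow]
  exact Finset.prod_nonneg fun j _ => by have := hτ j; positivity

/-- counting integer points mapped into a box by a unimodular matrix -/
lemma count_box {d : ℕ} (M : Matrix (Fin d) (Fin d) ℝ) (hM : |M.det| = 1) (D : ℝ)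
    (hD : ∀ x : Fin d → ℝ, (∀ i, 0 ≤ x i ∧ x i ≤ 1) → ∀ i, |(M *ᵥ x) i| ≤ D)
    (S : Finset (Fin d → ℤ)) (s : Fin d → ℝ) (hs : ∀ i, 0 ≤ s i + D)
    (h : ∀ z ∈ S, ∀ i, |(M *ᵥ (fun i => (z i : ℝ))) i| ≤ s i) :
    (S.card : ℝ) ≤ ∏ i, (2 * (s i + D)) := by
  have hM0 : M.det ≠ 0 := by intro h; rw [h] at hM; norm_num at hM
  set cube : (Fin d → ℤ) → Set (Fin d → ℝ) := fun z =>
    Set.pi Set.univ fun i => Set.Ico (z i : ℝ) (z i + 1)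
  have hvol : ∀ z, volume (cube z) = 1 := by
    intro z; simp only [cube]; rw [Real.volume_pi_Ico]; simp
  have hdisj : ∀ z ∈ S, ∀ w ∈ S, z ≠ w → Disjoint (cube z) (cube w) := by
    intro z _ w _ hzw
    rw [Set.disjoint_left]
    intro x hx hx'
    apply hzw
    funext i
    have h1 := hx i trivial
    have h2 := hx' i trivial
    have := Int.floor_eq_iff.2 (show ((z i : ℤ) : ℝ) ≤ x i ∧ x i < z i + 1 from h1)
    have := Int.floor_eq_iff.2 (show ((w i : ℤ) : ℝ) ≤ x i ∧ x i < w i + 1 from h2)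
    omega
  have hmeas : ∀ z ∈ S, MeasurableSet (cube z) := fun z _ =>
    MeasurableSet.univ_pi fun i => measurableSet_Ico
  have hsum : volume (⋃ z ∈ S, cube z) = S.card := by
    rw [measure_biUnion_finset (fun z hz w hw hzw => hdisj z hz w hw hzw) hmeas]
    simp [hvol]
  have hsub : (⋃ z ∈ S, cube z) ⊆ (fun x => M *ᵥ x) ⁻¹'
      (Set.Icc (fun i => -(s i + D)) (fun i => s i + D)) := by
    intro x hx
    simp only [Set.mem_iUnion] at hx
    obtain ⟨z, hz, hx⟩ := hx
    have hb : ∀ i, |(M *ᵥ x) i| ≤ s i + D := by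
      intro i
      have e : x = (fun i => (z i : ℝ)) + (x - fun i => (z i : ℝ)) := by abel
      rw [e, Matrix.mulVec_add, Pi.add_apply]
      refine (abs_add_le _ _).trans (add_le_add (h z hz i) (hD _ (fun j => ?_) i))
      have := hx j trivial
      simp only [Pi.sub_apply]
      exact ⟨by linarith [this.1], by linarith [this.2]⟩
    exact ⟨fun i => (abs_le.1 (hb i)).1, fun i => (abs_le.1 (hb i)).2⟩
  have hle := measure_mono (μ := volume) hsub
  rw [hsum, vol_pre_det M hM0, Real.volume_Icc_pi, abs_inv, hM, inv_one, ENNReal.ofReal_one,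
    one_mul, ← ENNReal.ofReal_prod_of_nonneg (fun i _ => by have := hs i; linarith),
    ← ENNReal.ofReal_natCast] at hle
  have := (ENNReal.ofReal_le_ofReal_iff (Finset.prod_nonneg fun i _ => by
    have := hs i; linarith)).1 hle
  refine this.trans (le_of_eq (Finset.prod_congr rfl fun i _ => by ring))

lemma dyadic_sum (β B : ℝ) (hβ : 0 < β) (hB : 0 ≤ B) (K : ℕ) :
    ∑ k ∈ Finset.range K, (if β * 2 ^ k ≤ B then β * 2 ^ k else 0) ≤ 2 * B := by
  have key : ∀ K : ℕ, (∑ k ∈ Finset.range K, (if β * 2 ^ k ≤ B then β * 2 ^ k else 0) ≤ 2 * B) ∧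
      (∑ k ∈ Finset.range K, (if β * 2 ^ k ≤ B then β * 2 ^ k else 0) ≤ β * 2 ^ K) := by
    intro K
    induction K with
    | zero => simp; exact ⟨hB, hβ.le⟩
    | succ K ih =>
      rw [Finset.sum_range_succ]
      have hp : 0 < β * 2 ^ K := by positivity
      split_ifs with h
      · rw [pow_succ]; constructor <;> nlinarith [ih.2]
      · rw [pow_succ]; constructor
        · linarith [ih.1]
        · nlinarith [ih.2]
  exact (key K).1

end

noncomputable section


/-! ## The cone vector -/

structure Cone {m n : ℕ} (g : SLR (m + n)) (j0 : Fin n) (zv : Fin (m + n) → ℤ) : Prop where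
  ne : zv ≠ 0
  cone : ∀ i, |lv g zv i| ≤ |lv g zv (Fin.natAdd m j0)|
  min : ∀ z : Fin (m + n) → ℤ, z ≠ 0 → (∀ i, |lv g z i| ≤ |lv g z (Fin.natAdd m j0)|) →
    ∑ i, |(zv i : ℝ)| ≤ ∑ i, |(z i : ℝ)|

lemma exists_cone {m n : ℕ} (R : ℝ) (hR : 1 ≤ R) : ∃ Q : ℝ, 0 < Q ∧ ∀ g ∈ BddSL (m + n) R,
    ∀ j0 : Fin n, ∃ zv, Cone g j0 zv ∧ ∑ i, |(zv i : ℝ)| ≤ Q := by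
  obtain ⟨R', hR', hinv⟩ := inv_bdd (m + n) R
  set d := m + n with hd
  set N : ℝ := 2 * (d * R) + 1 with hN
  have hN0 : 0 < N := by positivity
  refine ⟨d * (d * R' * N + 1) + 1, by positivity, fun g hg j0 => ?_⟩
  set J : Fin d := Fin.natAdd m j0 with hJ
  set e : Fin d → ℝ := Pi.single J N with he
  have hen : ‖e‖ = N := by
    rw [he, Pi.norm_single, Real.norm_eq_abs, abs_of_pos hN0]
  set x := g⁻¹.1 *ᵥ e with hx
  set z : Fin d → ℤ := fun i => round (x i) with hz
  have hxb : ∀ i, |x i| ≤ d * R' * N := fun i => by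
    have := mv_bound g⁻¹.1 (hinv g hg) e i
    rwa [hen] at this
  have hlv : ∀ i, |lv g z i - e i| ≤ d * R := by
    intro i
    have h1 : lv g z - e = g.1 *ᵥ ((fun i => (z i : ℝ)) - x) := by
      rw [Matrix.mulVec_sub, hx, SL_mv_inv]; rfl
    have h2 := mv_bound g.1 hg ((fun i => (z i : ℝ)) - x) i
    rw [← h1] at h2
    have h3 : ‖(fun i => (z i : ℝ)) - x‖ ≤ 1 := by
      refine (pi_norm_le_iff_of_nonneg zero_le_one).2 fun i => ?_
      have := abs_sub_round (x i)
      rw [Real.norm_eq_abs, Pi.sub_apply, abs_sub_comm]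
      simp only [hz]
      linarith
    refine h2.trans ?_
    have : (0:ℝ) ≤ d * R := by positivity
    nlinarith
  have hJb : d * R + 1 ≤ |lv g z J| := by
    have := hlv J
    simp only [he, Pi.single_eq_same] at this
    rw [abs_le] at this
    have h2 := le_abs_self (lv g z J)
    linarith [this.1]
  have hcone : ∀ i, |lv g z i| ≤ |lv g z J| := by
    intro i
    by_cases h : i = J
    · rw [h]
    · have := hlv i
      rw [he, Pi.single_eq_of_ne h, sub_zero] at this
      linarith
  have hz0 : z ≠ 0 := by
    intro h0
    have : lv g z J = 0 := by
      rw [h0]; unfold lv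
      have : (fun i : Fin d => (((0 : Fin d → ℤ) i : ℤ) : ℝ)) = 0 := by funext i; simp
      rw [this, Matrix.mulVec_zero]; rfl
    rw [this, abs_zero] at hJb
    have : (0:ℝ) ≤ d * R := by positivity
    linarith
  have hzQ : ∑ i, |(z i : ℝ)| ≤ d * (d * R' * N + 1) + 1 := by
    have : ∀ i ∈ Finset.univ, |(z i : ℝ)| ≤ d * R' * N + 1 := by
      intro i _
      have h1 := abs_sub_round (x i)
      have h2 := hxb i
      have h3 : |(z i : ℝ)| ≤ |x i| + |x i - round (x i)| := by
        have := abs_sub_abs_le_abs_sub ((z i : ℤ) : ℝ) (x i)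
        rw [abs_sub_comm] at this
        simp only [hz] at this ⊢
        linarith
      linarith
    refine (Finset.sum_le_sum this).trans ?_
    simp
    linarith
  let f : (Fin d → ℤ) → ℕ := fun z => ∑ i, (z i).natAbs
  have hf : ∀ z, (f z : ℝ) = ∑ i, |(z i : ℝ)| := by
    intro z; simp only [f]; push_cast
    refine Finset.sum_congr rfl fun i _ => ?_
    rw [Nat.cast_natAbs, Int.cast_abs]
  obtain ⟨zv, ⟨hv0, hvc⟩, hmin⟩ := (measure f).wf.has_min
    {z | z ≠ 0 ∧ ∀ i, |lv g z i| ≤ |lv g z J|} ⟨z, hz0, hcone⟩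
  have hmin' : ∀ z : Fin d → ℤ, z ≠ 0 → (∀ i, |lv g z i| ≤ |lv g z J|) →
      ∑ i, |(zv i : ℝ)| ≤ ∑ i, |(z i : ℝ)| := by
    intro w hw0 hwc
    have h1 : ¬ (f w < f zv) := hmin w ⟨hw0, hwc⟩
    rw [← hf, ← hf]
    exact_mod_cast not_lt.1 h1
  exact ⟨zv, ⟨hv0, hvc, hmin'⟩, (hmin' z hz0 hcone).trans hzQ⟩

section
variable {m n : ℕ}

/-- the matrix attached to a parameter `t` -/
def Aof (v : Fin (m + n) → ℝ) (j0 : Fin n) (η : ℝ) (t : Fin m → Fin n → ℝ) (i : Fin m) (j : Fin n) : ℝ :=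
  if j = j0 then (η * t i j0 - v (Fin.castAdd n i)
    - ∑ j ∈ Finset.univ.erase j0, t i j * v (Fin.natAdd m j)) / v (Fin.natAdd m j0)
  else t i j

/-- coefficients -/
def bof (v : Fin (m + n) → ℝ) (j0 : Fin n) (η : ℝ) (w : Fin (m + n) → ℝ) (j : Fin n) : ℝ :=
  if j = j0 then w (Fin.natAdd m j0) / v (Fin.natAdd m j0) * η
  else w (Fin.natAdd m j) - w (Fin.natAdd m j0) / v (Fin.natAdd m j0) * v (Fin.natAdd m j)

lemma key_identity (v : Fin (m + n) → ℝ) (j0 : Fin n) (η : ℝ) (t : Fin m → Fin n → ℝ)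
    (hv : v (Fin.natAdd m j0) ≠ 0) (w : Fin (m + n) → ℝ) (i : Fin m) :
    (uMat m n (Aof v j0 η t) *ᵥ w) (Fin.castAdd n i)
      = (w (Fin.castAdd n i) - w (Fin.natAdd m j0) / v (Fin.natAdd m j0) * v (Fin.castAdd n i))
        + ∑ j, bof v j0 η w j * t i j := by
  rw [uMat_mv1]
  rw [← Finset.add_sum_erase _ _ (Finset.mem_univ j0),
    ← Finset.add_sum_erase (Finset.univ) (fun j => bof v j0 η w j * t i j) (Finset.mem_univ j0)]
  rw [Finset.sum_congr rfl (g := fun j => t i j * w (Fin.natAdd m j)) (fun j hj => by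
    rw [Aof, if_neg (Finset.ne_of_mem_erase hj)])]
  rw [Finset.sum_congr rfl (g := fun j => t i j * w (Fin.natAdd m j)
      - w (Fin.natAdd m j0) / v (Fin.natAdd m j0) * (t i j * v (Fin.natAdd m j))) (s₁ := Finset.univ.erase j0)
      (f := fun j => bof v j0 η w j * t i j) (fun j hj => by
    rw [bof, if_neg (Finset.ne_of_mem_erase hj)]; ring)]
  rw [Finset.sum_sub_distrib, ← Finset.mul_sum]
  simp only [Aof, bof, if_true]
  field_simp
  ring

lemma Aof_bound (v : Fin (m + n) → ℝ) (j0 : Fin n) (η : ℝ) (t : Fin m → Fin n → ℝ)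
    (hη : 0 ≤ η) (hv : η ≤ |v (Fin.natAdd m j0)|) (hv0 : v (Fin.natAdd m j0) ≠ 0)
    (hc : ∀ i, |v i| ≤ |v (Fin.natAdd m j0)|) (ht : ∀ i j, |t i j| ≤ 1) (i : Fin m) (j : Fin n) :
    |Aof v j0 η t i j| ≤ n + 1 := by
  have hn1 : (1:ℝ) ≤ n := by exact_mod_cast j0.pos
  unfold Aof
  split_ifs with h
  · have hV : 0 < |v (Fin.natAdd m j0)| := abs_pos.2 hv0
    rw [abs_div, div_le_iff₀ hV]
    have h1 : |η * t i j0| ≤ |v (Fin.natAdd m j0)| := by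
      rw [abs_mul, abs_of_nonneg hη]
      nlinarith [ht i j0, abs_nonneg (t i j0)]
    have h2 : |∑ j ∈ Finset.univ.erase j0, t i j * v (Fin.natAdd m j)|
        ≤ (n - 1) * |v (Fin.natAdd m j0)| := by
      refine (Finset.abs_sum_le_sum_abs _ _).trans ?_
      have : ∀ j ∈ Finset.univ.erase j0, |t i j * v (Fin.natAdd m j)| ≤ |v (Fin.natAdd m j0)| := by
        intro j _
        rw [abs_mul]
        nlinarith [ht i j, hc (Fin.natAdd m j), abs_nonneg (t i j), abs_nonneg (v (Fin.natAdd m j))]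
      refine (Finset.sum_le_sum this).trans (le_of_eq ?_)
      rw [Finset.sum_const, nsmul_eq_mul, Finset.card_erase_of_mem (Finset.mem_univ j0),
        Finset.card_univ, Fintype.card_fin, Nat.cast_sub j0.pos]
      simp
    have h3 := hc (Fin.castAdd n i)
    have h4 := abs_sub (η * t i j0 - v (Fin.castAdd n i))
      (∑ j ∈ Finset.univ.erase j0, t i j * v (Fin.natAdd m j))
    have h5 := abs_sub (η * t i j0) (v (Fin.castAdd n i))
    linarith
  · have := ht i j; linarith

/-- separation of parameters from closeness of matrices -/
lemma Aof_close (v : Fin (m + n) → ℝ) (j0 : Fin n) (η : ℝ) (t t' : Fin m → Fin n → ℝ)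
    (hη : 0 < η) (hv0 : v (Fin.natAdd m j0) ≠ 0)
    (hc : ∀ i, |v i| ≤ |v (Fin.natAdd m j0)|) (ε : ℝ) 
    (h : ∀ i j, |Aof v j0 η t i j - Aof v j0 η t' i j| ≤ ε) (i : Fin m) (j : Fin n) :
    |t i j - t' i j| ≤ if j = j0 then n * |v (Fin.natAdd m j0)| * ε / η else ε := by
  have hε : 0 ≤ ε := (abs_nonneg _).trans (h i j)
  have hother : ∀ j, j ≠ j0 → |t i j - t' i j| ≤ ε := by
    intro j hj
    have := h i j
    simp only [Aof, if_neg hj] at this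
    exact this
  split_ifs with hj
  · subst hj
    rw [le_div_iff₀ hη]
    have h1 := h i j
    simp only [Aof, if_true] at h1
    rw [← sub_div, abs_div, div_le_iff₀ (abs_pos.2 hv0)] at h1
    have h2 : |∑ k ∈ Finset.univ.erase j, (t i k - t' i k) * v (Fin.natAdd m k)|
        ≤ (n - 1) * (ε * |v (Fin.natAdd m j)|) := by
      refine (Finset.abs_sum_le_sum_abs _ _).trans ?_
      have : ∀ k ∈ Finset.univ.erase j, |(t i k - t' i k) * v (Fin.natAdd m k)|
          ≤ ε * |v (Fin.natAdd m j)| := by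
        intro k hk
        rw [abs_mul]
        exact mul_le_mul (hother k (Finset.ne_of_mem_erase hk)) (hc _) (abs_nonneg _) hε
      refine (Finset.sum_le_sum this).trans (le_of_eq ?_)
      rw [Finset.sum_const, nsmul_eq_mul, Finset.card_erase_of_mem (Finset.mem_univ j),
        Finset.card_univ, Fintype.card_fin, Nat.cast_sub j.pos]
      simp
    have e : (t i j - t' i j) * η = (η * t i j - v (Fin.castAdd n i)
        - ∑ k ∈ Finset.univ.erase j, t i k * v (Fin.natAdd m k)
        - (η * t' i j - v (Fin.castAdd n i)
        - ∑ k ∈ Finset.univ.erase j, t' i k * v (Fin.natAdd m k)))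
        + ∑ k ∈ Finset.univ.erase j, (t i k - t' i k) * v (Fin.natAdd m k) := by
      simp only [sub_mul, Finset.sum_sub_distrib]
      ring
    have h3 : |(t i j - t' i j) * η| ≤ n * |v (Fin.natAdd m j)| * ε := by
      rw [e]
      refine (abs_add_le _ _).trans ?_
      linarith
    rwa [abs_mul, abs_of_pos hη] at h3
  · exact hother j hj

/-- the sheared coordinates -/
def shear (v : Fin (m + n) → ℝ) (j0 : Fin n) : Matrix (Fin (m + n)) (Fin (m + n)) ℝ :=
  (1 : Matrix (Fin (m + n)) (Fin (m + n)) ℝ).updateCol (Fin.natAdd m j0)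
    (fun i => if i = Fin.natAdd m j0 then 1 else - (v i / v (Fin.natAdd m j0)))

lemma shear_det (v : Fin (m + n) → ℝ) (j0 : Fin n) : (shear v j0).det = 1 := by
  unfold shear; rw [det_updateCol_one]; simp

lemma shear_mv (v : Fin (m + n) → ℝ) (j0 : Fin n) (w : Fin (m + n) → ℝ) (i : Fin (m + n)) :
    (shear v j0 *ᵥ w) i = if i = Fin.natAdd m j0 then w (Fin.natAdd m j0) else
      w i - w (Fin.natAdd m j0) / v (Fin.natAdd m j0) * v i := by
  have : ∀ k, shear v j0 i k * w k = (if k = i then (if i = Fin.natAdd m j0 then 0 else w i) else 0)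
     + (if k = Fin.natAdd m j0 then (if i = Fin.natAdd m j0 then w (Fin.natAdd m j0) else
        - (v i / v (Fin.natAdd m j0)) * w (Fin.natAdd m j0)) else 0) := by
    intro k
    unfold shear
    rw [Matrix.updateCol_apply]
    by_cases h1 : k = Fin.natAdd m j0
    · subst h1
      by_cases h2 : i = Fin.natAdd m j0
      · simp [h2]
      · rw [if_pos rfl, if_pos rfl, if_neg h2, if_neg (Ne.symm h2), if_neg h2]; ring
    · rw [if_neg h1, if_neg h1, Matrix.one_apply]
      by_cases h3 : k = i
      · subst h3; simp [h1]
      · simp [h3, Ne.symm h3]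
  rw [Matrix.mulVec, dotProduct, Finset.sum_congr rfl (fun k _ => this k), Finset.sum_add_distrib]
  simp only [Finset.sum_ite_eq', Finset.mem_univ, if_true]
  split_ifs with h
  · ring
  · ring

end

end

noncomputable section

lemma count_set {d : ℕ} (M : Matrix (Fin d) (Fin d) ℝ) (hM : |M.det| = 1) (D : ℝ)
    (hD : ∀ x : Fin d → ℝ, (∀ i, 0 ≤ x i ∧ x i ≤ 1) → ∀ i, |(M *ᵥ x) i| ≤ D)
    (S : Set (Fin d → ℤ)) (s : Fin d → ℝ) (hs : ∀ i, 0 ≤ s i + D)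
    (h : ∀ z ∈ S, ∀ i, |(M *ᵥ (fun i => (z i : ℝ))) i| ≤ s i) :
    ∃ F : Finset (Fin d → ℤ), (∀ z, z ∈ F ↔ z ∈ S) ∧ (F.card : ℝ) ≤ ∏ i, (2 * (s i + D)) := by
  have hfin : S.Finite := by
    by_contra hinf
    obtain ⟨k, hk⟩ := exists_nat_gt (∏ i, (2 * (s i + D)))
    obtain ⟨F, hF, hc⟩ := Set.Infinite.exists_subset_card_eq hinf k
    have := count_box M hM D hD F s hs (fun z hz => h z (hF hz))
    rw [hc] at this
    linarith
  exact ⟨hfin.toFinset, fun z => hfin.mem_toFinset,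
    count_box M hM D hD _ s hs (fun z hz => h z (hfin.mem_toFinset.1 hz))⟩

lemma norm_attained {n : ℕ} (j0 : Fin n) (b : Fin n → ℝ) : ∃ k, |b k| = ‖b‖ := by
  haveI : Nonempty (Fin n) := ⟨j0⟩
  obtain ⟨k, hk⟩ := Finite.exists_max (fun k => |b k|)
  refine ⟨k, le_antisymm ?_ ?_⟩
  · exact norm_le_pi_norm b k
  · exact (pi_norm_le_iff_of_nonneg (abs_nonneg _)).2 hk

section
variable {m n : ℕ}

/-- `z` obstructs the parameter `t` -/
def Act (v : Fin (m + n) → ℝ) (j0 : Fin n) (η θ : ℝ) (w : Fin (m + n) → ℝ)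
    (t : Fin m → Fin n → ℝ) : Prop :=
  ∀ i, |(w (Fin.castAdd n i) - w (Fin.natAdd m j0) / v (Fin.natAdd m j0) * v (Fin.castAdd n i))
        + ∑ j, bof v j0 η w j * t i j| ≤ θ

lemma Act_c (v : Fin (m + n) → ℝ) (j0 : Fin n) (η θ : ℝ) (w : Fin (m + n) → ℝ)
    (t : Fin m → Fin n → ℝ) (ht : ∀ i j, |t i j| ≤ 1) (h : Act v j0 η θ w t) (i : Fin m) :
    |w (Fin.castAdd n i) - w (Fin.natAdd m j0) / v (Fin.natAdd m j0) * v (Fin.castAdd n i)|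
      ≤ θ + n * ‖bof v j0 η w‖ := by
  have h1 := h i
  set c := w (Fin.castAdd n i) - w (Fin.natAdd m j0) / v (Fin.natAdd m j0) * v (Fin.castAdd n i)
  have h2 : |∑ j, bof v j0 η w j * t i j| ≤ n * ‖bof v j0 η w‖ := by
    refine (Finset.abs_sum_le_sum_abs _ _).trans ?_
    have : ∀ j ∈ Finset.univ, |bof v j0 η w j * t i j| ≤ ‖bof v j0 η w‖ := by
      intro j _
      rw [abs_mul]
      have h3 : |bof v j0 η w j| ≤ ‖bof v j0 η w‖ := norm_le_pi_norm (bof v j0 η w) j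
      nlinarith [ht i j, abs_nonneg (bof v j0 η w j), abs_nonneg (t i j)]
    refine (Finset.sum_le_sum this).trans (le_of_eq ?_)
    simp
  have h3 : |c| ≤ |c + ∑ j, bof v j0 η w j * t i j| + |∑ j, bof v j0 η w j * t i j| := by
    have := abs_sub (c + ∑ j, bof v j0 η w j * t i j) (∑ j, bof v j0 η w j * t i j)
    rwa [add_sub_cancel_right] at this
  linarith

lemma shear_D (g : SLR (m + n)) (R : ℝ) (hR : 1 ≤ R) (hg : g ∈ BddSL (m + n) R) (j0 : Fin n)
    (v : Fin (m + n) → ℝ) (hv0 : v (Fin.natAdd m j0) ≠ 0)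
    (hc : ∀ i, |v i| ≤ |v (Fin.natAdd m j0)|) (x : Fin (m + n) → ℝ)
    (hx : ∀ i, 0 ≤ x i ∧ x i ≤ 1) (i : Fin (m + n)) :
    |((shear v j0 * g.1) *ᵥ x) i| ≤ 2 * ((m + n : ℕ) * R) := by
  have hb : ∀ i, |(g.1 *ᵥ x) i| ≤ (m + n : ℕ) * R := by
    intro i
    have h1 := mv_bound g.1 hg x i
    have h2 : ‖x‖ ≤ 1 := (pi_norm_le_iff_of_nonneg zero_le_one).2 fun i => by
      rw [Real.norm_eq_abs, abs_of_nonneg (hx i).1]; exact (hx i).2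
    have : (0:ℝ) ≤ (m + n : ℕ) * R := by positivity
    nlinarith
  rw [← Matrix.mulVec_mulVec, shear_mv]
  have h0 : (0:ℝ) ≤ (m + n : ℕ) * R := by positivity
  split_ifs with h
  · linarith [hb (Fin.natAdd m j0)]
  · have hV := abs_pos.2 hv0
    have : |(g.1 *ᵥ x) (Fin.natAdd m j0) / v (Fin.natAdd m j0) * v i| ≤ (m + n : ℕ) * R := by
      rw [abs_mul, abs_div, div_mul_eq_mul_div, div_le_iff₀ hV]
      exact mul_le_mul (hb _) (hc i) (abs_nonneg _) h0
    have h2 := abs_sub ((g.1 *ᵥ x) i) ((g.1 *ᵥ x) (Fin.natAdd m j0) / v (Fin.natAdd m j0) * v i)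
    linarith [hb i]

lemma level_vol (g : SLR (m + n)) (R : ℝ) (hR : 1 ≤ R) (hg : g ∈ BddSL (m + n) R) (j0 : Fin n)
    (v : Fin (m + n) → ℝ) (hv0 : v (Fin.natAdd m j0) ≠ 0)
    (hc : ∀ i, |v i| ≤ |v (Fin.natAdd m j0)|) (η θ b0 B X D : ℝ) (hD : D = 2 * ((m + n : ℕ) * R))
    (hθ : 0 ≤ θ) (hb0 : 0 < b0) (hB : 0 ≤ B) (hX : 0 ≤ X) :
    volume {t : Fin m → Fin n → ℝ | (∀ i j, |t i j| ≤ 1) ∧ ∃ z : Fin (m + n) → ℤ,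
        Act v j0 η θ (lv g z) t ∧ b0 ≤ ‖bof v j0 η (lv g z)‖ ∧ ‖bof v j0 η (lv g z)‖ ≤ B ∧
        |lv g z (Fin.natAdd m j0)| ≤ X}
      ≤ ENNReal.ofReal ((2 * (θ + n * B + D)) ^ m * ((2 * (B + D)) ^ (n - 1) * (2 * (X + D)))
          * (2 ^ n * θ / b0) ^ m) := by
  have hD0 : 0 ≤ D := by rw [hD]; positivity
  set S : Set (Fin (m + n) → ℤ) := {z | (∃ t : Fin m → Fin n → ℝ, (∀ i j, |t i j| ≤ 1) ∧
    Act v j0 η θ (lv g z) t) ∧ b0 ≤ ‖bof v j0 η (lv g z)‖ ∧ ‖bof v j0 η (lv g z)‖ ≤ B ∧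
        |lv g z (Fin.natAdd m j0)| ≤ X} with hS
  set s : Fin (m + n) → ℝ := fun i => Fin.addCases (fun _ => θ + n * B)
    (fun j => if j = j0 then X else B) i with hs
  have hs1 : ∀ i, s (Fin.castAdd n i) = θ + n * B := fun i => by simp [hs]
  have hs2 : ∀ j, s (Fin.natAdd m j) = if j = j0 then X else B := fun j => by simp [hs]
  have hs0 : ∀ i, 0 ≤ s i := by
    intro i
    refine Fin.addCases (fun i => ?_) (fun j => ?_) i
    · rw [hs1]; positivity
    · rw [hs2]; split_ifs <;> assumption
  have hdet : |(shear v j0 * g.1).det| = 1 := by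
    rw [Matrix.det_mul, shear_det, g.2]; simp
  obtain ⟨F, hF, hcard⟩ := count_set (shear v j0 * g.1) hdet D
    (fun x hx i => by rw [hD]; exact shear_D g R hR hg j0 v hv0 hc x hx i) S s
    (fun i => add_nonneg (hs0 i) hD0) (by
      rintro z ⟨⟨t, ht, hA⟩, h1, h2, h3⟩ i
      rw [← Matrix.mulVec_mulVec, shear_mv]
      change |if i = Fin.natAdd m j0 then lv g z (Fin.natAdd m j0) else
        lv g z i - lv g z (Fin.natAdd m j0) / v (Fin.natAdd m j0) * v i| ≤ s i
      refine Fin.addCases (fun i => ?_) (fun j => ?_) i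
      · rw [if_neg (by intro h; have := congrArg Fin.val h; simp at this; omega), hs1]
        have := Act_c v j0 η θ _ t ht hA i
        have hn : (0:ℝ) ≤ n := by positivity
        nlinarith
      · rw [hs2]
        by_cases hj : j = j0
        · subst hj; simpa using h3
        · rw [if_neg (by intro h; exact hj (Fin.natAdd_injective _ _ h)), if_neg hj]
          have h4 : |bof v j0 η (lv g z) j| ≤ ‖bof v j0 η (lv g z)‖ := norm_le_pi_norm (bof v j0 η (lv g z)) j
          rw [bof, if_neg hj] at h4
          exact h4.trans h2)
  have hprod : ∏ i, (2 * (s i + D)) = (2 * (θ + n * B + D)) ^ m *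
      ((2 * (B + D)) ^ (n - 1) * (2 * (X + D))) := by
    rw [Fin.prod_univ_add]
    congr 1
    · simp only [hs1]; simp
    · rw [← Finset.prod_erase_mul _ _ (Finset.mem_univ j0)]
      rw [hs2, if_pos rfl]
      congr 1
      rw [Finset.prod_congr rfl (g := fun _ => 2 * (B + D)) (fun j hj => by
        rw [hs2, if_neg (Finset.ne_of_mem_erase hj)])]
      simp
  rw [hprod] at hcard
  have hsub : {t : Fin m → Fin n → ℝ | (∀ i j, |t i j| ≤ 1) ∧ ∃ z : Fin (m + n) → ℤ,
        Act v j0 η θ (lv g z) t ∧ b0 ≤ ‖bof v j0 η (lv g z)‖ ∧ ‖bof v j0 η (lv g z)‖ ≤ B ∧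
        |lv g z (Fin.natAdd m j0)| ≤ X} ⊆
      ⋃ z ∈ F, {t : Fin m → Fin n → ℝ | (∀ i j, |t i j| ≤ 1) ∧ Act v j0 η θ (lv g z) t} := by
    rintro t ⟨ht, z, hA, h⟩
    simp only [Set.mem_iUnion]
    exact ⟨z, (hF z).2 ⟨⟨t, ht, hA⟩, h⟩, ht, hA⟩
  refine (measure_mono hsub).trans ((measure_biUnion_finset_le _ _).trans ?_)
  have hz : ∀ z ∈ F, volume {t : Fin m → Fin n → ℝ | (∀ i j, |t i j| ≤ 1) ∧
      Act v j0 η θ (lv g z) t} ≤ ENNReal.ofReal ((2 ^ n * θ / b0) ^ m) := by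
    intro z hz
    obtain ⟨-, h1, -⟩ := (hF z).1 hz
    obtain ⟨k, hk⟩ := norm_attained j0 (bof v j0 η (lv g z))
    have hk0 : b0 ≤ |bof v j0 η (lv g z) k| := by rw [hk]; exact h1
    refine (slab_vol_m (bof v j0 η (lv g z)) k (abs_pos.1 (hb0.trans_le hk0)) _ θ hθ).trans ?_
    apply ENNReal.ofReal_le_ofReal
    gcongr
  refine (Finset.sum_le_sum hz).trans ?_
  rw [Finset.sum_const, nsmul_eq_mul, ENNReal.ofReal_mul (by positivity)]
  gcongr
  rw [← ENNReal.ofReal_natCast]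
  exact ENNReal.ofReal_le_ofReal hcard
end
end

noncomputable section

section
variable {m n : ℕ}

lemma bof_bound (v : Fin (m + n) → ℝ) (j0 : Fin n) (η ρ : ℝ) (hη : 0 < η) (hρ : 0 < ρ)
    (hv : η ≤ |v (Fin.natAdd m j0)|)
    (hc : ∀ i, |v i| ≤ |v (Fin.natAdd m j0)|) :
    ∃ F Bm : ℝ, 0 ≤ F ∧ 0 ≤ Bm ∧
      (∀ b, 0 ≤ b → b ≤ Bm → b ^ (n - 1) * min ρ (|v (Fin.natAdd m j0)| * (2 * b) / η) ≤ F * b) ∧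
      F * (2 * Bm) ≤ 4 ^ n * ρ ^ n ∧
      ∀ w : Fin (m + n) → ℝ, (∀ j, |w (Fin.natAdd m j)| ≤ ρ) → ‖bof v j0 η w‖ ≤ Bm := by
  set V := |v (Fin.natAdd m j0)| with hV
  have hV0 : 0 < V := hη.trans_le hv
  have hbj0 : ∀ w : Fin (m + n) → ℝ, (∀ j, |w (Fin.natAdd m j)| ≤ ρ) →
      |bof v j0 η w j0| ≤ ρ * η / V := by
    intro w hw
    rw [bof, if_pos rfl, abs_mul, abs_div, abs_of_pos hη, div_mul_eq_mul_div]
    gcongr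
    exact hw j0
  by_cases h1 : n = 1
  · refine ⟨2 * V / η, ρ * η / V, by positivity, by positivity, fun b hb hb2 => ?_, ?_, fun w hw => ?_⟩
    · rw [h1]; simp only [Nat.sub_self, pow_zero, one_mul]
      refine (min_le_right _ _).trans (le_of_eq ?_)
      ring
    · rw [h1]; apply le_of_eq; field_simp; norm_num
    · refine (pi_norm_le_iff_of_nonneg (by positivity)).2 fun j => ?_
      have : j = j0 := by subst h1; exact Subsingleton.elim _ _
      rw [this]; exact hbj0 w hw
  · have h2 : 2 ≤ n := by have := j0.pos; omega
    obtain ⟨p, rfl⟩ : ∃ p, n = p + 2 := ⟨n - 2, by omega⟩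
    refine ⟨(2 * ρ) ^ p * ρ, 2 * ρ, by positivity, by positivity, fun b hb hb2 => ?_, ?_, fun w hw => ?_⟩
    · have e : p + 2 - 1 = p + 1 := rfl
      rw [e, pow_succ]
      calc b ^ p * b * min ρ (V * (2 * b) / η) ≤ (2 * ρ) ^ p * b * ρ := by
            gcongr
            exact min_le_left _ _
        _ = _ := by ring
    · have : (2 * ρ) ^ p * ρ * (2 * (2 * ρ)) = 2 ^ (p + 2) * ρ ^ (p + 2) := by
        rw [mul_pow]; ring
      rw [this]
      gcongr
      norm_num
    · refine (pi_norm_le_iff_of_nonneg (by positivity)).2 fun j => ?_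
      rw [Real.norm_eq_abs]
      by_cases hj : j = j0
      · rw [hj]
        refine (hbj0 w hw).trans ?_
        rw [div_le_iff₀ hV0]
        nlinarith
      · rw [bof, if_neg hj]
        have h3 := abs_sub (w (Fin.natAdd m j)) (w (Fin.natAdd m j0) / v (Fin.natAdd m j0) * v (Fin.natAdd m j))
        have h4 : |w (Fin.natAdd m j0) / v (Fin.natAdd m j0) * v (Fin.natAdd m j)| ≤ ρ := by
          rw [abs_mul, abs_div, div_mul_eq_mul_div, div_le_iff₀ hV0]
          exact mul_le_mul (hw j0) (hc _) (abs_nonneg _) hρ.le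
        linarith [hw j]

/-- absolute constant -/
def C0 (m n : ℕ) : ℝ := (4 * (n + 2)) ^ m * 8 ^ (n - 1) * 4 * (2 ^ n) ^ m * 4 ^ n

lemma w_le_b (v : Fin (m + n) → ℝ) (j0 : Fin n) (η : ℝ) (hη : 0 < η) (hv0 : v (Fin.natAdd m j0) ≠ 0)
    (w : Fin (m + n) → ℝ) :
    |w (Fin.natAdd m j0)| ≤ |v (Fin.natAdd m j0)| * ‖bof v j0 η w‖ / η := by
  have h4 : |bof v j0 η w j0| ≤ ‖bof v j0 η w‖ := norm_le_pi_norm (bof v j0 η w) j0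
  have hV := abs_pos.2 hv0
  rw [bof, if_pos rfl, abs_mul, abs_div, abs_of_pos hη, div_mul_eq_mul_div, div_le_iff₀ hV] at h4
  rw [le_div_iff₀ hη]
  linarith

lemma big_vol (g : SLR (m + n)) (R : ℝ) (hR : 1 ≤ R) (hg : g ∈ BddSL (m + n) R) (j0 : Fin n)
    (v : Fin (m + n) → ℝ) (hv0 : v (Fin.natAdd m j0) ≠ 0)
    (hc : ∀ i, |v i| ≤ |v (Fin.natAdd m j0)|) (η δ ρ β D : ℝ) (hD : D = 2 * ((m + n : ℕ) * R))
    (hη : 0 < η) (hηV : η ≤ |v (Fin.natAdd m j0)|) (hδ : 0 < δ) (hδη : δ * η ≤ 1) (hρ : 0 < ρ)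
    (hDρ : D ≤ ρ) (hηρ : η ^ m * ρ ^ n = δ ^ n) (hβ : 1 ≤ β) (hDβ : D ≤ β) :
    volume {t : Fin m → Fin n → ℝ | (∀ i j, |t i j| ≤ 1) ∧ ∃ z : Fin (m + n) → ℤ,
        Act v j0 η (δ * η) (lv g z) t ∧ β ≤ ‖bof v j0 η (lv g z)‖ ∧
        ∀ j, |lv g z (Fin.natAdd m j)| ≤ ρ}
      ≤ ENNReal.ofReal (C0 m n * δ ^ (m + n)) := by
  have hD0 : 0 ≤ D := by rw [hD]; positivity
  obtain ⟨F, Bm, hF, hBm, hFX, hFB, hbB⟩ := bof_bound v j0 η ρ hη hρ hηV hc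
  set V := |v (Fin.natAdd m j0)| with hV
  have hV0 : 0 < V := hη.trans_le hηV
  have hβ0 : 0 < β := by linarith
  obtain ⟨K, hK⟩ : ∃ K : ℕ, Bm < β * 2 ^ K := by
    obtain ⟨K, hK⟩ := pow_unbounded_of_one_lt (Bm / β) (one_lt_two : (1:ℝ) < 2)
    exact ⟨K, by rwa [div_lt_iff₀' hβ0] at hK⟩
  set Lev : ℕ → Set (Fin m → Fin n → ℝ) := fun k =>
    {t | (∀ i j, |t i j| ≤ 1) ∧ ∃ z : Fin (m + n) → ℤ,
        Act v j0 η (δ * η) (lv g z) t ∧ β * 2 ^ k ≤ ‖bof v j0 η (lv g z)‖ ∧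
        ‖bof v j0 η (lv g z)‖ ≤ 2 * (β * 2 ^ k) ∧
        ∀ j, |lv g z (Fin.natAdd m j)| ≤ ρ} with hLev
  set Cc : ℝ := (4 * (n + 2)) ^ m * 8 ^ (n - 1) * 4 * (2 ^ n) ^ m * (δ * η) ^ m with hCc
  have hCc0 : 0 ≤ Cc := by positivity
  have hlev : ∀ k ∈ Finset.range K, volume (Lev k) ≤
      ENNReal.ofReal (Cc * F * (if β * 2 ^ k ≤ Bm then β * 2 ^ k else 0)) := by
    intro k _
    split_ifs with h
    · set b := β * 2 ^ k with hb
      have hbβ : β ≤ b := by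
        rw [hb]; exact le_mul_of_one_le_right hβ0.le (one_le_pow₀ one_le_two)
      have hb0 : 0 < b := by positivity
      set X := min ρ (V * (2 * b) / η) with hX
      have hDX : D ≤ X := by
        refine le_min hDρ ?_
        rw [le_div_iff₀ hη]
        nlinarith
      have hX0 : 0 ≤ X := hD0.trans hDX
      have h1 := level_vol g R hR hg j0 v hv0 hc η (δ * η) b (2 * b) X D hD (by positivity) hb0
        (by positivity) hX0
      refine (measure_mono ?_).trans (h1.trans (ENNReal.ofReal_le_ofReal ?_))
      · rintro t ⟨ht, z, hA, hz1, hz2, hz3⟩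
        refine ⟨ht, z, hA, hz1, hz2, le_min (hz3 j0) ?_⟩
        refine (w_le_b v j0 η hη hv0 _).trans ?_
        gcongr
      · calc (2 * (δ * η + n * (2 * b) + D)) ^ m * ((2 * (2 * b + D)) ^ (n - 1) * (2 * (X + D)))
              * (2 ^ n * (δ * η) / b) ^ m
            ≤ (4 * (n + 2) * b) ^ m * ((8 * b) ^ (n - 1) * (4 * X)) * (2 ^ n * (δ * η) / b) ^ m := by
              have hn : (0:ℝ) ≤ n := by positivity
              gcongr ?_ ^ m * (?_ ^ (n - 1) * ?_) * _
              · nlinarith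
              · linarith
              · linarith
          _ = Cc * (b ^ (n - 1) * X) := by
              rw [hCc, div_pow, mul_pow _ b, mul_pow 8 b, mul_pow (2 ^ n) (δ * η)]
              field_simp
          _ ≤ Cc * (F * b) := by
              exact mul_le_mul_of_nonneg_left (hFX b hb0.le h) hCc0
          _ = Cc * F * b := by ring
    · have : Lev k = ∅ := by
        rw [Set.eq_empty_iff_forall_notMem]
        rintro t ⟨ht, z, hA, hz1, hz2, hz3⟩
        exact h (hz1.trans (hbB _ hz3))
      rw [this]; simp
  have hsub : {t : Fin m → Fin n → ℝ | (∀ i j, |t i j| ≤ 1) ∧ ∃ z : Fin (m + n) → ℤ,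
        Act v j0 η (δ * η) (lv g z) t ∧ β ≤ ‖bof v j0 η (lv g z)‖ ∧
        ∀ j, |lv g z (Fin.natAdd m j)| ≤ ρ} ⊆ ⋃ k ∈ Finset.range K, Lev k := by
    rintro t ⟨ht, z, hA, hz1, hz3⟩
    have h1 : 1 ≤ ‖bof v j0 η (lv g z)‖ / β := by rwa [one_le_div hβ0]
    obtain ⟨k, hk1, hk2⟩ := exists_nat_pow_near h1 (one_lt_two : (1:ℝ) < 2)
    rw [le_div_iff₀ hβ0] at hk1
    rw [div_lt_iff₀ hβ0] at hk2
    simp only [Set.mem_iUnion]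
    refine ⟨k, ?_, ht, z, hA, by linarith, ?_, hz3⟩
    · rw [Finset.mem_range]
      by_contra hkK
      have h2 : (2:ℝ) ^ K ≤ 2 ^ k := pow_le_pow_right₀ one_le_two (not_lt.1 hkK)
      have h3 := hbB _ hz3
      nlinarith
    · rw [pow_succ] at hk2; linarith
  refine (measure_mono hsub).trans ((measure_biUnion_finset_le _ _).trans
    ((Finset.sum_le_sum hlev).trans ?_))
  rw [← ENNReal.ofReal_sum_of_nonneg, ← Finset.mul_sum]
  · apply ENNReal.ofReal_le_ofReal
    have h1 := dyadic_sum β Bm hβ0 hBm K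
    calc Cc * F * ∑ k ∈ Finset.range K, (if β * 2 ^ k ≤ Bm then β * 2 ^ k else 0)
        ≤ Cc * F * (2 * Bm) := by gcongr
      _ = Cc * (F * (2 * Bm)) := by ring
      _ ≤ Cc * (4 ^ n * ρ ^ n) := by gcongr
      _ = C0 m n * δ ^ m * (η ^ m * ρ ^ n) := by rw [hCc, C0, mul_pow]; ring
      _ = C0 m n * δ ^ (m + n) := by rw [hηρ, pow_add]; ring
  · intro k _
    split_ifs <;> positivity
end
end

noncomputable section

section
variable {m n : ℕ}

lemma Cone.v_ne {g : SLR (m + n)} {j0 : Fin n} {zv : Fin (m + n) → ℤ} (h : Cone g j0 zv)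
    {δ : ℝ} (hδ : 0 < δ) (hg : Good δ g) : δ ≤ |lv g zv (Fin.natAdd m j0)| := by
  refine (hg zv h.ne).trans ?_
  exact (pi_norm_le_iff_of_nonneg (abs_nonneg _)).2 fun i => h.cone i

lemma par_or_big (g : SLR (m + n)) (R' Q : ℝ) (hR' : 1 ≤ R') (hQ : 0 < Q)
    (hinv : ∀ i j, |g⁻¹.1 i j| ≤ R') (j0 : Fin n) (zv : Fin (m + n) → ℤ) (hz : Cone g j0 zv)
    (hv0 : lv g zv (Fin.natAdd m j0) ≠ 0)
    (hzQ : ∑ i, |(zv i : ℝ)| ≤ Q) (z : Fin (m + n) → ℤ) (hz0 : z ≠ 0) :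
    (1 ≤ |lv g z (Fin.natAdd m j0) / lv g zv (Fin.natAdd m j0)| ∧
      ∀ i, lv g z i = lv g z (Fin.natAdd m j0) / lv g zv (Fin.natAdd m j0) * lv g zv i) ∨
    ((∃ a b, z a * zv b ≠ z b * zv a) ∧ ∃ k, 1 / (2 * Q * ((m + n : ℕ) * R')) ≤
      |lv g z k - lv g z (Fin.natAdd m j0) / lv g zv (Fin.natAdd m j0) * lv g zv k|) := by
  by_cases h : ∀ a b, z a * zv b = z b * zv a
  · left
    obtain ⟨b, hb⟩ : ∃ b, zv b ≠ 0 := by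
      by_contra hh; push Not at hh; exact hz.ne (funext hh)
    have hb' : (zv b : ℝ) ≠ 0 := by exact_mod_cast hb
    set q : ℝ := z b / zv b with hq
    have hzq : ∀ a, (z a : ℝ) = q * zv a := by
      intro a
      have : (z a : ℝ) * zv b = z b * zv a := by exact_mod_cast h a b
      rw [hq]; field_simp; linarith
    have hw : ∀ i, lv g z i = q * lv g zv i := by
      intro i
      unfold lv
      have : (fun i => (z i : ℝ)) = q • (fun i => (zv i : ℝ)) := funext fun a => by simp [hzq a]
      rw [this, Matrix.mulVec_smul]; rfl
    have hs : lv g z (Fin.natAdd m j0) / lv g zv (Fin.natAdd m j0) = q := by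
      rw [hw]; field_simp
    rw [hs]
    refine ⟨?_, hw⟩
    have h1 := hz.min z hz0 (fun i => by
      rw [hw, hw, abs_mul, abs_mul]
      exact mul_le_mul_of_nonneg_left (hz.cone i) (abs_nonneg _))
    have h2 : ∑ i, |(z i : ℝ)| = |q| * ∑ i, |(zv i : ℝ)| := by
      rw [Finset.mul_sum]
      exact Finset.sum_congr rfl fun i _ => by rw [hzq, abs_mul]
    have h3 : 0 < ∑ i, |(zv i : ℝ)| :=
      Finset.sum_pos' (fun i _ => abs_nonneg _) ⟨b, Finset.mem_univ _, abs_pos.2 hb'⟩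
    rw [h2] at h1
    by_contra hlt
    push Not at hlt
    nlinarith
  · right
    push Not at h
    refine ⟨h, ?_⟩
    obtain ⟨a, b, hab⟩ := h
    set s := lv g z (Fin.natAdd m j0) / lv g zv (Fin.natAdd m j0) with hs
    set w' : Fin (m + n) → ℝ := fun k => lv g z k - s * lv g zv k with hw'
    set y : Fin (m + n) → ℝ := fun k => (z k : ℝ) - s * zv k with hy
    have hyw : y = g⁻¹.1 *ᵥ w' := by
      have : w' = g.1 *ᵥ y := by
        have : y = (fun i => (z i : ℝ)) - s • (fun i => (zv i : ℝ)) := by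
          funext k; simp [hy]
        rw [this, Matrix.mulVec_sub, Matrix.mulVec_smul]; rfl
      rw [this, SL_inv_mv]
    have hyb : ∀ i, |y i| ≤ (m + n : ℕ) * R' * ‖w'‖ := fun i => by
      rw [hyw]; exact mv_bound g⁻¹.1 hinv w' i
    have hzvb : ∀ i, |(zv i : ℝ)| ≤ Q := fun i =>
      (Finset.single_le_sum (f := fun i => |(zv i : ℝ)|) (fun i _ => abs_nonneg _)
        (Finset.mem_univ i)).trans hzQ
    have h1 : (1:ℝ) ≤ |(z a : ℝ) * zv b - z b * zv a| := by
      have : z a * zv b - z b * zv a ≠ 0 := sub_ne_zero.2 hab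
      have := Int.one_le_abs this
      exact_mod_cast this
    have h2 : (z a : ℝ) * zv b - z b * zv a = y a * zv b - y b * zv a := by
      simp only [hy]; ring
    have h3 := abs_sub (y a * zv b) (y b * zv a)
    rw [← h2, abs_mul, abs_mul] at h3
    have h4 : |y a| * |(zv b : ℝ)| ≤ (m + n : ℕ) * R' * ‖w'‖ * Q :=
      mul_le_mul (hyb a) (hzvb b) (abs_nonneg _) (by positivity)
    have h5 : |y b| * |(zv a : ℝ)| ≤ (m + n : ℕ) * R' * ‖w'‖ * Q :=
      mul_le_mul (hyb b) (hzvb a) (abs_nonneg _) (by positivity)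
    have hmn : 0 < m + n := by have := j0.pos; omega
    have hmn' : (0:ℝ) < (m + n : ℕ) := by exact_mod_cast hmn
    obtain ⟨k, hk⟩ := norm_attained ⟨0, hmn⟩ w'
    refine ⟨k, ?_⟩
    change _ ≤ |w' k|
    rw [hk, div_le_iff₀ (by positivity)]
    nlinarith

/-- the rank one by one case -/
lemma det_two (g : SLR (1 + 1)) (z zv : Fin (1 + 1) → ℤ) (a b : Fin (1 + 1))
    (hab : z a * zv b ≠ z b * zv a) (j0 : Fin 1) (i0 : Fin 1)
    (hv0 : lv g zv (Fin.natAdd 1 j0) ≠ 0) :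
    1 ≤ |lv g z (Fin.castAdd 1 i0) - lv g z (Fin.natAdd 1 j0) / lv g zv (Fin.natAdd 1 j0)
      * lv g zv (Fin.castAdd 1 i0)| * |lv g zv (Fin.natAdd 1 j0)| := by
  rw [← abs_mul, sub_mul]
  have e : lv g z (Fin.natAdd 1 j0) / lv g zv (Fin.natAdd 1 j0)
      * lv g zv (Fin.castAdd 1 i0) * lv g zv (Fin.natAdd 1 j0) =
      lv g z (Fin.natAdd 1 j0) * lv g zv (Fin.castAdd 1 i0) := by field_simp
  rw [e]
  have hi : i0 = 0 := Subsingleton.elim _ _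
  have hj : j0 = 0 := Subsingleton.elim _ _
  subst hi hj
  have e1 : (Fin.castAdd 1 (0 : Fin 1) : Fin (1 + 1)) = (0 : Fin 2) := rfl
  have e2 : (Fin.natAdd 1 (0 : Fin 1) : Fin (1 + 1)) = (1 : Fin 2) := rfl
  rw [e1, e2]
  have hdet := g.2
  have hdet2 : g.1 (0 : Fin 2) (0 : Fin 2) * g.1 (1 : Fin 2) (1 : Fin 2)
    - g.1 (0 : Fin 2) (1 : Fin 2) * g.1 (1 : Fin 2) (0 : Fin 2) = 1 :=
    (Matrix.det_fin_two (g.1 : Matrix (Fin 2) (Fin 2) ℝ)).symm.trans hdet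
  have hl : ∀ (z : Fin (1 + 1) → ℤ) (i : Fin 2), lv g z i
      = g.1 i (0 : Fin 2) * z (0 : Fin 2) + g.1 i (1 : Fin 2) * z (1 : Fin 2) := by
    intro z i
    unfold lv
    rw [Matrix.mulVec, dotProduct]
    exact Fin.sum_univ_two _
  rw [hl, hl, hl, hl]
  have e3 : (g.1 (0 : Fin 2) (0 : Fin 2) * z (0 : Fin 2) + g.1 (0 : Fin 2) (1 : Fin 2) * z (1 : Fin 2))
     * (g.1 (1 : Fin 2) (0 : Fin 2) * zv (0 : Fin 2) + g.1 (1 : Fin 2) (1 : Fin 2) * zv (1 : Fin 2))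
    - (g.1 (1 : Fin 2) (0 : Fin 2) * z (0 : Fin 2) + g.1 (1 : Fin 2) (1 : Fin 2) * z (1 : Fin 2))
     * (g.1 (0 : Fin 2) (0 : Fin 2) * zv (0 : Fin 2) + g.1 (0 : Fin 2) (1 : Fin 2) * zv (1 : Fin 2))
    = ((z (0 : Fin 2) * zv (1 : Fin 2) - z (1 : Fin 2) * zv (0 : Fin 2) : ℤ) : ℝ) := by
    push_cast
    linear_combination ((z (0 : Fin 2) : ℝ) * zv (1 : Fin 2) - z (1 : Fin 2) * zv (0 : Fin 2)) * hdet2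
  rw [e3]
  have hne : z (0 : Fin 2) * zv (1 : Fin 2) - z (1 : Fin 2) * zv (0 : Fin 2) ≠ 0 := by
    intro h0
    have h0' := sub_eq_zero.1 h0
    apply hab
    change Fin 2 at a
    change Fin 2 at b
    fin_cases a <;> fin_cases b
    · rfl
    · exact h0'
    · exact h0'.symm
    · rfl
  have := Int.one_le_abs hne
  exact_mod_cast this

end
end

noncomputable section

section
variable {m n : ℕ}

lemma eta_tendsto (hm : 0 < m) : Tendsto (fun L : ℝ => Real.exp (-(L / m))) atTop (𝓝 0) := by
  have : (0:ℝ) < m := by exact_mod_cast hm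
  exact Real.tendsto_exp_neg_atTop_nhds_zero.comp (tendsto_id.atTop_div_const this)

lemma small_tendsto (hm : 0 < m) (hn : 0 < n) (h : ¬ (m = 1 ∧ n = 1)) (C δ D : ℝ) :
    Tendsto (fun L : ℝ => ((if 2 ≤ m then C / Real.exp (-(L / m)) else δ * Real.exp (L / n)) + D)
      * Real.exp (-(L / m)) ^ m) atTop (𝓝 0) := by
  have h0 := eta_tendsto hm
  by_cases h2 : 2 ≤ m
  · simp only [if_pos h2]
    obtain ⟨p, rfl⟩ : ∃ p, m = p + 2 := ⟨m - 2, by omega⟩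
    have e : (fun L : ℝ => (C / Real.exp (-(L / (p + 2 : ℕ))) + D) * Real.exp (-(L / (p + 2 : ℕ))) ^ (p + 2))
        = fun L : ℝ => C * Real.exp (-(L / (p + 2 : ℕ))) ^ (p + 1) + D * Real.exp (-(L / (p + 2 : ℕ))) ^ (p + 2) := by
      funext L
      have := (Real.exp_pos (-(L / (p + 2 : ℕ)))).ne'
      field_simp
      ring
    rw [e]
    have := ((h0.pow (p + 1)).const_mul C).add ((h0.pow (p + 2)).const_mul D)
    simpa using this
  · simp only [if_neg h2]
    have hm1 : m = 1 := by omega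
    have hn2 : 2 ≤ n := by omega
    subst hm1
    have hn2' : (2:ℝ) ≤ n := by exact_mod_cast hn2
    have hc : (0:ℝ) < 1 - 1 / n := by
      rw [sub_pos, div_lt_one (by linarith)]; linarith
    have h3 : Tendsto (fun L : ℝ => Real.exp (-(L * (1 - 1 / n)))) atTop (𝓝 0) :=
      Real.tendsto_exp_neg_atTop_nhds_zero.comp (tendsto_id.atTop_mul_const hc)
    have := (h3.const_mul δ).add (h0.const_mul D)
    simp only [mul_zero, add_zero] at this
    refine this.congr fun L => ?_
    have : Real.exp (-(L * (1 - 1 / n))) = Real.exp (L / n) * Real.exp (-(L / (1:ℕ))) := by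
      rw [← Real.exp_add]; congr 1; push_cast; ring
    rw [this]; ring

lemma not_good (hm : 0 < m) (hn : 0 < n) (δ L : ℝ) (hδ : 0 < δ) (A : Fin m → Fin n → ℝ) (g : SLR (m + n))
    (h : ¬ Good δ (aSL m n hm hn L * uSL m n A * g)) :
    ∃ z : Fin (m + n) → ℤ, z ≠ 0 ∧
      (∀ i, |(uMat m n A *ᵥ lv g z) (Fin.castAdd n i)| ≤ δ * Real.exp (-(L / m))) ∧
      ∀ j, |lv g z (Fin.natAdd m j)| ≤ δ * Real.exp (L / n) := by
  unfold Good at h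
  push Not at h
  obtain ⟨z, hz, hlt⟩ := h
  refine ⟨z, hz, fun i => ?_, fun j => ?_⟩
  · have h1 := (norm_le_pi_norm (lv (aSL m n hm hn L * uSL m n A * g) z) (Fin.castAdd n i)).trans hlt.le
    rw [mul_assoc, lv_mul, lv_mul] at h1
    change ‖(aMat m n L *ᵥ (uMat m n A *ᵥ lv g z)) (Fin.castAdd n i)‖ ≤ δ at h1
    rw [aMat_mv1, norm_mul, Real.norm_eq_abs, Real.norm_eq_abs, Real.abs_exp] at h1
    rw [Real.exp_neg, ← div_eq_mul_inv, le_div_iff₀ (Real.exp_pos _)]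
    linarith
  · have h1 := (norm_le_pi_norm (lv (aSL m n hm hn L * uSL m n A * g) z) (Fin.natAdd m j)).trans hlt.le
    rw [mul_assoc, lv_mul, lv_mul] at h1
    change ‖(aMat m n L *ᵥ (uMat m n A *ᵥ lv g z)) (Fin.natAdd m j)‖ ≤ δ at h1
    rw [aMat_mv2, uMat_mv2, norm_mul, Real.norm_eq_abs, Real.norm_eq_abs, Real.abs_exp, Real.exp_neg,
      ← div_eq_inv_mul, div_le_iff₀ (Real.exp_pos _)] at h1
    exact h1

lemma eta_rho (hm : 0 < m) (hn : 0 < n) (δ L : ℝ) :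
    Real.exp (-(L / m)) ^ m * (δ * Real.exp (L / n)) ^ n = δ ^ n := by
  have hm' : (m:ℝ) ≠ 0 := by positivity
  have hn' : (n:ℝ) ≠ 0 := by positivity
  rw [mul_pow, ← Real.exp_nat_mul, ← Real.exp_nat_mul, mul_left_comm, ← Real.exp_add]
  have : (m:ℝ) * -(L / m) + n * (L / n) = 0 := by field_simp; ring
  rw [this]; simp

set_option maxHeartbeats 2000000 in
lemma bad_vol (hm : 0 < m) (hn : 0 < n) (δ R Q ε : ℝ) (hδ : 0 < δ) (hδ4 : δ ≤ 1 / 4) (hR : 1 ≤ R)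
    (hQ : 0 < Q) (hε : 0 < ε) :
    ∀ᶠ L : ℝ in atTop, ∀ g ∈ BddSL (m + n) R, Good δ g → ∀ (j0 : Fin n) (zv : Fin (m + n) → ℤ),
      Cone g j0 zv → ∑ i, |(zv i : ℝ)| ≤ Q →
      volume {t : Fin m → Fin n → ℝ | (∀ i j, |t i j| ≤ 1) ∧
        ¬ Good δ (aSL m n hm hn L * uSL m n (Aof (lv g zv) j0 (Real.exp (-(L / m))) t) * g)}
      ≤ ENNReal.ofReal ((2 ^ n * δ) ^ m + C0 m n * δ ^ (m + n) + ε) := by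
  obtain ⟨R', hR', hinv⟩ := inv_bdd (m + n) R
  have hd : (0:ℝ) < (m + n : ℕ) := by exact_mod_cast (by omega : 0 < m + n)
  set D : ℝ := 2 * ((m + n : ℕ) * R) with hD
  have hD0 : 0 ≤ D := by positivity
  set β : ℝ := D + 1 with hβ
  set C1 : ℝ := (m + n : ℕ) * R * Q with hC1
  have hC10 : 0 < C1 := by positivity
  set c : ℝ := 1 / (2 * Q * ((m + n : ℕ) * R')) with hc
  have hc0 : 0 < c := by positivity
  have hn' : (1:ℝ) ≤ n := by exact_mod_cast hn
  set c' : ℝ := c / (2 * n) with hc'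
  have hc'0 : 0 < c' := by positivity
  set K1 : ℝ := (2 * (1 + n * β + D)) ^ m * (2 * (β + D)) ^ (n - 1) * 2 * (2 ^ n * δ / c') ^ m with hK1
  have hK10 : 0 < K1 := by positivity
  have hη := eta_tendsto (m := m) hm
  have hρt : Tendsto (fun L : ℝ => δ * Real.exp (L / n)) atTop atTop :=
    Tendsto.const_mul_atTop hδ (Real.tendsto_exp_atTop.comp
      (tendsto_id.atTop_div_const (by linarith)))
  have hsm : ∀ᶠ L : ℝ in atTop, ¬ (m = 1 ∧ n = 1) →
     ((if 2 ≤ m then (C1 * β) / Real.exp (-(L / m)) else δ * Real.exp (L / n)) + D)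
      * Real.exp (-(L / m)) ^ m < ε / K1 := by
    by_cases h : m = 1 ∧ n = 1
    · exact Eventually.of_forall fun L h2 => absurd h h2
    · filter_upwards [(small_tendsto hm hn h (C1 * β) δ D).eventually_lt_const
        (show 0 < ε / K1 by positivity)] with L hL _ using hL
  filter_upwards [hsm, hη.eventually_lt_const hδ, hη.eventually_lt_const (show 0 < c / 2 by positivity),
    hη.eventually_lt_const (show 0 < 1 / (2 * C1) by positivity),
    hρt.eventually_ge_atTop D] with L hL1 hL2 hL3 hL4 hL5 g hg hgood j0 zv hcone hzQ
  set η := Real.exp (-(L / m)) with hηd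
  have hη0 : 0 < η := Real.exp_pos _
  set ρ := δ * Real.exp (L / n) with hρd
  have hρ0 : 0 < ρ := by positivity
  set v := lv g zv with hv
  have hVδ : δ ≤ |v (Fin.natAdd m j0)| := hcone.v_ne hδ hgood
  have hv0 : v (Fin.natAdd m j0) ≠ 0 := abs_pos.1 (hδ.trans_le hVδ)
  set V := |v (Fin.natAdd m j0)| with hV
  have hV0 : 0 < V := hδ.trans_le hVδ
  have hVC : V ≤ C1 := by
    have h1 := mv_bound g.1 hg (fun i => (zv i : ℝ)) (Fin.natAdd m j0)
    refine h1.trans ?_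
    rw [hC1]
    gcongr
    refine (pi_norm_le_iff_of_nonneg hQ.le).2 fun i => ?_
    exact (Finset.single_le_sum (f := fun i => |(zv i : ℝ)|) (fun i _ => abs_nonneg _)
        (Finset.mem_univ i)).trans hzQ
  have hδη : δ * η ≤ 1 := by nlinarith
  have hηρ : η ^ m * ρ ^ n = δ ^ n := eta_rho hm hn δ L
  set P : Set (Fin m → Fin n → ℝ) := {t | (∀ i j, |t i j| ≤ 1) ∧
    ∀ i, |0 + ∑ j, (Pi.single j0 (1:ℝ) : Fin n → ℝ) j * t i j| ≤ δ} with hP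
  set Big : Set (Fin m → Fin n → ℝ) := {t | (∀ i j, |t i j| ≤ 1) ∧ ∃ z : Fin (m + n) → ℤ,
        Act v j0 η (δ * η) (lv g z) t ∧ β ≤ ‖bof v j0 η (lv g z)‖ ∧
        ∀ j, |lv g z (Fin.natAdd m j)| ≤ ρ} with hBig
  set X : ℝ := if 2 ≤ m then (C1 * β) / η else ρ with hX
  have hX0 : 0 ≤ X := by rw [hX]; split_ifs <;> positivity
  set Sm : Set (Fin m → Fin n → ℝ) := {t | (∀ i j, |t i j| ≤ 1) ∧ ¬ (m = 1 ∧ n = 1) ∧ ∃ z : Fin (m + n) → ℤ,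
        Act v j0 η (δ * η) (lv g z) t ∧ c' ≤ ‖bof v j0 η (lv g z)‖ ∧ ‖bof v j0 η (lv g z)‖ ≤ β ∧
        |lv g z (Fin.natAdd m j0)| ≤ X} with hSm
  have hPv : volume P ≤ ENNReal.ofReal ((2 ^ n * δ) ^ m) := by
    have := slab_vol_m (m := m) (Pi.single j0 (1:ℝ)) j0 (by simp) (fun _ => 0) δ hδ.le
    simpa [hP] using this
  have hBv : volume Big ≤ ENNReal.ofReal (C0 m n * δ ^ (m + n)) :=
    big_vol g R hR hg j0 v hv0 hcone.cone η δ ρ β D hD hη0 (hL2.le.trans hVδ) hδ hδη hρ0 hL5 hηρ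
      (by linarith) (by linarith)
  have hSv : volume Sm ≤ ENNReal.ofReal ε := by
    by_cases h11 : m = 1 ∧ n = 1
    · have : Sm = ∅ := by
        rw [Set.eq_empty_iff_forall_notMem]
        rintro t ⟨_, h, _⟩
        exact h h11
      rw [this]; simp
    · have h1 := level_vol g R hR hg j0 v hv0 hcone.cone η (δ * η) c' β X D hD (by positivity) hc'0
        (by linarith) hX0
      refine (measure_mono ?_).trans (h1.trans (ENNReal.ofReal_le_ofReal ?_))
      · rintro t ⟨ht, -, h⟩; exact ⟨ht, h⟩
      · have h2 := hL1 h11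
        rw [lt_div_iff₀ hK10] at h2
        calc (2 * (δ * η + n * β + D)) ^ m * ((2 * (β + D)) ^ (n - 1) * (2 * (X + D)))
              * (2 ^ n * (δ * η) / c') ^ m
            ≤ (2 * (1 + n * β + D)) ^ m * ((2 * (β + D)) ^ (n - 1) * (2 * (X + D)))
              * (2 ^ n * (δ * η) / c') ^ m := by gcongr
          _ = (X + D) * η ^ m * K1 := by
              rw [hK1, show 2 ^ n * (δ * η) / c' = (2 ^ n * δ / c') * η by ring, mul_pow _ η]
              ring
          _ ≤ ε := h2.le
  have hsub : {t : Fin m → Fin n → ℝ | (∀ i j, |t i j| ≤ 1) ∧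
        ¬ Good δ (aSL m n hm hn L * uSL m n (Aof v j0 η t) * g)} ⊆ P ∪ Big ∪ Sm := by
    rintro t ⟨ht, hng⟩
    obtain ⟨z, hz0, h1, h2⟩ := not_good hm hn δ L hδ _ g hng
    have hA : Act v j0 η (δ * η) (lv g z) t := by
      intro i
      rw [← key_identity v j0 η t hv0]
      exact h1 i
    rcases par_or_big g R' Q hR' hQ (hinv g hg) j0 zv hcone hv0 hzQ z hz0 with ⟨hs, hw⟩ | ⟨⟨a, b, hab⟩, k, hk⟩
    · left; left
      refine ⟨ht, fun i => ?_⟩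
      have hAi := hA i
      set s := lv g z (Fin.natAdd m j0) / v (Fin.natAdd m j0) with hsd
      have e1 : lv g z (Fin.castAdd n i) - s * v (Fin.castAdd n i) = 0 := by
        rw [hw]; ring
      have e2 : ∀ j, bof v j0 η (lv g z) j = if j = j0 then s * η else 0 := by
        intro j
        unfold bof
        split_ifs with hj
        · rfl
        · rw [hw (Fin.natAdd m j)]; ring
      rw [e1, Finset.sum_congr rfl (fun j _ => by rw [e2 j])] at hAi
      simp only [ite_mul, zero_mul, Finset.sum_ite_eq', Finset.mem_univ, if_true, zero_add] at hAi
      simp only [Pi.single_apply, ite_mul, zero_mul, one_mul, Finset.sum_ite_eq', Finset.mem_univ,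
        if_true, zero_add]
      rw [abs_mul, abs_mul, abs_of_pos hη0] at hAi
      have h3 : |t i j0| * η ≤ |s| * η * |t i j0| := by
        have := mul_nonneg (abs_nonneg (t i j0)) hη0.le
        nlinarith
      nlinarith
    · have hkb : c ≤ δ * η + n * ‖bof v j0 η (lv g z)‖ := by
        refine hk.trans ?_
        have hb0 : 0 ≤ ‖bof v j0 η (lv g z)‖ := norm_nonneg _
        have hdη : 0 ≤ δ * η := by positivity
        refine Fin.addCases (fun i => ?_) (fun j => ?_) k
        · exact Act_c v j0 η _ _ t ht hA i
        · by_cases hj : j = j0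
          · subst hj
            have : lv g z (Fin.natAdd m j) - lv g z (Fin.natAdd m j) / lv g zv (Fin.natAdd m j)
              * lv g zv (Fin.natAdd m j) = 0 := by
              rw [div_mul_cancel₀ _ hv0, sub_self]
            rw [this, abs_zero]; positivity
          · have h4 : |bof v j0 η (lv g z) j| ≤ ‖bof v j0 η (lv g z)‖ :=
              norm_le_pi_norm (bof v j0 η (lv g z)) j
            rw [bof, if_neg hj] at h4
            refine h4.trans ?_
            have h5 := le_mul_of_one_le_left hb0 hn'
            linarith
      have hbc : c' ≤ ‖bof v j0 η (lv g z)‖ := by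
        rw [hc', div_le_iff₀ (by positivity)]
        nlinarith
      by_cases hbig : β ≤ ‖bof v j0 η (lv g z)‖
      · left; right
        exact ⟨ht, z, hA, hbig, h2⟩
      · right
        push Not at hbig
        refine ⟨ht, ?_, z, hA, hbc, hbig.le, ?_⟩
        · rintro ⟨rfl, rfl⟩
          have h5 := det_two g z zv a b hab j0 0 hv0
          have h6 := Act_c v j0 η _ _ t ht hA 0
          have h7 : ‖bof v j0 η (lv g z)‖ ≤ ρ * η / V := by
            refine (pi_norm_le_iff_of_nonneg (by positivity)).2 fun j => ?_
            have hj : j = j0 := Subsingleton.elim _ _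
            rw [hj, Real.norm_eq_abs, bof, if_pos rfl, abs_mul, abs_div, abs_of_pos hη0, div_mul_eq_mul_div]
            gcongr
            exact h2 j0
          simp only [pow_one] at hηρ
          rw [mul_comm ρ, hηρ, le_div_iff₀ hV0] at h7
          have h8 : 1 ≤ (δ * η + (1:ℕ) * ‖bof v j0 η (lv g z)‖) * V :=
            h5.trans (mul_le_mul_of_nonneg_right h6 hV0.le)
          have h9 : η * V ≤ 1 / 2 := by
            rw [lt_div_iff₀ (by positivity)] at hL4
            nlinarith
          push_cast at h8
          nlinarith
        · rw [hX]
          split_ifs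
          · refine (w_le_b v j0 η hη0 hv0 _).trans ?_
            gcongr
          · exact h2 j0
  refine (measure_mono hsub).trans ((measure_union_le _ _).trans ?_)
  rw [ENNReal.ofReal_add _ hε.le, ENNReal.ofReal_add]
  · exact add_le_add ((measure_union_le _ _).trans (add_le_add hPv hBv)) hSv
  · positivity
  · unfold C0; positivity
  · unfold C0; positivity
end
end

noncomputable section

section
variable {m n : ℕ}

lemma zm_inv {d : ℕ} (g : SLR d) (γ : Matrix.SpecialLinearGroup (Fin d) ℤ) :
    g * zm γ * zm γ⁻¹ = g := by
  have : zm γ * zm γ⁻¹ = 1 := by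
    unfold zm; rw [← map_mul]; simp
  rw [mul_assoc, this, mul_one]

lemma C0_ge : 1 ≤ C0 m n := by
  unfold C0
  have h1 : (1:ℝ) ≤ (4 * (n + 2)) ^ m := one_le_pow₀ (by have : (0:ℝ) ≤ n := by positivity
                                                         linarith)
  have h2 : (1:ℝ) ≤ 8 ^ (n - 1) := one_le_pow₀ (by norm_num)
  have h3 : (1:ℝ) ≤ (2 ^ n) ^ m := one_le_pow₀ (one_le_pow₀ (by norm_num))
  have h4 : (1:ℝ) ≤ 4 ^ n := one_le_pow₀ (by norm_num)
  have h5 := one_le_mul_of_one_le_of_one_le h1 h2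
  have h6 := one_le_mul_of_one_le_of_one_le h5 (by norm_num : (1:ℝ) ≤ 4)
  have h7 := one_le_mul_of_one_le_of_one_le h6 h3
  exact one_le_mul_of_one_le_of_one_le h7 h4

lemma own_vec (v : Fin (m + n) → ℝ) (j0 : Fin n) (η : ℝ) (t : Fin m → Fin n → ℝ)
    (hv : v (Fin.natAdd m j0) ≠ 0) (i : Fin m) :
    (uMat m n (Aof v j0 η t) *ᵥ v) (Fin.castAdd n i) = η * t i j0 := by
  rw [key_identity v j0 η t hv, div_self hv, one_mul, sub_self, zero_add]
  rw [Finset.sum_eq_single j0]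
  · rw [bof, if_pos rfl, div_self hv, one_mul]
  · intro j _ hj
    rw [bof, if_neg hj, div_self hv, one_mul, sub_self, zero_mul]
  · simp

lemma greedy {T : Type*} [MeasurableSpace T] (μ : Measure T) (Box Bad : Set T) (close : T → Set T)
    (hrefl : ∀ t, t ∈ close t) (x y : ℝ≥0∞) (hbad : μ Bad ≤ x) (K : ℕ) (hcl : ∀ t, μ (close t) ≤ y)
    (hlt : x + K * y < μ Box) :
    ∀ k ≤ K, ∃ F : Finset T, F.card = k ∧ (∀ t ∈ F, t ∈ Box ∧ t ∉ Bad) ∧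
      ∀ t ∈ F, ∀ t' ∈ F, t ≠ t' → (t ∉ close t' ∨ t' ∉ close t) := by
  classical
  intro k
  induction k with
  | zero => intro _; exact ⟨∅, by simp⟩
  | succ k ih =>
    intro hk
    obtain ⟨F, hc, hF, hs⟩ := ih (by omega)
    by_cases hself : ∃ t ∈ Box, t ∉ Bad ∧ t ∉ F ∧ ∀ t' ∈ F, t ∉ close t'
    · obtain ⟨t, htB, htb, htF, ht⟩ := hself
      refine ⟨insert t F, by rw [Finset.card_insert_of_notMem htF, hc], ?_, ?_⟩
      · intro u hu
        rcases Finset.mem_insert.1 hu with rfl | hu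
        · exact ⟨htB, htb⟩
        · exact hF u hu
      · intro u hu u' hu' hne
        rcases Finset.mem_insert.1 hu with rfl | hu1 <;> rcases Finset.mem_insert.1 hu' with rfl | hu2
        · exact absurd rfl hne
        · exact Or.inl (ht _ hu2)
        · exact Or.inr (ht _ hu1)
        · exact hs u hu1 u' hu2 hne
    · exfalso
      push Not at hself
      have hsub : Box ⊆ Bad ∪ ⋃ t ∈ F, close t := by
        intro t ht
        by_cases h1 : t ∈ Bad
        · exact Or.inl h1
        · right
          simp only [Set.mem_iUnion]
          by_cases h2 : t ∈ F
          · exact ⟨t, h2, hrefl t⟩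
          · obtain ⟨t', h3, h4⟩ := hself t ht h1 h2
            exact ⟨t', h3, h4⟩
      have h1 : μ Box ≤ x + K * y := by
        refine (measure_mono hsub).trans ((measure_union_le _ _).trans (add_le_add hbad ?_))
        refine (measure_biUnion_finset_le _ _).trans ((Finset.sum_le_sum (fun t _ => hcl t)).trans ?_)
        rw [Finset.sum_const, nsmul_eq_mul, hc]
        gcongr
        exact_mod_cast (by omega : k ≤ K)
      exact absurd hlt (not_lt.2 h1)

theorem child (hm : 0 < m) (hn : 0 < n) : ∃ δ C1 c : ℝ, 0 < δ ∧ δ ≤ 1 / 4 ∧ 0 < C1 ∧ 0 < c ∧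
    ∀ᶠ L : ℝ in atTop, ∀ g : SLR (m + n), Good δ g → ∀ K : ℕ, (K : ℝ) ≤ c * Real.exp ((m + n - 1) * L) →
      ∃ A : Fin K → Fin m → Fin n → ℝ, (∀ k i j, |A k i j| ≤ n + 1) ∧
        (∀ k k', k ≠ k' → ∃ i j, 8 * (n + 1) * Real.exp (-(kap m n * L)) ≤ |A k i j - A k' i j|) ∧
        (∀ k, Good δ (aSL m n hm hn L * uSL m n (A k) * g)) ∧
        ∃ z : Fin (m + n) → ℤ, z ≠ 0 ∧ ‖lv g z‖ ≤ C1 ∧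
          ∀ k i, |(uMat m n (A k) *ᵥ lv g z) (Fin.castAdd n i)| ≤ Real.exp (-(L / m)) := by
  classical
  have hC0 := C0_ge (m := m) (n := n)
  set δ : ℝ := 1 / (4 * C0 m n) with hδd
  have hδ : 0 < δ := by positivity
  have hδ4 : δ ≤ 1 / 4 := by
    rw [hδd]; apply one_div_le_one_div_of_le <;> linarith
  obtain ⟨R, hR, hmah⟩ := mahlerX (d := m + n) hδ
  obtain ⟨Q, hQ, hcone⟩ := exists_cone (m := m) (n := n) R hR
  have hd : (0:ℝ) < (m + n : ℕ) := by exact_mod_cast (by omega : 0 < m + n)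
  have hn' : (1:ℝ) ≤ n := by exact_mod_cast hn
  set C1 : ℝ := (m + n : ℕ) * R * Q with hC1
  have hC10 : 0 < C1 := by positivity
  set C' : ℝ := ((16 * (n + 1)) ^ n * (n * C1)) ^ m with hC'
  have hC'0 : 0 < C' := by positivity
  refine ⟨δ, C1, 1 / (8 * C'), hδ, hδ4, hC10, by positivity, ?_⟩
  filter_upwards [bad_vol hm hn δ R Q (1 / 4) hδ hδ4 hR hQ (by norm_num),
    (eta_tendsto hm).eventually_lt_const hδ] with L hbad hηδ g0 hg0 K hK
  obtain ⟨γ, hγ⟩ := hmah g0 hg0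
  set g := g0 * zm γ with hg
  have hgood : Good δ g := Good_zm hg0 γ
  set j0 : Fin n := ⟨0, hn⟩ with hj0
  obtain ⟨zv, hzc, hzQ⟩ := hcone g hγ j0
  have hbad' := hbad g hγ hgood j0 zv hzc hzQ
  set η := Real.exp (-(L / m)) with hηd
  have hη0 : 0 < η := Real.exp_pos _
  set v := lv g zv with hv
  have hVδ : δ ≤ |v (Fin.natAdd m j0)| := hzc.v_ne hδ hgood
  have hv0 : v (Fin.natAdd m j0) ≠ 0 := abs_pos.1 (hδ.trans_le hVδ)
  have hvn : ‖v‖ ≤ C1 := by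
    refine (pi_norm_le_iff_of_nonneg hC10.le).2 fun i => ?_
    have h1 := mv_bound g.1 hγ (fun i => (zv i : ℝ)) i
    refine h1.trans ?_
    rw [hC1]
    gcongr
    refine (pi_norm_le_iff_of_nonneg hQ.le).2 fun i => ?_
    exact (Finset.single_le_sum (f := fun i => |(zv i : ℝ)|) (fun i _ => abs_nonneg _)
        (Finset.mem_univ i)).trans hzQ
  have hVC : |v (Fin.natAdd m j0)| ≤ C1 := (norm_le_pi_norm v (Fin.natAdd m j0)).trans hvn
  set ε0 : ℝ := 8 * (n + 1) * Real.exp (-(kap m n * L)) with hε0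
  have hε00 : 0 < ε0 := by positivity
  set Box : Set (Fin m → Fin n → ℝ) := {t | ∀ i j, |t i j| ≤ 1} with hBox
  set close : (Fin m → Fin n → ℝ) → Set (Fin m → Fin n → ℝ) := fun t' =>
    {t | ∀ i j, |Aof v j0 η t i j - Aof v j0 η t' i j| ≤ ε0} with hclose
  have hBoxv : volume Box = ENNReal.ofReal ((2 ^ n) ^ m) := by
    have := box_vol (m := m) (n := n) (fun _ => 1) (fun _ => zero_le_one) 0
    simpa using this
  have hclv : ∀ t', volume (close t') ≤ ENNReal.ofReal (C' * Real.exp (-((m + n - 1) * L))) := by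
    intro t'
    set τ : Fin n → ℝ := fun j => if j = j0 then n * |v (Fin.natAdd m j0)| * ε0 / η else ε0 with hτ
    have hτ0 : ∀ j, 0 ≤ τ j := by intro j; simp only [hτ]; split_ifs <;> positivity
    have h1 : close t' ⊆ {t | ∀ i j, |t i j - t' i j| ≤ τ j} := by
      intro t ht i j
      exact Aof_close v j0 η t t' hη0 hv0 hzc.cone ε0 ht i j
    refine (measure_mono h1).trans ?_
    rw [box_vol τ hτ0]
    apply ENNReal.ofReal_le_ofReal
    have h2 : ∏ j, (2 * τ j) ≤ (2 * ε0) ^ n * (n * C1) / η := by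
      have h3 : ∏ j, (2 * τ j) = ∏ j, ((2 * ε0) * (if j = j0 then n * |v (Fin.natAdd m j0)| / η else 1)) := by
        refine Finset.prod_congr rfl fun j _ => ?_
        simp only [hτ]; split_ifs
        · ring
        · ring
      rw [h3, Finset.prod_mul_distrib, Finset.prod_ite_eq']
      simp only [Finset.prod_const, Finset.card_univ, Fintype.card_fin, Finset.mem_univ, if_true]
      calc (2 * ε0) ^ n * (n * |v (Fin.natAdd m j0)| / η) ≤ (2 * ε0) ^ n * (n * C1 / η) := by gcongr
        _ = _ := by ring
    calc (∏ j, (2 * τ j)) ^ m ≤ ((2 * ε0) ^ n * (n * C1) / η) ^ m := by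
          have : 0 ≤ ∏ j, (2 * τ j) := Finset.prod_nonneg fun j _ => by have := hτ0 j; positivity
          gcongr
      _ = C' * (Real.exp (-(kap m n * L)) ^ (n * m) / η ^ m) := by
          have e : (2 * ε0) ^ n = (16 * (n + 1)) ^ n * Real.exp (-(kap m n * L)) ^ n := by
            rw [hε0, ← mul_pow]; ring_nf
          rw [e, div_pow, hC', pow_mul, mul_pow, mul_pow, mul_pow (_ ^ n) (n * C1)]
          ring
      _ = C' * Real.exp (-((m + n - 1) * L)) := by
          congr 1
          rw [hηd, ← Real.exp_nat_mul, ← Real.exp_nat_mul, ← Real.exp_sub]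
          congr 1
          have hk := kap_mul hm hn
          have hm' : (m:ℝ) ≠ 0 := by positivity
          push_cast
          have : (m:ℝ) * -(L / m) = -L := by field_simp
          rw [this]
          linear_combination (-L) * hk
      _ ≤ _ := le_rfl
  set Bad : Set (Fin m → Fin n → ℝ) := {t | (∀ i j, |t i j| ≤ 1) ∧
        ¬ Good δ (aSL m n hm hn L * uSL m n (Aof v j0 η t) * g)} with hBad
  have hp1 : (1:ℝ) ≤ (2 ^ n) ^ m := one_le_pow₀ (one_le_pow₀ (by norm_num))
  have hp2 : (2:ℝ) ≤ (2 ^ n) ^ m := by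
    rw [← pow_mul]
    calc (2:ℝ) = 2 ^ 1 := by norm_num
      _ ≤ 2 ^ (n * m) := pow_le_pow_right₀ (by norm_num) (Nat.mul_pos hn hm)
  have hlt : ENNReal.ofReal ((2 ^ n * δ) ^ m + C0 m n * δ ^ (m + n) + 1 / 4)
      + K * ENNReal.ofReal (C' * Real.exp (-((m + n - 1) * L))) < volume Box := by
    rw [hBoxv, ← ENNReal.ofReal_natCast, ← ENNReal.ofReal_mul (by positivity), ← ENNReal.ofReal_add
      (by positivity) (by positivity)]
    apply (ENNReal.ofReal_lt_ofReal_iff (by positivity)).2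
    have h1 : (2 ^ n * δ) ^ m ≤ (2 ^ n) ^ m * (1 / 4) := by
      rw [mul_pow]
      gcongr
      calc δ ^ m ≤ δ ^ 1 := pow_le_pow_of_le_one hδ.le (by linarith) hm
        _ ≤ 1 / 4 := by simpa using hδ4
    have h2 : C0 m n * δ ^ (m + n) ≤ 1 / 4 := by
      calc C0 m n * δ ^ (m + n) ≤ C0 m n * δ ^ 1 := by
            gcongr ?_ * ?_
            exact pow_le_pow_of_le_one hδ.le (by linarith) (by omega)
        _ = 1 / 4 := by rw [hδd, pow_one]; field_simp
    have h3 : (K : ℝ) * (C' * Real.exp (-((m + n - 1) * L))) ≤ 1 / 8 := by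
      calc (K : ℝ) * (C' * Real.exp (-((m + n - 1) * L)))
          ≤ (1 / (8 * C') * Real.exp ((m + n - 1) * L)) * (C' * Real.exp (-((m + n - 1) * L))) := by
            gcongr
        _ = 1 / 8 * (Real.exp ((m + n - 1) * L) * Real.exp (-((m + n - 1) * L))) := by
            field_simp
        _ = 1 / 8 := by rw [← Real.exp_add]; simp
    linarith
  obtain ⟨F, hFc, hF, hFs⟩ := greedy volume Box Bad close (fun t i j => by simpa using hε00.le) _ _
    hbad' K hclv hlt K le_rfl
  let e : Fin K ≃ F := (F.equivFinOfCardEq hFc).symm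
  refine ⟨fun k => Aof v j0 η (e k).1, fun k i j => ?_, fun k k' hkk => ?_, fun k => ?_,
    γ.1 *ᵥ zv, zm_ne γ hzc.ne, ?_, fun k i => ?_⟩
  · exact Aof_bound v j0 η _ hη0.le (hηδ.le.trans hVδ) hv0 hzc.cone (hF _ (e k).2).1 i j
  · have hne : (e k).1 ≠ (e k').1 := fun h => hkk (e.injective (Subtype.ext h))
    rcases hFs _ (e k).2 _ (e k').2 hne with h | h
    · simp only [hclose, Set.mem_setOf_eq] at h
      push Not at h
      obtain ⟨i, j, h⟩ := h
      exact ⟨i, j, h.le⟩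
    · simp only [hclose, Set.mem_setOf_eq] at h
      push Not at h
      obtain ⟨i, j, h⟩ := h
      exact ⟨i, j, by rw [abs_sub_comm]; exact h.le⟩
  · obtain ⟨h1, h2⟩ := hF _ (e k).2
    simp only [hBad, Set.mem_setOf_eq, not_and, not_not] at h2
    have h3 := Good_zm (h2 h1) γ⁻¹
    rwa [hg, ← mul_assoc, zm_inv] at h3
  · rw [← lv_zm]; exact hvn
  · rw [← lv_zm]
    change |(uMat m n (Aof v j0 η (e k).1) *ᵥ v) (Fin.castAdd n i)| ≤ η
    rw [own_vec v j0 η _ hv0, abs_mul, abs_of_pos hη0]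
    have := (hF _ (e k).2).1 i j0
    nlinarith
end
end

noncomputable section

/-- geometric sums -/
def gsum (q : ℝ) (a : ℕ → ℝ) (i : ℕ) : ℝ := ∑' j, q ^ j * a (i + j)

lemma gsum_summable {q M : ℝ} {a : ℕ → ℝ} (hq : 0 < q) (hq2 : q ≤ 1 / 2) (ha : ∀ i, |a i| ≤ M) (i : ℕ) :
    Summable fun j => q ^ j * a (i + j) := by
  refine Summable.of_norm_bounded (g := fun j => q ^ j * M)
    ((summable_geometric_of_lt_one hq.le (by linarith)).mul_right M) fun j => ?_
  rw [norm_mul, Real.norm_eq_abs, Real.norm_eq_abs, abs_of_nonneg (by positivity)]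
  exact mul_le_mul_of_nonneg_left (ha _) (by positivity)

lemma gsum_succ {q M : ℝ} {a : ℕ → ℝ} (hq : 0 < q) (hq2 : q ≤ 1 / 2) (ha : ∀ i, |a i| ≤ M) (i : ℕ) :
    gsum q a i = a i + q * gsum q a (i + 1) := by
  unfold gsum
  rw [(gsum_summable hq hq2 ha i).tsum_eq_zero_add, ← tsum_mul_left]
  simp only [pow_zero, one_mul, add_zero]
  congr 1
  refine tsum_congr fun j => ?_
  rw [show i + (j + 1) = i + 1 + j by ring]; ring

lemma gsum_bound {q M : ℝ} {a : ℕ → ℝ} (hq : 0 < q) (hq2 : q ≤ 1 / 2) (ha : ∀ i, |a i| ≤ M) (i : ℕ) :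
    |gsum q a i| ≤ 2 * M := by
  have hM : 0 ≤ M := (abs_nonneg _).trans (ha 0)
  have h1 : |gsum q a i| ≤ ∑' j, q ^ j * M := by
    have hs := (summable_geometric_of_lt_one hq.le (by linarith)).mul_right M
    rw [← Real.norm_eq_abs]
    unfold gsum
    refine tsum_of_norm_bounded (f := fun j => q ^ j * a (i + j)) hs.hasSum fun j => ?_
    rw [norm_mul, Real.norm_eq_abs, Real.norm_eq_abs, abs_of_nonneg (by positivity)]
    exact mul_le_mul_of_nonneg_left (ha _) (by positivity)
  refine h1.trans ?_
  rw [tsum_mul_right, tsum_geometric_of_lt_one hq.le (by linarith)]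
  have : (1 - q)⁻¹ ≤ 2 := by
    rw [inv_le_comm₀ (by linarith) (by norm_num)]; norm_num; linarith
  nlinarith

section
variable {m n : ℕ}

lemma u_norm (B : Fin m → Fin n → ℝ) (M : ℝ) (hM : 0 ≤ M) (hB : ∀ i j, |B i j| ≤ M) (w : Fin (m + n) → ℝ) :
    ‖uMat m n B *ᵥ w‖ ≤ (1 + n * M) * ‖w‖ := by
  refine (pi_norm_le_iff_of_nonneg (by positivity)).2 fun i => ?_
  rw [Real.norm_eq_abs]
  have hw : ∀ i, |w i| ≤ ‖w‖ := fun i => norm_le_pi_norm w i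
  have hnM : 0 ≤ n * M * ‖w‖ := by positivity
  refine Fin.addCases (fun i => ?_) (fun j => ?_) i
  · rw [uMat_mv1]
    refine (abs_add_le _ _).trans ?_
    have : |∑ j, B i j * w (Fin.natAdd m j)| ≤ n * (M * ‖w‖) := by
      refine (Finset.abs_sum_le_sum_abs _ _).trans ?_
      refine (Finset.sum_le_sum (g := fun _ => M * ‖w‖) fun j _ => ?_).trans (by simp)
      rw [abs_mul]
      exact mul_le_mul (hB i j) (hw _) (abs_nonneg _) hM
    nlinarith [hw (Fin.castAdd n i)]
  · rw [uMat_mv2]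
    nlinarith [hw (Fin.natAdd m j)]

lemma uSL_Good (B : Fin m → Fin n → ℝ) (M δ : ℝ) (hM : 0 ≤ M) (hB : ∀ i j, |B i j| ≤ M) (g : SLR (m + n))
    (hg : Good δ g) : Good (δ / (1 + n * M)) (uSL m n B * g) := by
  intro z hz
  rw [div_le_iff₀ (by positivity)]
  refine (hg z hz).trans ?_
  have h1 : lv g z = uMat m n (fun i j => - B i j) *ᵥ lv (uSL m n B * g) z := by
    rw [lv_mul]
    have h2 : (uSL m n (fun i j => - B i j) * uSL m n B) = 1 := by
      rw [← uSL_add]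
      rw [show ((fun i j => - B i j) + B) = (0 : Fin m → Fin n → ℝ) from by funext i j; simp]
      exact uSL_zero
    have h3 := SL_mul_mv (uSL m n (fun i j => - B i j)) (uSL m n B) (lv g z)
    rw [h2, SL_one_mv] at h3
    exact h3
  rw [h1, mul_comm]
  exact u_norm _ M hM (fun i j => by rw [abs_neg]; exact hB i j) _

/-- the set of pattern points -/
def EE (m n : ℕ) (hm : 0 < m) (hn : 0 < n) (R C L : ℝ) : Set (XSp (m + n)) :=
  qm '' {g | g ∈ BddSL (m + n) R ∧ ∃ z : Fin (m + n) → ℤ, z ≠ 0 ∧ ‖lv g z‖ ≤ C ∧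
    ‖lv (aSL m n hm hn L * g) z‖ ≤ C}

lemma lv_cont {d : ℕ} (z : Fin d → ℤ) : Continuous fun g : SLR d => lv g z := by
  unfold lv
  exact Continuous.matrix_mulVec continuous_subtype_val continuous_const

lemma EE_compact (hm : 0 < m) (hn : 0 < n) (R C L : ℝ) : IsCompact (EE m n hm hn R C L) := by
  obtain ⟨R', hR', hinv⟩ := inv_bdd (m + n) R
  apply IsCompact.image _ (qm_cont _)
  set N : ℤ := ⌈(m + n : ℕ) * R' * C⌉ with hN
  have hfin : (Set.Icc (fun _ : Fin (m + n) => -N) (fun _ => N)).Finite := Set.finite_Icc _ _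
  have e : {g | g ∈ BddSL (m + n) R ∧ ∃ z : Fin (m + n) → ℤ, z ≠ 0 ∧ ‖lv g z‖ ≤ C ∧
    ‖lv (aSL m n hm hn L * g) z‖ ≤ C} = BddSL (m + n) R ∩
      ⋃ z ∈ (Set.Icc (fun _ : Fin (m + n) => -N) (fun _ => N)) ∩ {z | z ≠ 0},
        {g | ‖lv g z‖ ≤ C ∧ ‖lv (aSL m n hm hn L * g) z‖ ≤ C} := by
    ext g
    simp only [Set.mem_setOf_eq, Set.mem_inter_iff, Set.mem_iUnion, exists_prop]
    constructor
    · rintro ⟨hg, z, hz, h1, h2⟩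
      refine ⟨hg, z, ⟨?_, hz⟩, h1, h2⟩
      have hb : ∀ i, |(z i : ℝ)| ≤ N := by
        intro i
        have h3 := mv_bound g⁻¹.1 (hinv g hg) (lv g z) i
        unfold lv at h3
        rw [SL_inv_mv] at h3
        refine h3.trans (le_trans ?_ (Int.le_ceil _))
        gcongr
        exact h1
      constructor <;> intro i
      · have := (abs_le.1 (hb i)).1
        exact_mod_cast this
      · have := (abs_le.1 (hb i)).2
        exact_mod_cast this
    · rintro ⟨hg, z, ⟨-, hz⟩, h1, h2⟩
      exact ⟨hg, z, hz, h1, h2⟩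
  rw [e]
  apply (BddSL_compact _ _).inter_right
  refine Set.Finite.isClosed_biUnion (hfin.subset Set.inter_subset_left) fun z _ => ?_
  apply IsClosed.and
  · exact isClosed_le (lv_cont z).norm continuous_const
  · exact isClosed_le ((lv_cont z).comp (continuous_const.mul continuous_id)).norm continuous_const

end
end

noncomputable section

section
variable {m n : ℕ}

lemma Good_one {d : ℕ} {δ : ℝ} (hδ : δ ≤ 1) : Good δ (1 : SLR d) := by
  intro z hz
  unfold lv
  rw [SL_one_mv]
  exact hδ.trans (int_vec_norm hz)

lemma mem_EE (hm : 0 < m) (hn : 0 < n) {R C L : ℝ} (g : SLR (m + n))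
    (γ : Matrix.SpecialLinearGroup (Fin (m + n)) ℤ) (hg : g * zm γ ∈ BddSL (m + n) R)
    (z : Fin (m + n) → ℤ) (hz : z ≠ 0) (h1 : ‖lv g z‖ ≤ C) (h2 : ‖lv (aSL m n hm hn L * g) z‖ ≤ C) :
    qm g ∈ EE m n hm hn R C L := by
  refine ⟨g * zm γ, ⟨hg, γ⁻¹.1 *ᵥ z, zm_ne _ hz, ?_, ?_⟩, qm_zm _ _⟩
  · rw [← lv_zm, zm_inv]; exact h1
  · rw [← lv_zm, ← mul_assoc, zm_inv]; exact h2

set_option maxHeartbeats 1000000 in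
theorem tree (hm : 0 < m) (hn : 0 < n) : ∃ R C c : ℝ, 1 ≤ R ∧ 0 < C ∧ 0 < c ∧
    ∀ᶠ L : ℕ in atTop, ∀ K : ℕ, (K : ℝ) ≤ c * Real.exp ((m + n - 1) * L) →
    ∃ (B : (ℕ → Fin K) → ℕ → Fin m → Fin n → ℝ) (z : (ℕ → Fin K) → XSp (m + n)),
      (∀ ω i, (aAct m n hm hn)^[i * L] (z ω) ∈ EE m n hm hn R C L) ∧
      (∀ ω i p j, |B ω i p j| ≤ 2 * (n + 1)) ∧
      (∀ ω ω' i0, (∀ i < i0, ω i = ω' i) → ∃ g : SLR (m + n),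
        (aAct m n hm hn)^[i0 * L] (z ω) = qm (uSL m n (B ω i0) * g) ∧
        (aAct m n hm hn)^[i0 * L] (z ω') = qm (uSL m n (B ω' i0) * g)) ∧
      (∀ (ω ω' : ℕ → Fin K) (i0 i : ℕ), (∀ k < i0 + i, ω k = ω' k) → ω (i0 + i) ≠ ω' (i0 + i) →
        ∃ p j, 4 * (n + 1) ≤ Real.exp (kap m n * (L * (i + 1))) * |B ω i0 p j - B ω' i0 p j|) := by
  obtain ⟨δ, C1, c, hδ, hδ1, hC1, hc, hev⟩ := child hm hn
  set M : ℝ := 2 * (n + 1) with hM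
  have hM0 : 0 ≤ M := by positivity
  obtain ⟨R, hR1, hR⟩ := mahlerX (d := m + n) (δ := δ / (1 + n * M)) (by positivity)
  have hkap := kap_pos hm hn
  refine ⟨R, (1 + n * M) * max 1 C1, c, hR1, by positivity, hc, ?_⟩
  have hq : ∀ᶠ L : ℝ in atTop, Real.exp (-(kap m n * L)) ≤ 1 / 2 := by
    have : Tendsto (fun L : ℝ => Real.exp (-(kap m n * L))) atTop (𝓝 0) :=
      Real.tendsto_exp_neg_atTop_nhds_zero.comp (tendsto_id.const_mul_atTop hkap)
    exact this.eventually_le_const (by norm_num)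
  have hev2 := tendsto_natCast_atTop_atTop.eventually (hev.and (hq.and (eventually_ge_atTop (0:ℝ))))
  filter_upwards [hev2] with L ⟨hL, hqL, hL0⟩ K hK
  choose A hA1 hA2 hA3 ζ hζ hζ1 hζ2 using fun g hg => hL g hg K hK
  set q := Real.exp (-(kap m n * L)) with hqd
  have hq0 : 0 < q := Real.exp_pos _
  have hqe : Real.exp (kap m n * L) * q = 1 := by rw [hqd, ← Real.exp_add]; simp
  let G : (ℕ → Fin K) → ℕ → {g : SLR (m + n) // Good δ g} := fun ω i =>
    Nat.rec ⟨1, Good_one (by linarith)⟩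
      (fun i g => ⟨aSL m n hm hn L * uSL m n (A g.1 g.2 (ω i)) * g.1, hA3 g.1 g.2 (ω i)⟩) i
  let AA : (ℕ → Fin K) → ℕ → Fin m → Fin n → ℝ := fun ω i => A (G ω i).1 (G ω i).2 (ω i)
  have hGs : ∀ ω i, (G ω (i + 1)).1 = aSL m n hm hn L * uSL m n (AA ω i) * (G ω i).1 := fun ω i => rfl
  have hAA : ∀ ω i p j, |AA ω i p j| ≤ n + 1 := fun ω i p j => hA1 _ _ _ _ _
  have hGc : ∀ ω ω' i0, (∀ i < i0, ω i = ω' i) → G ω i0 = G ω' i0 := by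
    intro ω ω' i0
    induction i0 with
    | zero => intro _; rfl
    | succ i0 ih =>
      intro h
      have h1 := ih fun i hi => h i (by omega)
      have h2 := h i0 (by omega)
      apply Subtype.ext
      rw [hGs, hGs, h1]
      congr 3
      show A (G ω i0).1 (G ω i0).2 (ω i0) = A (G ω' i0).1 (G ω' i0).2 (ω' i0)
      rw [h1, h2]
  let B : (ℕ → Fin K) → ℕ → Fin m → Fin n → ℝ := fun ω i p j => gsum q (fun k => AA ω k p j) i
  have hBs : ∀ ω i p j, B ω i p j = AA ω i p j + q * B ω (i + 1) p j := fun ω i p j =>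
    gsum_succ hq0 hqL (fun k => hAA ω k p j) i
  have hBb : ∀ ω i p j, |B ω i p j| ≤ M := fun ω i p j =>
    gsum_bound hq0 hqL (fun k => hAA ω k p j) i
  have hAAe : ∀ ω i, AA ω i = A (G ω i).1 (G ω i).2 (ω i) := fun _ _ => rfl
  clear_value B AA G
  have hstep : ∀ ω i, aSL m n hm hn L * (uSL m n (B ω i) * (G ω i).1)
      = uSL m n (B ω (i + 1)) * (G ω (i + 1)).1 := by
    intro ω i
    have e : B ω i = (fun p j => q * B ω (i + 1) p j) + AA ω i := by
      funext p j; exact (hBs ω i p j).trans (add_comm _ _)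
    rw [e, uSL_add, hGs]
    simp only [← mul_assoc]
    rw [aSL_uSL]
    congr 4
    funext p j
    rw [← mul_assoc, hqe, one_mul]
  have hiter : ∀ ω i, (aAct m n hm hn)^[i * L] (qm (uSL m n (B ω 0) * (G ω 0).1))
      = qm (uSL m n (B ω i) * (G ω i).1) := by
    intro ω i
    induction i with
    | zero => simp
    | succ i ih =>
      rw [show (i + 1) * L = L + i * L by ring, Function.iterate_add_apply, ih, aAct_iter, smul_qm, hstep]
  refine ⟨B, fun ω => qm (uSL m n (B ω 0) * (G ω 0).1), ?_, hBb, ?_, ?_⟩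
  · intro ω i
    rw [hiter]
    obtain ⟨γ, hγ⟩ := hR _ (uSL_Good (B ω i) M δ hM0 (hBb ω i) (G ω i).1 (G ω i).2)
    refine mem_EE hm hn _ γ hγ (ζ (G ω i).1 (G ω i).2) (hζ _ _) ?_ ?_
    · rw [lv_mul]
      refine (u_norm _ M hM0 (hBb ω i) _).trans ?_
      gcongr
      exact (hζ1 _ _).trans (le_max_right _ _)
    · rw [hstep, lv_mul]
      refine (u_norm _ M hM0 (hBb ω (i + 1)) _).trans ?_
      gcongr
      rw [hGs, mul_assoc, lv_mul, lv_mul]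
      refine (pi_norm_le_iff_of_nonneg (by positivity)).2 fun k => ?_
      rw [Real.norm_eq_abs]
      refine Fin.addCases (fun k => ?_) (fun k => ?_) k
      · refine le_trans ?_ (le_max_left _ _)
        have h1 := hζ2 (G ω i).1 (G ω i).2 (ω i) k
        rw [← hAAe] at h1
        show |(aMat m n L *ᵥ (uMat m n _ *ᵥ _)) _| ≤ 1
        rw [aMat_mv1, abs_mul, abs_of_pos (Real.exp_pos _)]
        calc Real.exp (L / m) * _ ≤ Real.exp (L / m) * Real.exp (-(L / m)) :=
              mul_le_mul_of_nonneg_left h1 (Real.exp_pos _).le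
          _ = 1 := by rw [← Real.exp_add]; simp
      · refine le_trans ?_ (le_max_right _ _)
        show |(aMat m n L *ᵥ (uMat m n _ *ᵥ _)) _| ≤ C1
        rw [aMat_mv2, uMat_mv2, abs_mul, abs_of_pos (Real.exp_pos _)]
        have h1 : |lv (G ω i).1 (ζ (G ω i).1 (G ω i).2) (Fin.natAdd m k)| ≤ C1 :=
          (norm_le_pi_norm (lv (G ω i).1 (ζ (G ω i).1 (G ω i).2)) _).trans (hζ1 _ _)
        have h2 : Real.exp (-((L:ℝ) / n)) ≤ 1 := Real.exp_le_one_iff.2 (by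
          rw [neg_nonpos]; positivity)
        calc _ ≤ 1 * C1 := mul_le_mul h2 h1 (abs_nonneg _) zero_le_one
          _ = C1 := one_mul _
  · intro ω ω' i0 h
    refine ⟨(G ω i0).1, hiter _ _, ?_⟩
    rw [hGc ω ω' i0 h]; exact hiter _ _
  · intro ω ω' i0 i
    induction i generalizing i0 with
    | zero =>
      intro h hne
      simp only [add_zero] at h hne
      obtain ⟨p, j, hpj⟩ := hA2 (G ω i0).1 (G ω i0).2 (ω i0) (ω' i0) hne
      refine ⟨p, j, ?_⟩
      have e1 : A (G ω i0).1 (G ω i0).2 (ω' i0) = AA ω' i0 := by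
        rw [hAAe, hGc ω ω' i0 h]
      rw [e1, ← hAAe] at hpj
      rw [hBs ω i0, hBs ω' i0]
      have h3 := hBb ω (i0 + 1) p j
      have h4 := hBb ω' (i0 + 1) p j
      have h5 : |AA ω i0 p j - AA ω' i0 p j| ≤ |AA ω i0 p j + q * B ω (i0 + 1) p j -
          (AA ω' i0 p j + q * B ω' (i0 + 1) p j)| + q * (2 * M) := by
        have h6 : |q * (B ω (i0 + 1) p j - B ω' (i0 + 1) p j)| ≤ q * (2 * M) := by
          rw [abs_mul, abs_of_pos hq0]
          refine mul_le_mul_of_nonneg_left ?_ hq0.le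
          refine (abs_sub _ _).trans (by linarith)
        have h7 := abs_sub_abs_le_abs_sub (AA ω i0 p j - AA ω' i0 p j)
          (-(q * (B ω (i0 + 1) p j - B ω' (i0 + 1) p j)))
        rw [abs_neg] at h7
        rw [show AA ω i0 p j + q * B ω (i0 + 1) p j -
          (AA ω' i0 p j + q * B ω' (i0 + 1) p j) = AA ω i0 p j - AA ω' i0 p j -
          (-(q * (B ω (i0 + 1) p j - B ω' (i0 + 1) p j))) by ring]
        linarith
      have h8 : 4 * ((n:ℝ) + 1) * q ≤ |AA ω i0 p j + q * B ω (i0 + 1) p j -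
          (AA ω' i0 p j + q * B ω' (i0 + 1) p j)| := by rw [hM] at h5; linarith
      have h9 := mul_le_mul_of_nonneg_left h8 (Real.exp_pos (kap m n * L)).le
      simp only [Nat.cast_zero, zero_add, mul_one]
      refine le_trans (le_of_eq ?_) h9
      linear_combination -(4 * ((n:ℝ) + 1)) * hqe
    | succ i ih =>
      intro h hne
      obtain ⟨p, j, hpj⟩ := ih (i0 + 1) (fun k hk => h k (by omega)) (by
        rw [show i0 + 1 + i = i0 + (i + 1) by ring]; exact hne)
      refine ⟨p, j, hpj.trans (le_of_eq ?_)⟩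
      have e1 : AA ω i0 = AA ω' i0 := by
        rw [hAAe, hAAe, hGc ω ω' i0 (fun k hk => h k (by omega)), h i0 (by omega)]
      rw [hBs ω i0, hBs ω' i0, e1, show AA ω' i0 p j + q * B ω (i0 + 1) p j -
          (AA ω' i0 p j + q * B ω' (i0 + 1) p j) = q * (B ω (i0 + 1) p j - B ω' (i0 + 1) p j) by ring,
        abs_mul, abs_of_pos hq0]
      have e2 : Real.exp (kap m n * (L * (i + 1))) = Real.exp (kap m n * (L * ((i + 1 : ℕ) + 1))) * q := by
        rw [hqd, ← Real.exp_add]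
        congr 1
        push_cast; ring
      rw [e2]; ring

end
end

noncomputable section

section
variable {m n : ℕ}

lemma a_bdd (hm : 0 < m) (hn : 0 < n) (L R : ℝ) : ∀ s : ℝ, |s| ≤ L →
    ∀ g ∈ BddSL (m + n) R, aSL m n hm hn s * g ∈ BddSL (m + n) (Real.exp L * R) := by
  intro s hs g hg i j
  have hL : 0 ≤ L := (abs_nonneg _).trans hs
  have hR : 0 ≤ R := (abs_nonneg _).trans (hg i j)
  have e : (aSL m n hm hn s * g).1 i j = (aMat m n s *ᵥ (fun k => g.1 k j)) i := rfl
  have hdiv : ∀ k : ℕ, 0 < k → |s / k| ≤ L := by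
    intro k hk
    have hk1 : (1:ℝ) ≤ k := by exact_mod_cast hk
    rw [abs_div, abs_of_pos (show (0:ℝ) < k by linarith)]
    exact (div_le_self (abs_nonneg _) hk1).trans hs
  rw [e]
  revert e
  refine Fin.addCases (fun i => ?_) (fun i => ?_) i <;> intro _
  · rw [aMat_mv1, abs_mul, abs_of_pos (Real.exp_pos _)]
    exact mul_le_mul (Real.exp_le_exp.2 ((le_abs_self _).trans (hdiv m hm))) (hg _ _) (abs_nonneg _) (Real.exp_pos _).le
  · rw [aMat_mv2, abs_mul, abs_of_pos (Real.exp_pos _)]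
    exact mul_le_mul (Real.exp_le_exp.2 ((neg_le_abs _).trans (hdiv n hn))) (hg _ _) (abs_nonneg _) (Real.exp_pos _).le

lemma uSL_cont : Continuous (fun C : Fin m → Fin n → ℝ => uSL m n C) := by
  refine Continuous.subtype_mk ?_ _
  unfold uMat
  refine continuous_matrix fun i j => ?_
  refine Fin.addCases (fun i => ?_) (fun i => ?_) i <;> refine Fin.addCases (fun j => ?_) (fun j => ?_) j <;>
    simp <;> fun_prop

lemma stab (R0 : ℝ) : ∃ r : ℝ, 0 < r ∧ r ≤ 1 ∧ ∀ g ∈ BddSL (m + n) R0, ∀ C : Fin m → Fin n → ℝ, C ≠ 0 →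
    ‖C‖ ≤ r → qm g ≠ qm (uSL m n C * g) := by
  obtain ⟨δ, hδ, hgood⟩ := bdd_good (m + n) R0
  set R1 := max R0 1
  have hR1 : 0 < R1 := lt_of_lt_of_le one_pos (le_max_right _ _)
  refine ⟨min 1 (δ / (2 * (n + 1) * R1)), by positivity, min_le_left _ _, ?_⟩
  intro g hg C hC hCr e
  obtain ⟨γ, hγ⟩ := qm_eq.1 e
  change uSL m n C * g = g * zm γ at hγ
  have hcol : ∀ (h : SLR (m + n)) (j : Fin (m + n)) i, lv h (Pi.single j 1) i = h.1 i j := by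
    intro h j i
    unfold lv
    rw [show (fun i => ((Pi.single j 1 : Fin (m + n) → ℤ) i : ℝ)) = Pi.single j 1 from by
      funext i
      by_cases hij : i = j
      · subst hij; simp
      · simp [Pi.single_eq_of_ne hij]]
    simp
  have key : ∀ j, lv (uSL m n C * g) (Pi.single j 1) = lv g (Pi.single j 1) := by
    intro j
    by_contra hne
    have h1 : γ.1 *ᵥ (Pi.single j 1) - Pi.single j 1 ≠ 0 := by
      intro h0
      apply hne
      rw [hγ, lv_zm, sub_eq_zero.1 h0]
    have h2 := hgood g hg _ h1
    rw [lv_sub, ← lv_zm, ← hγ, lv_mul] at h2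
    have hw : ∀ k, |lv g (Pi.single j 1) k| ≤ R1 := fun k => by
      rw [hcol]; exact (hg k j).trans (le_max_left _ _)
    have h3 : ‖uMat m n C *ᵥ lv g (Pi.single j 1) - lv g (Pi.single j 1)‖ ≤ n * (δ / (2 * (n + 1) * R1) * R1) := by
      refine (pi_norm_le_iff_of_nonneg (by positivity)).2 fun k => ?_
      rw [Real.norm_eq_abs, Pi.sub_apply]
      refine Fin.addCases (fun k => ?_) (fun k => ?_) k
      · rw [uMat_mv1, add_sub_cancel_left]
        refine (Finset.abs_sum_le_sum_abs _ _).trans ?_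
        refine (Finset.sum_le_sum (g := fun _ => δ / (2 * (n + 1) * R1) * R1) fun l _ => ?_).trans (by simp)
        rw [abs_mul]
        refine mul_le_mul ?_ (hw _) (abs_nonneg _) (by positivity)
        exact (norm_le_pi_norm (C k) l).trans ((norm_le_pi_norm C k).trans (hCr.trans (min_le_right _ _)))
      · rw [uMat_mv2, sub_self, abs_zero]; positivity
    have h4 : (n:ℝ) * (δ / (2 * (n + 1) * R1) * R1) < δ := by
      rw [show (n:ℝ) * (δ / (2 * (n + 1) * R1) * R1) = δ * (n / (2 * (n + 1))) by field_simp]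
      have : (n:ℝ) / (2 * (n + 1)) < 1 := by rw [div_lt_one (by positivity)]; linarith [(Nat.cast_nonneg n : (0:ℝ) ≤ n)]
      nlinarith
    exact absurd (h2.trans h3) (not_le.2 h4)
  have h5 : uSL m n C * g = g := by
    apply Subtype.ext
    ext i j
    rw [← hcol, key, hcol]
  have h6 : uSL m n C = 1 := by simpa using h5
  apply hC
  funext i j
  have h7 : (uSL m n C).1 (Fin.castAdd n i) (Fin.natAdd m j) = (1 : SLR (m + n)).1 (Fin.castAdd n i) (Fin.natAdd m j) := by rw [h6]
  have h8 : uMat m n C (Fin.castAdd n i) (Fin.natAdd m j) = (1 : Matrix (Fin (m + n)) (Fin (m + n)) ℝ) (Fin.castAdd n i) (Fin.natAdd m j) := h7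
  rw [uMat_12, Matrix.one_apply_ne] at h8
  · exact h8
  · intro h
    have := congrArg Fin.val h
    simp at this
    omega

lemma cell {E : Type*} [NormedAddCommGroup E] [NormedSpace ℝ E] [ProperSpace E] (M r : ℝ) (hr : 0 < r) :
    ∃ (N : ℕ) (f : E → Fin N), ∀ x y, ‖x‖ ≤ M → ‖y‖ ≤ M → f x = f y → ‖x - y‖ ≤ r := by
  classical
  obtain ⟨t, -, htf, htc⟩ := (isCompact_closedBall (0 : E) M).finite_cover_balls (half_pos hr)
  haveI := htf.to_subtype
  obtain ⟨N, ⟨e⟩⟩ := Finite.exists_equiv_fin t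
  let f : E → Fin (N + 1) := fun x => if h : ∃ c : t, x ∈ Metric.ball (c : E) (r / 2) then
    (e h.choose).castSucc else Fin.last N
  refine ⟨N + 1, f, ?_⟩
  have hf : ∀ x, ‖x‖ ≤ M → ∃ c : t, f x = (e c).castSucc ∧ x ∈ Metric.ball (c : E) (r / 2) := by
    intro x hx
    have h : ∃ c : t, x ∈ Metric.ball (c : E) (r / 2) := by
      have := htc (show x ∈ Metric.closedBall (0:E) M by simpa using hx)
      simp only [Set.mem_iUnion] at this
      obtain ⟨c, hc, h⟩ := this
      exact ⟨⟨c, hc⟩, h⟩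
    exact ⟨h.choose, dif_pos h, h.choose_spec⟩
  intro x y hx hy hxy
  obtain ⟨c, hc, hxc⟩ := hf x hx
  obtain ⟨c', hc', hyc⟩ := hf y hy
  rw [hc, hc'] at hxy
  have : c = c' := e.injective (Fin.castSucc_injective _ hxy)
  subst this
  rw [← dist_eq_norm]
  have h1 := dist_triangle_right x y (c : E)
  rw [Metric.mem_ball] at hxc hyc
  linarith

end
end

noncomputable section

section
variable {m n : ℕ}

lemma sep (hm : 0 < m) (hn : 0 < n) (K L : ℕ) (R0 : ℝ)
    (B : (ℕ → Fin K) → ℕ → Fin m → Fin n → ℝ) (z : (ℕ → Fin K) → XSp (m + n))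
    (h1 : ∀ ω j, (aAct m n hm hn)^[j] (z ω) ∈ qm '' BddSL (m + n) R0)
    (h2 : ∀ ω i p j, |B ω i p j| ≤ 2 * (n + 1))
    (h3 : ∀ (ω ω' : ℕ → Fin K) (i0 : ℕ), (∀ i < i0, ω i = ω' i) → ∃ g : SLR (m + n),
        (aAct m n hm hn)^[i0 * L] (z ω) = qm (uSL m n (B ω i0) * g) ∧
        (aAct m n hm hn)^[i0 * L] (z ω') = qm (uSL m n (B ω' i0) * g))
    (h4 : ∀ (ω ω' : ℕ → Fin K) (i0 i : ℕ), (∀ k < i0 + i, ω k = ω' k) → ω (i0 + i) ≠ ω' (i0 + i) →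
        ∃ p j, 4 * ((n:ℝ) + 1) ≤ Real.exp (kap m n * (L * (i + 1))) * |B ω i0 p j - B ω' i0 p j|) :
    ∃ S : Set (XSp (m + n) × XSp (m + n)), IsCompact S ∧ (∀ p ∈ S, p.1 ≠ p.2) ∧
    ∃ (C : ℕ) (c : ℕ → (ℕ → Fin K) → Fin C),
      ∀ i0 l ω ω', (∀ i, i < i0 ∨ i0 + l ≤ i → ω i = ω' i) → c i0 ω = c i0 ω' → ω ≠ ω' →
      ∃ t ≤ l * L, ((aAct m n hm hn)^[i0 * L + t] (z ω), (aAct m n hm hn)^[i0 * L + t] (z ω')) ∈ S := by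
  obtain ⟨r', hr', hr1, hst⟩ := stab (m := m) (n := n) R0
  have hk := kap_pos hm hn
  set r := r' * Real.exp (-(kap m n)) with hr
  have hr0 : 0 < r := by positivity
  have hrr : r * Real.exp (kap m n) = r' := by rw [hr, mul_assoc, ← Real.exp_add]; simp
  have hrle : r ≤ r' := by
    have : (1:ℝ) ≤ Real.exp (kap m n) := Real.one_le_exp hk.le
    nlinarith
  obtain ⟨N, f, hf⟩ := cell (E := Fin m → Fin n → ℝ) (2 * (n + 1)) r hr0
  have hBn : ∀ ω i, ‖B ω i‖ ≤ 2 * (n + 1) := fun ω i =>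
    (pi_norm_le_iff_of_nonneg (by positivity)).2 fun p => (pi_norm_le_iff_of_nonneg (by positivity)).2 fun j => h2 ω i p j
  refine ⟨(fun p : SLR (m + n) × (Fin m → Fin n → ℝ) => (qm p.1, qm (uSL m n p.2 * p.1))) ''
    (BddSL (m + n) R0 ×ˢ {C | r ≤ ‖C‖ ∧ ‖C‖ ≤ r'}), ?_, ?_, N, fun i ω => f (B ω i), ?_⟩
  · refine ((BddSL_compact _ _).prod ?_).image ?_
    · have : {C : Fin m → Fin n → ℝ | r ≤ ‖C‖ ∧ ‖C‖ ≤ r'} = Metric.closedBall 0 r' ∩ {C | r ≤ ‖C‖} := by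
        ext C; simp [and_comm]
      rw [this]
      exact (isCompact_closedBall _ _).inter_right (isClosed_le continuous_const continuous_norm)
    · refine ((qm_cont _).comp continuous_fst).prodMk ((qm_cont _).comp ?_)
      exact (uSL_cont.comp continuous_snd).mul continuous_fst
  · rintro _ ⟨⟨g, C⟩, ⟨hg, hC1, hC2⟩, rfl⟩
    refine hst g hg C ?_ hC2
    rintro rfl
    rw [norm_zero] at hC1; linarith
  · intro i0 l ω ω' hag hc hne
    obtain ⟨g, hg1, hg2⟩ := h3 ω ω' i0 fun i hi => hag i (Or.inl hi)
    set D := B ω' i0 - B ω i0 with hD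
    have hDr : ‖D‖ ≤ r := by rw [hD]; exact hf _ _ (hBn _ _) (hBn _ _) hc.symm
    have hlast : r ≤ Real.exp (kap m n * (l * L : ℕ)) * ‖D‖ := by
      classical
      have hex : ∃ k, ω k ≠ ω' k := Function.ne_iff.1 hne
      have hs := Nat.find_spec hex
      have hmin := fun k hk => not_not.1 (Nat.find_min hex (m := k) hk)
      set k := Nat.find hex
      have hk1 : i0 ≤ k := by
        by_contra h; exact hs (hag k (Or.inl (by omega)))
      have hk2 : k < i0 + l := by
        by_contra h; exact hs (hag k (Or.inr (by omega)))
      obtain ⟨i, hi⟩ := Nat.exists_eq_add_of_le hk1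
      rw [hi] at hs hmin
      obtain ⟨p, j, hpj⟩ := h4 ω ω' i0 i hmin hs
      have e1 : |B ω i0 p j - B ω' i0 p j| ≤ ‖D‖ := by
        rw [abs_sub_comm]
        exact (norm_le_pi_norm (D p) j).trans (norm_le_pi_norm D p)
      have e2 : (i:ℝ) + 1 ≤ l := by
        have : i + 1 ≤ l := by omega
        exact_mod_cast this
      have e3 : Real.exp (kap m n * (L * (i + 1))) ≤ Real.exp (kap m n * (l * L : ℕ)) := by
        apply Real.exp_le_exp.2
        push_cast
        refine mul_le_mul_of_nonneg_left ?_ hk.le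
        rw [mul_comm]
        exact mul_le_mul_of_nonneg_right e2 (Nat.cast_nonneg _)
      have e4 : 4 * ((n:ℝ) + 1) ≤ Real.exp (kap m n * (l * L : ℕ)) * ‖D‖ :=
        hpj.trans (mul_le_mul e3 e1 (abs_nonneg _) (Real.exp_pos _).le)
      have : (0:ℝ) ≤ n := Nat.cast_nonneg n
      linarith
    have hmain : ∃ t ≤ l * L, r ≤ Real.exp (kap m n * (t : ℕ)) * ‖D‖ ∧ Real.exp (kap m n * (t : ℕ)) * ‖D‖ ≤ r' := by
      classical
      have hex : ∃ t : ℕ, r ≤ Real.exp (kap m n * (t : ℕ)) * ‖D‖ := ⟨_, hlast⟩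
      have hs := Nat.find_spec hex
      have hle : Nat.find hex ≤ l * L := Nat.find_min' hex hlast
      refine ⟨Nat.find hex, hle, hs, ?_⟩
      rcases Nat.eq_zero_or_pos (Nat.find hex) with h0 | hpos
      · rw [h0]; simp; linarith
      · have hm1 := Nat.find_min hex (m := Nat.find hex - 1) (by omega)
        rw [not_le] at hm1
        have e : Real.exp (kap m n * (Nat.find hex : ℕ)) = Real.exp (kap m n * ((Nat.find hex - 1 : ℕ))) * Real.exp (kap m n) := by
          rw [← Real.exp_add]; congr 1
          rw [Nat.cast_sub hpos]; push_cast; ring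
        rw [e, ← hrr]
        have := Real.exp_pos (kap m n)
        nlinarith
    obtain ⟨t, ht, ht1, ht2⟩ := hmain
    refine ⟨t, ht, ?_⟩
    obtain ⟨h, hh, hhe⟩ := h1 ω (i0 * L + t)
    have e2 : (aAct m n hm hn)^[i0 * L + t] (z ω') = uSL m n (fun p j => Real.exp (kap m n * t) * D p j) •
        (aAct m n hm hn)^[i0 * L + t] (z ω) := by
      rw [add_comm (i0 * L) t, Function.iterate_add_apply, Function.iterate_add_apply, hg1, hg2, aAct_iter, aAct_iter,
        smul_qm, smul_qm, smul_qm]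
      congr 1
      rw [← mul_assoc, ← mul_assoc, ← mul_assoc, ← aSL_uSL, mul_assoc (aSL m n hm hn t) (uSL m n D), ← uSL_add]
      rw [hD]; simp
    refine ⟨(h, fun p j => Real.exp (kap m n * t) * D p j), ⟨hh, ?_⟩, ?_⟩
    · have : (fun p j => Real.exp (kap m n * t) * D p j) = Real.exp (kap m n * t) • D := by
        funext p j; simp
      show r ≤ ‖_‖ ∧ ‖_‖ ≤ r'
      simp only [this, norm_smul, Real.norm_eq_abs, abs_of_pos (Real.exp_pos _)]
      exact ⟨ht1, ht2⟩
    · rw [e2, ← hhe]; rfl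

end
end

noncomputable section

section
variable {m n : ℕ}

/-- points whose forward orbit visits the pattern set along an arithmetic progression -/
def YY (m n : ℕ) (hm : 0 < m) (hn : 0 < n) (R C : ℝ) (L : ℕ) : Set (XSp (m + n)) :=
  {x | ∃ s < L, ∀ i : ℕ, (aAct m n hm hn)^[i * L + s] x ∈ EE m n hm hn R C L}

lemma YY_closed (hm : 0 < m) (hn : 0 < n) (R C : ℝ) (L : ℕ) : IsClosed (YY m n hm hn R C L) := by
  have e : YY m n hm hn R C L = ⋃ s ∈ Set.Iio L, ⋂ i : ℕ, (aAct m n hm hn)^[i * L + s] ⁻¹' EE m n hm hn R C L := by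
    ext x; simp [YY]
  rw [e]
  refine Set.Finite.isClosed_biUnion (Set.finite_Iio L) fun s _ => isClosed_iInter fun i => ?_
  exact (EE_compact hm hn R C L).isClosed.preimage ((aAct_cont hm hn).iterate _)

lemma orbit_YY (hm : 0 < m) (hn : 0 < n) (R C : ℝ) (L : ℕ) (hL : 0 < L) (x : XSp (m + n))
    (hx : ∀ i : ℕ, (aAct m n hm hn)^[i * L] x ∈ EE m n hm hn R C L) (j : ℕ) :
    (aAct m n hm hn)^[j] x ∈ YY m n hm hn R C L := by
  have hmod := Nat.div_add_mod j L
  have hlt := Nat.mod_lt j hL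
  by_cases h0 : j % L = 0
  · refine ⟨0, hL, fun i => ?_⟩
    rw [← Function.iterate_add_apply]
    have := hx (i + j / L)
    rwa [show i * L + 0 + j = (i + j / L) * L by rw [add_mul, mul_comm (j / L)]; omega]
  · refine ⟨L - j % L, by omega, fun i => ?_⟩
    rw [← Function.iterate_add_apply]
    have := hx (i + j / L + 1)
    rwa [show i * L + (L - j % L) + j = (i + j / L + 1) * L by rw [add_mul, add_mul, mul_comm (j / L)]; omega]

lemma YY_decomp (hm : 0 < m) (hn : 0 < n) {R C : ℝ} {L : ℕ} (hL : 0 < L) {x : XSp (m + n)} {s : ℕ}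
    (hx : ∀ i : ℕ, (aAct m n hm hn)^[i * L + s] x ∈ EE m n hm hn R C L) (j : ℕ) (hj : s ≤ j) :
    ∃ e ∈ EE m n hm hn R C L, (aAct m n hm hn)^[j] x = (aAct m n hm hn)^[(j - s) % L] e := by
  refine ⟨_, hx ((j - s) / L), ?_⟩
  rw [← Function.iterate_add_apply]
  congr 1
  have := Nat.div_add_mod (j - s) L
  rw [mul_comm] at this
  congr 1
  omega

lemma YY_bdd (hm : 0 < m) (hn : 0 < n) {R C : ℝ} {L : ℕ} (hL : 0 < L) {x : XSp (m + n)}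
    (hx : x ∈ YY m n hm hn R C L) (j : ℕ) :
    (aAct m n hm hn)^[j] x ∈ qm '' BddSL (m + n) (Real.exp L * R) := by
  obtain ⟨s, hs, hx⟩ := hx
  rcases le_total s j with h | h
  · obtain ⟨_, ⟨g, ⟨hg, -⟩, rfl⟩, he⟩ := YY_decomp hm hn hL hx j h
    rw [he, aAct_iter, smul_qm]
    refine ⟨_, a_bdd hm hn L R _ ?_ g hg, rfl⟩
    rw [abs_of_nonneg (Nat.cast_nonneg _)]
    exact_mod_cast (Nat.mod_lt (j - s) hL).le
  · obtain ⟨g, ⟨hg, -⟩, he⟩ := hx 0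
    have e : (aAct m n hm hn)^[j] x = aSL m n hm hn (-((s - j : ℕ) : ℝ)) • qm g := by
      have e0 : (aAct m n hm hn)^[0 * L + s] x = (aAct m n hm hn)^[s - j] ((aAct m n hm hn)^[j] x) := by
        rw [← Function.iterate_add_apply, show s - j + j = 0 * L + s by omega]
      rw [he, e0, aAct_iter _ _ (s - j), smul_smul, aSL_neg, inv_mul_cancel, one_smul]
    rw [e, smul_qm]
    refine ⟨_, a_bdd hm hn L R _ ?_ g hg, rfl⟩
    rw [abs_neg, abs_of_nonneg (Nat.cast_nonneg _)]
    exact_mod_cast (by omega : s - j ≤ L)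

lemma compact_good {d : ℕ} (Q : Set (XSp d)) (hQ : IsCompact Q) : ∃ η : ℝ, 0 < η ∧ ∀ g, qm g ∈ Q → Good η g := by
  have hcov : Q ⊆ ⋃ k : ℕ, qm '' {g : SLR d | ∀ i j, |g.1 i j| < k} := by
    intro x _
    obtain ⟨g, rfl⟩ := qm_surj x
    obtain ⟨k, hk⟩ := exists_nat_gt (∑ i, ∑ j, |g.1 i j|)
    refine Set.mem_iUnion.2 ⟨k, g, fun i j => lt_of_le_of_lt ?_ hk, rfl⟩
    refine le_trans ?_ (Finset.single_le_sum (f := fun i => ∑ j, |g.1 i j|) (fun i _ => Finset.sum_nonneg fun j _ => abs_nonneg _) (Finset.mem_univ i))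
    exact Finset.single_le_sum (f := fun j => |g.1 i j|) (fun j _ => abs_nonneg _) (Finset.mem_univ j)
  have hopen : ∀ k : ℕ, IsOpen (qm '' {g : SLR d | ∀ i j, |g.1 i j| < k}) := by
    intro k
    apply qm_open
    simp only [Set.setOf_forall]
    refine isOpen_iInter_of_finite fun i => isOpen_iInter_of_finite fun j => ?_
    have : Continuous fun g : SLR d => g.1 i j := (continuous_apply_apply i j).comp continuous_subtype_val
    exact isOpen_lt this.abs continuous_const
  obtain ⟨k, hk⟩ := hQ.elim_directed_cover _ hopen hcov (directed_of_isDirected_le fun a b hab =>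
    Set.image_mono fun g hg i j => lt_of_lt_of_le (hg i j) (by exact_mod_cast hab))
  obtain ⟨η, hη, h⟩ := bdd_good d k
  refine ⟨η, hη, fun g hg => ?_⟩
  obtain ⟨g', hg', e⟩ := hk hg
  intro z hz
  obtain ⟨z', hz', e'⟩ := lv_of_qm_eq e hz
  rw [← e']
  exact h g' (fun i j => (hg' i j).le) z' hz'

lemma EE_escape (hm : 0 < m) (hn : 0 < n) (R C : ℝ) (Q : Set (XSp (m + n))) (hQ : IsCompact Q) :
    ∃ W : ℕ, ∀ L u : ℕ, u ≤ L → ∀ e ∈ EE m n hm hn R C L, (aAct m n hm hn)^[u] e ∈ Q → u ≤ W ∨ L - u ≤ W := by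
  obtain ⟨η, hη, hgood⟩ := compact_good Q hQ
  have hm0 : (0:ℝ) < m := by exact_mod_cast hm
  have hn0 : (0:ℝ) < n := by exact_mod_cast hn
  set D := max C 1 with hD
  have hD0 : 0 < D := lt_of_lt_of_le one_pos (le_max_right _ _)
  obtain ⟨W, hW⟩ := exists_nat_ge ((m + n) * |Real.log (D / η)|)
  have key : ∀ (k : ℕ), 0 < k → k ≤ m + n → ∀ t : ℝ, η ≤ Real.exp (-(t / k)) * D → t ≤ W := by
    intro k hk hk2 t ht
    refine le_trans ?_ hW
    have h1 : Real.log η ≤ -(t / k) + Real.log D := by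
      have := Real.log_le_log hη ht
      rwa [Real.log_mul (Real.exp_pos _).ne' hD0.ne', Real.log_exp] at this
    have hk0 : (0:ℝ) < k := by exact_mod_cast hk
    have h2 : t / k ≤ |Real.log (D / η)| := by
      refine le_trans ?_ (le_abs_self _)
      rw [Real.log_div hD0.ne' hη.ne']; linarith
    rw [div_le_iff₀ hk0] at h2
    have h3 : (k:ℝ) ≤ m + n := by exact_mod_cast hk2
    nlinarith [abs_nonneg (Real.log (D / η))]
  refine ⟨W, ?_⟩
  rintro L u hu _ ⟨g, ⟨-, z, hz, h1, h2⟩, rfl⟩ hq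
  rw [aAct_iter, smul_qm] at hq
  by_contra hcon
  push Not at hcon
  have h3 := hgood _ hq z hz
  have h4 : ‖lv (aSL m n hm hn u * g) z‖ < η := by
    refine (pi_norm_lt_iff hη).2 fun k => ?_
    rw [Real.norm_eq_abs, lv_mul]
    by_contra hge
    rw [not_lt] at hge
    revert hge
    refine Fin.addCases (fun k => ?_) (fun k => ?_) k <;> intro hge
    · have h5 := (norm_le_pi_norm (lv (aSL m n hm hn L * g) z) (Fin.castAdd n k)).trans (h2.trans (le_max_left C 1))
      rw [Real.norm_eq_abs, lv_mul] at h5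
      change |(aMat m n L *ᵥ lv g z) _| ≤ D at h5
      change η ≤ |(aMat m n u *ᵥ lv g z) _| at hge
      rw [aMat_mv1, abs_mul, abs_of_pos (Real.exp_pos _)] at h5 hge
      have h6 := key m hm (by omega) (L - u) (hge.trans ?_)
      · have : ((L - u : ℕ) : ℝ) ≤ W := by rw [Nat.cast_sub hu]; exact h6
        have : L - u ≤ W := by exact_mod_cast this
        omega
      · rw [show Real.exp ((u:ℝ) / m) = Real.exp (-(((L:ℝ) - u) / m)) * Real.exp ((L:ℝ) / m) by
          rw [← Real.exp_add]; congr 1; ring, mul_assoc]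
        exact mul_le_mul_of_nonneg_left h5 (Real.exp_pos _).le
    · have h5 := (norm_le_pi_norm (lv g z) (Fin.natAdd m k)).trans (h1.trans (le_max_left C 1))
      rw [Real.norm_eq_abs] at h5
      change η ≤ |(aMat m n u *ᵥ lv g z) _| at hge
      rw [aMat_mv2, abs_mul, abs_of_pos (Real.exp_pos _)] at hge
      have h6 := key n hn (by omega) u (hge.trans (mul_le_mul_of_nonneg_left h5 (Real.exp_pos _).le))
      have : u ≤ W := by exact_mod_cast h6
      omega
  linarith

lemma escape (hm : 0 < m) (hn : 0 < n) (R C : ℝ) (Q : Set (XSp (m + n))) (hQ : IsCompact Q) :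
    ∃ M : ℕ, ∀ (L : ℕ), 0 < L → ∀ μ : Measure (XSp (m + n)), IsProbabilityMeasure μ →
      MeasurePreserving (aAct m n hm hn) μ μ → μ (YY m n hm hn R C L)ᶜ = 0 →
      L * μ Q ≤ M := by
  classical
  obtain ⟨W, hW⟩ := EE_escape hm hn R C Q hQ
  refine ⟨2 * W + 2, ?_⟩
  intro L hL μ hμ hT hY
  have hQm : MeasurableSet Q := hQ.isClosed.measurableSet
  have hm1 : ∀ j : ℕ, MeasurableSet ((aAct m n hm hn)^[j] ⁻¹' Q) := fun j =>
    (hT.iterate j).measurable hQm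
  have h1 : (L : ℝ≥0∞) * μ Q = ∑ j ∈ Finset.Ico L (2 * L), μ ((aAct m n hm hn)^[j] ⁻¹' Q) := by
    rw [Finset.sum_congr rfl fun j _ => (hT.iterate j).measure_preimage hQm.nullMeasurableSet]
    simp [two_mul]
  rw [h1]
  have h2 : ∑ j ∈ Finset.Ico L (2 * L), μ ((aAct m n hm hn)^[j] ⁻¹' Q)
      = ∫⁻ x, ∑ j ∈ Finset.Ico L (2 * L), ((aAct m n hm hn)^[j] ⁻¹' Q).indicator 1 x ∂μ := by
    rw [lintegral_finsetSum _ fun j _ => measurable_one.indicator (hm1 j)]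
    refine Finset.sum_congr rfl fun j _ => ?_
    rw [lintegral_indicator_one (hm1 j)]
  rw [h2]
  calc _ ≤ ∫⁻ x, ((2 * W + 2 : ℕ) : ℝ≥0∞) ∂μ := by
        refine lintegral_mono_ae ?_
        have : ∀ᵐ x ∂μ, x ∈ YY m n hm hn R C L := by rw [ae_iff]; exact hY
        filter_upwards [this] with x hx
        obtain ⟨s, hs, hx⟩ := hx
        have e : ∑ j ∈ Finset.Ico L (2 * L), ((aAct m n hm hn)^[j] ⁻¹' Q).indicator (1 : XSp (m + n) → ℝ≥0∞) x
            = (((Finset.Ico L (2 * L)).filter fun j => (aAct m n hm hn)^[j] x ∈ Q).card : ℝ≥0∞) := by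
          rw [Finset.card_filter]
          push_cast
          refine Finset.sum_congr rfl fun j _ => ?_
          by_cases h : (aAct m n hm hn)^[j] x ∈ Q <;> simp [Set.indicator, h]
        rw [e]
        have hc : ((Finset.Ico L (2 * L)).filter fun j => (aAct m n hm hn)^[j] x ∈ Q).card ≤ 2 * W + 2 := by
          calc _ ≤ (Finset.range (W + 1) ∪ (Finset.range (W + 1)).image (fun u => L - u)).card := by
                refine Finset.card_le_card_of_injOn (fun j => (j - s) % L) ?_ ?_
                · intro j hj
                  simp only [Finset.coe_filter, Finset.mem_Ico, Set.mem_setOf_eq] at hj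
                  obtain ⟨⟨hj1, hj2⟩, hjQ⟩ := hj
                  obtain ⟨e, he, hej⟩ := YY_decomp hm hn hL hx j (by omega)
                  have hlt := Nat.mod_lt (j - s) hL
                  have := hW L _ hlt.le e he (by rw [← hej]; exact hjQ)
                  simp only [Finset.coe_union, Finset.coe_image, Set.mem_union, Finset.mem_coe, Finset.mem_range, Set.mem_image]
                  rcases this with h | h
                  · left; omega
                  · right; exact ⟨L - (j - s) % L, by omega, by omega⟩
                · intro j hj j' hj' hjj
                  simp only [Finset.coe_filter, Finset.mem_Ico, Set.mem_setOf_eq] at hj hj'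
                  have := Nat.ModEq.eq_of_abs_lt (m := L) (a := j - s) (b := j' - s) hjj (by
                    rw [abs_lt]; constructor <;> omega)
                  omega
            _ ≤ (W + 1) + (W + 1) := by
                refine (Finset.card_union_le _ _).trans (add_le_add (by simp) (Finset.card_image_le.trans (by simp)))
            _ = 2 * W + 2 := by ring
        exact_mod_cast hc
    _ = _ := by simp

end
end

noncomputable section

lemma count_good {d : ℕ} {δ : ℝ} (hδ : 0 < δ) (C : ℝ) (hC : 0 ≤ C) : ∃ N0 : ℝ, 0 < N0 ∧ ∀ h : SLR d, Good δ h →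
    ∃ F : Finset (Fin d → ℤ), (∀ z, ‖lv h z‖ ≤ C → z ∈ F) ∧ (F.card : ℝ) ≤ N0 := by
  classical
  obtain ⟨R, hR1, hR⟩ := mahlerX (d := d) hδ
  refine ⟨(2 * (C + d * R)) ^ d + 1, by positivity, fun h hh => ?_⟩
  obtain ⟨γ, hγ⟩ := hR h hh
  obtain ⟨F, hF, hc⟩ := count_set (h * zm γ).1 (by rw [(h * zm γ).2]; simp) (d * R) (by
    intro x hx i
    refine (mv_bound _ hγ x i).trans ?_
    have : ‖x‖ ≤ 1 := (pi_norm_le_iff_of_nonneg zero_le_one).2 fun i => by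
      rw [Real.norm_eq_abs, abs_of_nonneg (hx i).1]; exact (hx i).2
    nlinarith [mul_nonneg (Nat.cast_nonneg d : (0:ℝ) ≤ d) (by linarith : (0:ℝ) ≤ R)])
    {z | ‖lv (h * zm γ) z‖ ≤ C} (fun _ => C) (fun _ => by positivity) (by
      intro z hz i
      exact (norm_le_pi_norm (lv (h * zm γ) z) i).trans hz)
  refine ⟨F.image fun z => γ.1 *ᵥ z, ?_, ?_⟩
  · intro z hz
    rw [Finset.mem_image]
    refine ⟨γ⁻¹.1 *ᵥ z, ?_, ?_⟩
    · rw [hF]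
      show ‖_‖ ≤ C
      rw [← lv_zm, zm_inv]; exact hz
    · rw [Matrix.mulVec_mulVec]
      have : γ.1 * γ⁻¹.1 = 1 := congrArg Subtype.val (mul_inv_cancel γ)
      rw [this, Matrix.one_mulVec]
  · refine le_trans (Nat.cast_le.2 Finset.card_image_le) (hc.trans ?_)
    simp

/-- grid lemma: pick representatives of grid cells -/
lemma grid {α ι : Type*} [Fintype ι] [DecidableEq ι] (S : Set α) (Φ : α → ι → ℝ) (b : ι → ℝ) (hb : ∀ i, 0 ≤ b i) (ε : ℝ) (hε : 0 < ε)
    (h : ∀ x ∈ S, ∀ i, |Φ x i| ≤ b i) :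
    ∃ Θ : Finset α, (Θ.card : ℝ) ≤ ∏ i, (2 * b i / ε + 2) ∧ ∀ x ∈ S, ∃ y ∈ Θ, y ∈ S ∧ ∀ i, |Φ x i - Φ y i| ≤ ε := by
  classical
  let code : α → ι → ℤ := fun x i => ⌊Φ x i / ε⌋
  let G : Finset (ι → ℤ) := Fintype.piFinset fun i => Finset.Icc ⌊-b i / ε⌋ ⌊b i / ε⌋
  let P : (ι → ℤ) → Prop := fun k => ∃ x ∈ S, code x = k
  let f : (ι → ℤ) → Option α := fun k => if h : P k then some h.choose else none
  refine ⟨(G.filter P).attach.image fun k => (Finset.mem_filter.1 k.2).2.choose, ?_, ?_⟩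
  · refine le_trans (Nat.cast_le.2 (Finset.card_image_le.trans (Finset.card_attach.le.trans (Finset.card_filter_le _ _)))) ?_
    rw [Fintype.card_piFinset]
    push_cast
    refine Finset.prod_le_prod (fun _ _ => Nat.cast_nonneg _) fun i _ => ?_
    rw [Int.card_Icc]
    have h1 : ((⌊b i / ε⌋ + 1 - ⌊-b i / ε⌋).toNat : ℝ) = ((⌊b i / ε⌋ + 1 - ⌊-b i / ε⌋ : ℤ) : ℝ) := by
      have : 0 ≤ ⌊b i / ε⌋ + 1 - ⌊-b i / ε⌋ := by
        have : ⌊-b i / ε⌋ ≤ ⌊b i / ε⌋ := Int.floor_le_floor (by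
          apply div_le_div_of_nonneg_right _ hε.le; linarith [hb i])
        omega
      exact_mod_cast Int.toNat_of_nonneg this
    rw [h1]
    push_cast
    have h2 := Int.floor_le (b i / ε)
    have h3 := Int.lt_floor_add_one (-b i / ε)
    have h4 : -b i / ε = -(b i / ε) := by ring
    have h5 : 2 * b i / ε = 2 * (b i / ε) := by ring
    rw [h5]; rw [h4] at h3 ⊢; linarith
  · intro x hx
    have hk : code x ∈ G.filter P := by
      refine Finset.mem_filter.2 ⟨Fintype.mem_piFinset.2 fun i => Finset.mem_Icc.2 ⟨?_, ?_⟩, x, hx, rfl⟩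
      · exact Int.floor_le_floor (div_le_div_of_nonneg_right (abs_le.1 (h x hx i)).1 hε.le)
      · exact Int.floor_le_floor (div_le_div_of_nonneg_right (abs_le.1 (h x hx i)).2 hε.le)
    have hs := (Finset.mem_filter.1 hk).2.choose_spec
    refine ⟨_, Finset.mem_image.2 ⟨⟨code x, hk⟩, Finset.mem_attach _ _, rfl⟩, hs.1, fun i => ?_⟩
    have e : ⌊Φ (Finset.mem_filter.1 hk).2.choose i / ε⌋ = ⌊Φ x i / ε⌋ := congrFun hs.2 i
    have := Int.abs_sub_lt_one_of_floor_eq_floor e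
    rw [← sub_div, abs_div, abs_of_pos hε, div_lt_one hε] at this
    rw [abs_sub_comm]; exact this.le

section
variable {m n : ℕ}

/-- neighborhoods of the identity -/
def NB (d : ℕ) (r : ℝ) : Set (SLR d) := {w | ∀ i j, |w.1 i j - (1 : Matrix (Fin d) (Fin d) ℝ) i j| ≤ r}

/-- block lower triangular matrices -/
def BLT (m n : ℕ) : Set (SLR (m + n)) := {p | ∀ i j, p.1 (Fin.castAdd n i) (Fin.natAdd m j) = 0}

lemma NB_mv {d : ℕ} {r : ℝ} {p : SLR d} (hp : p ∈ NB d r) (y : Fin d → ℝ) (i : Fin d) :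
    |(p.1 *ᵥ y) i - y i| ≤ d * (r * ‖y‖) := by
  have e : (p.1 *ᵥ y) i - y i = ∑ j, (p.1 i j - (1 : Matrix (Fin d) (Fin d) ℝ) i j) * y j := by
    have h1 : y i = ((1 : Matrix (Fin d) (Fin d) ℝ) *ᵥ y) i := by rw [Matrix.one_mulVec]
    conv_lhs => rw [h1]
    simp only [Matrix.mulVec, dotProduct, sub_mul, Finset.sum_sub_distrib]
  rw [e]
  refine (Finset.abs_sum_le_sum_abs _ _).trans ?_
  refine (Finset.sum_le_sum (g := fun _ => r * ‖y‖) fun j _ => ?_).trans (by simp)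
  rw [abs_mul]
  exact mul_le_mul (hp i j) (norm_le_pi_norm y j) (abs_nonneg _) ((abs_nonneg _).trans (hp i j))

lemma NB_up {d : ℕ} {r : ℝ} (hr : d * r ≤ 1 / 2) {p : SLR d} (hp : p ∈ NB d r) (y : Fin d → ℝ) :
    ‖p.1 *ᵥ y‖ ≤ 2 * ‖y‖ := by
  refine (pi_norm_le_iff_of_nonneg (by positivity)).2 fun i => ?_
  have h1 := NB_mv hp y i
  have h2 := norm_le_pi_norm y i
  rw [Real.norm_eq_abs] at h2 ⊢
  have h3 : |(p.1 *ᵥ y) i| ≤ |(p.1 *ᵥ y) i - y i| + |y i| := by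
    have := abs_add_le ((p.1 *ᵥ y) i - y i) (y i); rwa [sub_add_cancel] at this
  nlinarith [norm_nonneg y]

lemma NB_low {d : ℕ} {r : ℝ} (hr : d * r ≤ 1 / 2) {p : SLR d} (hp : p ∈ NB d r) (y : Fin d → ℝ) :
    ‖y‖ ≤ 2 * ‖p.1 *ᵥ y‖ := by
  have : ‖y‖ ≤ ‖p.1 *ᵥ y‖ + 1 / 2 * ‖y‖ := by
    refine (pi_norm_le_iff_of_nonneg (by positivity)).2 fun i => ?_
    have h1 := NB_mv hp y i
    have h2 := norm_le_pi_norm (p.1 *ᵥ y) i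
    rw [Real.norm_eq_abs] at h2 ⊢
    have h3 : |y i| ≤ |(p.1 *ᵥ y) i - y i| + |(p.1 *ᵥ y) i| := by
      have := abs_sub ((p.1 *ᵥ y) i) ((p.1 *ᵥ y) i - y i)
      rw [_root_.sub_sub_cancel] at this; linarith
    nlinarith [norm_nonneg y]
  linarith

lemma LT_low {r : ℝ} (hr0 : 0 ≤ r) (hr : (m + n : ℕ) * r ≤ 1 / 2) {p : SLR (m + n)} (hp : p ∈ NB (m + n) r) (hl : p ∈ BLT m n)
    (y : Fin (m + n) → ℝ) (a : ℝ) (ha : 0 ≤ a) (h : ∀ i : Fin m, |(p.1 *ᵥ y) (Fin.castAdd n i)| ≤ a) (i : Fin m) :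
    |y (Fin.castAdd n i)| ≤ 2 * a := by
  set y' : Fin (m + n) → ℝ := Fin.append (fun i => y (Fin.castAdd n i)) 0 with hy'
  have e1 : ∀ i : Fin m, y' (Fin.castAdd n i) = y (Fin.castAdd n i) := fun i => by rw [hy', Fin.append_left]
  have e2 : ∀ j : Fin n, y' (Fin.natAdd m j) = 0 := fun j => by rw [hy', Fin.append_right]; rfl
  have e3 : ∀ i : Fin m, (p.1 *ᵥ y') (Fin.castAdd n i) = (p.1 *ᵥ y) (Fin.castAdd n i) := by
    intro i
    simp only [Matrix.mulVec, dotProduct, sum_split]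
    congr 1
    · exact Finset.sum_congr rfl fun k _ => by rw [e1]
    · exact Finset.sum_congr rfl fun k _ => by rw [hl i k]; simp
  have h4 : ‖y'‖ ≤ a + 1 / 2 * ‖y'‖ := by
    refine (pi_norm_le_iff_of_nonneg (by positivity)).2 fun i => ?_
    rw [Real.norm_eq_abs]
    refine Fin.addCases (fun i => ?_) (fun j => ?_) i
    · have h1 := NB_mv hp y' (Fin.castAdd n i)
      have h3 : |y' (Fin.castAdd n i)| ≤ |(p.1 *ᵥ y') (Fin.castAdd n i) - y' (Fin.castAdd n i)| + |(p.1 *ᵥ y') (Fin.castAdd n i)| := by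
        have := abs_sub ((p.1 *ᵥ y') (Fin.castAdd n i)) ((p.1 *ᵥ y') (Fin.castAdd n i) - y' (Fin.castAdd n i))
        rw [_root_.sub_sub_cancel] at this; linarith
      have h5 := h i
      rw [← e3] at h5
      nlinarith [norm_nonneg y']
    · rw [e2, abs_zero]; positivity
  have := norm_le_pi_norm y' (Fin.castAdd n i)
  rw [Real.norm_eq_abs, e1] at this
  linarith

end
end

noncomputable section

section
variable {m n : ℕ}

lemma vec_cover (hm : 0 < m) (hn : 0 < n) (C c : ℝ) (hC : 0 < C) (hc : 0 < c) : ∃ K0 : ℝ, 1 ≤ K0 ∧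
    ∀ L : ℝ, 0 ≤ L → ∀ w : Fin (m + n) → ℝ, c ≤ ‖(fun j : Fin n => w (Fin.natAdd m j))‖ →
    ∃ Θ : Finset (Fin m → Fin n → ℝ), (Θ.card : ℝ) ≤ K0 * Real.exp ((m + n - 1) * L) ∧
      ∀ D : Fin m → Fin n → ℝ, ‖D‖ ≤ 1 →
        (∀ i, |(uMat m n D *ᵥ w) (Fin.castAdd n i)| ≤ C * Real.exp (-(L / m))) →
        ∃ D0 ∈ Θ, ‖D - D0‖ ≤ Real.exp (-(kap m n * L)) := by
  classical
  have hk := kap_pos hm hn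
  have hm0 : (0:ℝ) < m := by exact_mod_cast hm
  have hn0 : (0:ℝ) < n := by exact_mod_cast hn
  set q : ℝ := 1 / c + n + 1 with hq
  have hq0 : 0 < q := by positivity
  have hq1 : 1 ≤ q := by
    have : 0 < 1 / c := by positivity
    linarith
  set K1 : ℝ := 2 * (1 + C) * q + 2 with hK1
  have hK1' : 1 ≤ K1 := by rw [hK1]; nlinarith
  refine ⟨K1 ^ (m * n), one_le_pow₀ hK1', ?_⟩
  intro L hL w hw
  set w2 : Fin n → ℝ := fun j => w (Fin.natAdd m j) with hw2
  obtain ⟨j0, hj0⟩ := norm_attained ⟨0, hn⟩ w2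
  have hwj : ∀ j, |w2 j| ≤ |w2 j0| := fun j => by rw [hj0]; exact norm_le_pi_norm w2 j
  have hw0 : c ≤ |w2 j0| := by rw [hj0]; exact hw
  set ε := Real.exp (-(kap m n * L)) / q with hε
  have hε0 : 0 < ε := by positivity
  let Φ : (Fin m → Fin n → ℝ) → Fin m × Fin n → ℝ := fun D p =>
    if p.2 = j0 then (uMat m n D *ᵥ w) (Fin.castAdd n p.1) else D p.1 p.2
  let b : Fin m × Fin n → ℝ := fun p => if p.2 = j0 then C * Real.exp (-(L / m)) else 1
  obtain ⟨Θ, hΘ, hcov⟩ := grid {D : Fin m → Fin n → ℝ | ‖D‖ ≤ 1 ∧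
    (∀ i, |(uMat m n D *ᵥ w) (Fin.castAdd n i)| ≤ C * Real.exp (-(L / m)))} Φ b (by
      intro p; simp only [b]; split_ifs <;> positivity) ε hε0 (by
      rintro D ⟨hD, h⟩ p
      simp only [Φ, b]
      split_ifs
      · exact h _
      · exact (norm_le_pi_norm (D p.1) p.2).trans ((norm_le_pi_norm D p.1).trans hD))
  refine ⟨Θ, hΘ.trans ?_, ?_⟩
  · let θ : Fin m × Fin n → ℝ := fun p => if p.2 = j0 then 1 / n else kap m n
    have hfac : ∀ p, 2 * b p / ε + 2 ≤ K1 * Real.exp (θ p * L) := by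
      intro p
      have hinv : 1 / ε = q * Real.exp (kap m n * L) := by
        rw [hε, one_div, inv_div, Real.exp_neg, div_inv_eq_mul]
      have hb : b p / ε ≤ (1 + C) * q * Real.exp (θ p * L) := by
        simp only [b, θ]
        split_ifs
        · have e : C * Real.exp (-(L / m)) / ε = C * q * Real.exp (1 / n * L) := by
            rw [div_eq_mul_one_div, hinv, show (1 / n * L : ℝ) = -(L / m) + kap m n * L by unfold kap; ring, Real.exp_add]
            ring
          rw [e]
          gcongr
          linarith
        · rw [hinv]
          have : 0 ≤ C * (q * Real.exp (kap m n * L)) := by positivity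
          linarith
      have hθ : 1 ≤ Real.exp (θ p * L) := by
        apply Real.one_le_exp
        simp only [θ]
        split_ifs <;> positivity
      rw [hK1, mul_div_assoc]
      nlinarith
    have hb0 : ∀ p, 0 ≤ 2 * b p / ε + 2 := by
      intro p
      have : 0 ≤ b p := by simp only [b]; split_ifs <;> positivity
      positivity
    refine (Finset.prod_le_prod (fun p _ => hb0 p) fun p _ => hfac p).trans ?_
    rw [Finset.prod_mul_distrib, ← Real.exp_sum]
    simp only [Finset.prod_const, Finset.card_univ, Fintype.card_prod, Fintype.card_fin]
    refine mul_le_mul_of_nonneg_left (Real.exp_le_exp.2 (le_of_eq ?_)) (by positivity)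
    rw [← Finset.sum_mul]
    congr 1
    rw [Fintype.sum_prod_type]
    simp only [θ]
    have e1 : ∀ x : Fin m, ∑ y : Fin n, (if y = j0 then (1 / n : ℝ) else kap m n) = 1 / n + (n - 1) * kap m n := by
      intro _
      rw [← Finset.add_sum_erase _ _ (Finset.mem_univ j0)]
      rw [if_pos rfl, Finset.sum_congr rfl (fun y hy => if_neg (Finset.ne_of_mem_erase hy))]
      rw [Finset.sum_const, Finset.card_erase_of_mem (Finset.mem_univ _)]
      simp only [Finset.card_univ, Fintype.card_fin, nsmul_eq_mul]
      rw [Nat.cast_sub hn]; push_cast; ring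
    rw [Finset.sum_congr rfl fun x _ => e1 x]
    simp only [Finset.sum_const, Finset.card_univ, Fintype.card_fin, nsmul_eq_mul]
    unfold kap
    field_simp
    ring
  · intro D hD h
    obtain ⟨D0, hD0, -, hcl⟩ := hcov D ⟨hD, h⟩
    refine ⟨D0, hD0, ?_⟩
    have hne : ∀ i j, j ≠ j0 → |D i j - D0 i j| ≤ ε := by
      intro i j hj
      have := hcl (i, j)
      simpa [Φ, hj] using this
    have h0 : ∀ i, |D i j0 - D0 i j0| ≤ ε * (1 / c + n) := by
      intro i
      have h1 := hcl (i, j0)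
      simp only [Φ, if_true] at h1
      rw [uMat_mv1, uMat_mv1, add_sub_add_left_eq_sub, ← Finset.sum_sub_distrib,
        ← Finset.add_sum_erase _ _ (Finset.mem_univ j0)] at h1
      set T := ∑ x ∈ Finset.univ.erase j0, (D i x * w (Fin.natAdd m x) - D0 i x * w (Fin.natAdd m x)) with hT
      have h2 : |T| ≤ n * (ε * |w2 j0|) := by
        refine (Finset.abs_sum_le_sum_abs _ _).trans ?_
        refine (Finset.sum_le_sum (g := fun _ => ε * |w2 j0|) fun l hl => ?_).trans ?_
        · rw [← sub_mul, abs_mul]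
          exact mul_le_mul (hne i l (Finset.ne_of_mem_erase hl)) (hwj l) (abs_nonneg _) hε0.le
        · rw [Finset.sum_const, nsmul_eq_mul]
          refine mul_le_mul_of_nonneg_right ?_ (by positivity)
          exact_mod_cast (Finset.card_erase_le.trans (by simp))
      have h3 : |D i j0 - D0 i j0| * |w2 j0| ≤ ε + n * (ε * |w2 j0|) := by
        rw [← abs_mul]
        have e : (D i j0 - D0 i j0) * w2 j0 = (D i j0 * w (Fin.natAdd m j0) - D0 i j0 * w (Fin.natAdd m j0) + T) - T := by
          rw [hw2]; ring
        rw [e]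
        exact (abs_sub _ _).trans (add_le_add h1 h2)
      have hw0' : 0 < |w2 j0| := hc.trans_le hw0
      have h4 : ε ≤ ε * (1 / c) * |w2 j0| := by
        rw [mul_assoc]
        have : 1 ≤ 1 / c * |w2 j0| := by rw [one_div, inv_mul_eq_div, one_le_div hc]; exact hw0
        nlinarith
      have h5 : |D i j0 - D0 i j0| * |w2 j0| ≤ (ε * (1 / c + n)) * |w2 j0| := by nlinarith
      exact le_of_mul_le_mul_right h5 hw0'
    have hεq : ε * q = Real.exp (-(kap m n * L)) := by rw [hε]; field_simp
    refine (pi_norm_le_iff_of_nonneg (Real.exp_pos _).le).2 fun i => (pi_norm_le_iff_of_nonneg (Real.exp_pos _).le).2 fun j => ?_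
    rw [Real.norm_eq_abs, ← hεq]
    by_cases hj : j = j0
    · subst hj
      refine (h0 i).trans ?_
      rw [hq]; nlinarith
    · refine (hne i j hj).trans ?_
      nlinarith

lemma refine_step (hm : 0 < m) (hn : 0 < n) (R C : ℝ) (hC : 0 < C) : ∃ K1 : ℝ, 1 ≤ K1 ∧ ∀ᶠ L : ℕ in atTop,
    ∀ h : SLR (m + n), ∃ Θ : Finset (Fin m → Fin n → ℝ), (Θ.card : ℝ) ≤ K1 * Real.exp ((m + n - 1) * L) ∧
      ∀ D : Fin m → Fin n → ℝ, ‖D‖ ≤ 1 → ∀ p ∈ NB (m + n) (1 / (2 * (m + n : ℕ))), p ∈ BLT m n →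
        qm (p * uSL m n D * h) ∈ EE m n hm hn R C L → ∃ D0 ∈ Θ, ‖D - D0‖ ≤ Real.exp (-(kap m n * L)) := by
  classical
  have hm0 : (0:ℝ) < m := by exact_mod_cast hm
  have hn0 : (0:ℝ) < n := by exact_mod_cast hn
  set r : ℝ := 1 / (2 * (m + n : ℕ)) with hr
  have hr0 : 0 ≤ r := by positivity
  have hdr : ((m + n : ℕ) : ℝ) * r ≤ 1 / 2 := by
    rw [hr]
    have : (0:ℝ) < (m + n : ℕ) := by exact_mod_cast (by omega : 0 < m + n)
    field_simp; exact le_rfl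
  obtain ⟨δ0, hδ0, hgood⟩ := bdd_good (m + n) R
  set c := δ0 / 2 with hcdef
  have hc : 0 < c := by positivity
  set C3 := (1 + n * 1) * (2 * C) with hC3
  obtain ⟨N0, hN0, hcount⟩ := count_good (d := m + n) (δ := δ0 / (4 * (1 + n * 1))) (by positivity) C3 (by positivity)
  obtain ⟨K0, hK0, hvec⟩ := vec_cover hm hn (2 * C) c (by positivity) hc
  refine ⟨max 1 (N0 * K0), le_max_left _ _, ?_⟩
  have hL : ∀ᶠ L : ℝ in atTop, 2 * C * Real.exp (-(L / m)) < c := by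
    have := (eta_tendsto hm).const_mul (2 * C)
    rw [mul_zero] at this
    exact this.eventually_lt_const hc
  filter_upwards [tendsto_natCast_atTop_atTop.eventually hL] with L hL h
  -- analysis of a single point
  have key : ∀ D : Fin m → Fin n → ℝ, ‖D‖ ≤ 1 → ∀ p ∈ NB (m + n) r, p ∈ BLT m n →
        qm (p * uSL m n D * h) ∈ EE m n hm hn R C L → Good (δ0 / (4 * (1 + n * 1))) h ∧
        ∃ z, ‖lv h z‖ ≤ C3 ∧ c ≤ ‖(fun j : Fin n => lv h z (Fin.natAdd m j))‖ ∧
          ∀ i, |(uMat m n D *ᵥ lv h z) (Fin.castAdd n i)| ≤ 2 * C * Real.exp (-((L:ℝ) / m)) := by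
    rintro D hD p hp hpl ⟨g, ⟨hg, z, hz, hz1, hz2⟩, hge⟩
    have hDb : ∀ i j, |D i j| ≤ 1 := fun i j => (norm_le_pi_norm (D i) j).trans ((norm_le_pi_norm D i).trans hD)
    have hgd : Good δ0 (p * uSL m n D * h) := by
      intro z hz
      obtain ⟨z', hz', e⟩ := lv_of_qm_eq hge hz
      rw [← e]
      exact hgood g hg z' hz'
    have hgu : Good c (uSL m n D * h) := by
      intro z hz
      have h1 := hgd z hz
      rw [mul_assoc, lv_mul] at h1
      have h2 := NB_up hdr hp (lv (uSL m n D * h) z)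
      rw [hcdef]; linarith
    refine ⟨?_, ?_⟩
    · intro z hz
      have h1 := hgu z hz
      rw [lv_mul] at h1
      have h2 := u_norm D 1 zero_le_one hDb (lv h z)
      rw [div_le_iff₀ (by positivity)]
      change c ≤ ‖uMat m n D *ᵥ lv h z‖ at h1
      rw [hcdef] at h1
      have h3 := norm_nonneg (lv h z)
      nlinarith
    · obtain ⟨z', hz', e⟩ := lv_of_qm_eq hge.symm hz
      have hv : p.1 *ᵥ (uMat m n D *ᵥ lv h z') = lv g z := by
        rw [← e, mul_assoc, lv_mul, lv_mul]; rfl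
      have h1 : ‖uMat m n D *ᵥ lv h z'‖ ≤ 2 * C := by
        have := NB_low hdr hp (uMat m n D *ᵥ lv h z')
        rw [hv] at this; linarith
      have hfirst : ∀ i, |(uMat m n D *ᵥ lv h z') (Fin.castAdd n i)| ≤ 2 * C * Real.exp (-((L:ℝ) / m)) := by
        intro i
        rw [mul_assoc]
        refine LT_low hr0 hdr hp hpl _ _ (by positivity) (fun i => ?_) i
        rw [hv]
        have h5 := (norm_le_pi_norm (lv (aSL m n hm hn L * g) z) (Fin.castAdd n i)).trans hz2
        rw [Real.norm_eq_abs, lv_mul] at h5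
        change |(aMat m n L *ᵥ lv g z) _| ≤ C at h5
        rw [aMat_mv1, abs_mul, abs_of_pos (Real.exp_pos _)] at h5
        rw [Real.exp_neg, ← div_eq_mul_inv, le_div_iff₀ (Real.exp_pos _), mul_comm]
        exact h5
      refine ⟨z', ?_, ?_, hfirst⟩
      · have hinv : lv h z' = uMat m n (fun i j => - D i j) *ᵥ (uMat m n D *ᵥ lv h z') := by
          have h2 : (uSL m n (fun i j => - D i j) * uSL m n D) = 1 := by
            rw [← uSL_add, show ((fun i j => - D i j) + D) = (0 : Fin m → Fin n → ℝ) from by funext i j; simp]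
            exact uSL_zero
          have h3 := SL_mul_mv (uSL m n (fun i j => - D i j)) (uSL m n D) (lv h z')
          rw [h2, SL_one_mv] at h3
          exact h3
        rw [hinv]
        refine (u_norm _ 1 zero_le_one (fun i j => by rw [abs_neg]; exact hDb i j) _).trans ?_
        rw [hC3]
        gcongr
      · have h2 := hgu z' hz'
        rw [lv_mul] at h2
        change c ≤ ‖uMat m n D *ᵥ lv h z'‖ at h2
        by_contra hlt
        rw [not_le] at hlt
        refine absurd h2 (not_le.2 ((pi_norm_lt_iff hc).2 fun i => ?_))
        rw [Real.norm_eq_abs]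
        refine Fin.addCases (fun i => ?_) (fun j => ?_) i
        · exact (hfirst i).trans_lt hL
        · rw [uMat_mv2]
          exact (norm_le_pi_norm (fun j : Fin n => lv h z' (Fin.natAdd m j)) j).trans_lt hlt
  by_cases hgh : Good (δ0 / (4 * (1 + n * 1))) h
  · obtain ⟨F, hF, hFc⟩ := hcount h hgh
    have hΘ : ∀ z, ∃ Θ : Finset (Fin m → Fin n → ℝ), (Θ.card : ℝ) ≤ K0 * Real.exp ((m + n - 1) * L) ∧
        (c ≤ ‖(fun j : Fin n => lv h z (Fin.natAdd m j))‖ → ∀ D : Fin m → Fin n → ℝ, ‖D‖ ≤ 1 →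
        (∀ i, |(uMat m n D *ᵥ lv h z) (Fin.castAdd n i)| ≤ 2 * C * Real.exp (-((L:ℝ) / m))) →
        ∃ D0 ∈ Θ, ‖D - D0‖ ≤ Real.exp (-(kap m n * L))) := by
      intro z
      by_cases hz : c ≤ ‖(fun j : Fin n => lv h z (Fin.natAdd m j))‖
      · obtain ⟨Θ, h1, h2⟩ := hvec L (Nat.cast_nonneg _) (lv h z) hz
        exact ⟨Θ, h1, fun _ => h2⟩
      · exact ⟨∅, by simp; positivity, fun h => absurd h hz⟩
    choose Θ hΘ1 hΘ2 using hΘ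
    refine ⟨F.biUnion Θ, ?_, ?_⟩
    · have h1 : ((F.biUnion Θ).card : ℝ) ≤ ∑ z ∈ F, ((Θ z).card : ℝ) := by
        exact_mod_cast Finset.card_biUnion_le
      refine h1.trans ((Finset.sum_le_sum fun z _ => hΘ1 z).trans ?_)
      rw [Finset.sum_const, nsmul_eq_mul, ← mul_assoc]
      refine mul_le_mul_of_nonneg_right ?_ (Real.exp_pos _).le
      refine le_trans ?_ (le_max_right _ _)
      gcongr
    · intro D hD p hp hpl hE
      obtain ⟨-, z, hz1, hz2, hz3⟩ := key D hD p hp hpl hE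
      obtain ⟨D0, hD0, h⟩ := hΘ2 z hz2 D hD hz3
      exact ⟨D0, Finset.mem_biUnion.2 ⟨z, hF z hz1, hD0⟩, h⟩
  · refine ⟨∅, by simp; positivity, ?_⟩
    intro D hD p hp hpl hE
    exact absurd (key D hD p hp hpl hE).1 hgh

end
end

noncomputable section

section
variable {m n : ℕ}

lemma NB_mem {d : ℕ} {r : ℝ} (hr : 0 < r) : NB d r ∈ 𝓝 (1 : SLR d) := by
  have h : ∀ i j : Fin d, ∀ᶠ w in 𝓝 (1 : SLR d), |w.1 i j - (1 : Matrix (Fin d) (Fin d) ℝ) i j| ≤ r := by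
    intro i j
    have hc : Continuous fun w : SLR d => |w.1 i j - (1 : Matrix (Fin d) (Fin d) ℝ) i j| := by
      have h1 : Continuous fun g : SLR d => g.1 := (SL_closedEmb d).continuous
      exact ((h1.matrix_elem i j).sub continuous_const).abs
    have h2 := hc.tendsto 1
    have h3 : |(1 : SLR d).1 i j - (1 : Matrix (Fin d) (Fin d) ℝ) i j| < r := by
      simpa using hr
    exact (h2.eventually (gt_mem_nhds h3)).mono fun _ h => le_of_lt h
  have := (eventually_all.2 fun i => eventually_all.2 fun j => h i j)
  exact this

lemma NB_basis {d : ℕ} {U : Set (SLR d)} (hU : U ∈ 𝓝 (1 : SLR d)) : ∃ r : ℝ, 0 < r ∧ NB d r ⊆ U := by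
  rw [(SL_closedEmb d).isEmbedding.isInducing.nhds_eq_comap, mem_comap] at hU
  obtain ⟨V, hV, hVU⟩ := hU
  let V' : Set (Fin d → Fin d → ℝ) := V
  have hV' : V' ∈ 𝓝 (fun i j => (1 : Matrix (Fin d) (Fin d) ℝ) i j) := hV
  obtain ⟨r, hr, hb⟩ := Metric.nhds_basis_closedBall.mem_iff.1 hV'
  refine ⟨r, hr, fun w hw => hVU ?_⟩
  have : (fun i j => w.1 i j) ∈ V' := hb (by
    rw [Metric.mem_closedBall, dist_pi_le_iff hr.le]
    intro i
    rw [dist_pi_le_iff hr.le]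
    intro j
    rw [Real.dist_eq]; exact hw i j)
  exact this

lemma V_nbhd {d : ℕ} (Z : Set (XSp d)) (hZ : IsCompact Z) (V : Set (XSp d × XSp d)) (hV : IsOpen V)
    (hd : ∀ x, (x, x) ∈ V) : ∃ r : ℝ, 0 < r ∧ ∀ w ∈ NB d r, ∀ x ∈ Z, (x, w • x) ∈ V := by
  have hc : Continuous fun q : SLR d × XSp d => (q.2, q.1 • q.2) := by fun_prop
  have hO : IsOpen ((fun q : SLR d × XSp d => (q.2, q.1 • q.2)) ⁻¹' V) := hV.preimage hc
  have hsub : ({(1 : SLR d)} : Set (SLR d)) ×ˢ Z ⊆ ((fun q : SLR d × XSp d => (q.2, q.1 • q.2)) ⁻¹' V) := by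
    rintro ⟨w, x⟩ ⟨hw, hx⟩
    rw [Set.mem_singleton_iff] at hw
    subst hw
    simpa using hd x
  obtain ⟨u, v, hu, hv, h1u, hZv, huv⟩ := generalized_tube_lemma isCompact_singleton hZ hO hsub
  obtain ⟨r, hr, hru⟩ := NB_basis (hu.mem_nhds (h1u rfl))
  exact ⟨r, hr, fun w hw x hx => huv (Set.mk_mem_prod (hru hw) (hZv hx))⟩

lemma NB_mono {d : ℕ} {r s : ℝ} (h : r ≤ s) : NB d r ⊆ NB d s := fun w hw i j => (hw i j).trans h

lemma close_cont {ρ : ℝ} (hρ : 0 < ρ) : ∃ r : ℝ, 0 < r ∧ ∀ p ∈ NB (m + n) r, ∀ p' ∈ NB (m + n) r,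
    ∀ D : Fin m → Fin n → ℝ, ‖D‖ ≤ r → p' * uSL m n D * p⁻¹ ∈ NB (m + n) ρ := by
  have hu : Continuous (fun C : Fin m → Fin n → ℝ => uSL m n C) := uSL_cont
  have hc : Continuous fun q : (SLR (m + n) × SLR (m + n)) × (Fin m → Fin n → ℝ) =>
      q.1.2 * uSL m n q.2 * q.1.1⁻¹ :=
    ((continuous_fst.snd).mul (hu.comp continuous_snd)).mul (continuous_fst.fst).inv
  have h1 := hc.tendsto ((1, 1), 0)
  simp only [uSL_zero, mul_one, inv_one] at h1
  have h2 := h1 (NB_mem (d := m + n) hρ)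
  rw [mem_map, mem_nhds_prod_iff] at h2
  obtain ⟨U, hU, W, hW, hUW⟩ := h2
  rw [mem_nhds_prod_iff] at hU
  obtain ⟨U1, hU1, U2, hU2, hU12⟩ := hU
  obtain ⟨r1, hr1, h1⟩ := NB_basis hU1
  obtain ⟨r2, hr2, h2⟩ := NB_basis hU2
  obtain ⟨r3, hr3, h3⟩ := Metric.nhds_basis_closedBall.mem_iff.1 hW
  refine ⟨min r1 (min r2 r3), by positivity, fun p hp p' hp' D hD => ?_⟩
  have := hUW (Set.mk_mem_prod (hU12 (Set.mk_mem_prod (h1 (NB_mono (min_le_left _ _) hp))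
    (h2 (NB_mono ((min_le_right _ _).trans (min_le_left _ _)) hp'))))
    (h3 (by simpa using hD.trans ((min_le_right _ _).trans (min_le_right _ _))) : D ∈ W))
  exact this

lemma conj_NB (hm : 0 < m) (hn : 0 < n) {r L t : ℝ} (hr : 0 ≤ r) (hL : 0 ≤ L) (ht : -L ≤ t) {p : SLR (m + n)}
    (hp : p ∈ NB (m + n) r) (hb : p ∈ BLT m n) :
    aSL m n hm hn t * p * aSL m n hm hn (-t) ∈ NB (m + n) (Real.exp (kap m n * L) * r) ∧
    aSL m n hm hn t * p * aSL m n hm hn (-t) ∈ BLT m n := by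
  obtain ⟨h1, h2, h3, h4⟩ := conj_entry hm hn t p
  have hk := kap_pos hm hn
  have hle : r ≤ Real.exp (kap m n * L) * r :=
    le_mul_of_one_le_left hr (Real.one_le_exp (by positivity))
  constructor
  · intro i j
    refine Fin.addCases (fun i => ?_) (fun i => ?_) i <;> refine Fin.addCases (fun j => ?_) (fun j => ?_) j
    · rw [h1]; exact (hp _ _).trans hle
    · rw [h2, hb, mul_zero, Matrix.one_apply_ne (by simp [Fin.ext_iff]; omega)]
      simp; positivity
    · rw [h3, Matrix.one_apply_ne (by simp [Fin.ext_iff]; omega), sub_zero, abs_mul, Real.abs_exp]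
      have := hp (Fin.natAdd m i) (Fin.castAdd n j)
      rw [Matrix.one_apply_ne (by simp [Fin.ext_iff]; omega), sub_zero] at this
      refine mul_le_mul (Real.exp_le_exp.2 ?_) this (abs_nonneg _) (Real.exp_pos _).le
      nlinarith
    · rw [h4]; exact (hp _ _).trans hle
  · intro i j
    rw [h2, hb, mul_zero]

end
end

noncomputable section

section
variable {m n : ℕ}

lemma decomp {r : ℝ} (hr : 0 < r) : ∀ᶠ g in 𝓝 (1 : SLR (m + n)), ∃ p ∈ NB (m + n) r, p ∈ BLT m n ∧
    ∃ C : Fin m → Fin n → ℝ, ‖C‖ ≤ r ∧ g = p * uSL m n C := by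
  let g11 : SLR (m + n) → Matrix (Fin m) (Fin m) ℝ := fun g => g.1.submatrix (Fin.castAdd n) (Fin.castAdd n)
  let g12 : SLR (m + n) → Matrix (Fin m) (Fin n) ℝ := fun g => g.1.submatrix (Fin.castAdd n) (Fin.natAdd m)
  let C : SLR (m + n) → Fin m → Fin n → ℝ := fun g i j => (g11 g).det⁻¹ * ((g11 g).adjugate * g12 g) i j
  have hval : Continuous fun g : SLR (m + n) => g.1 := (SL_closedEmb (m + n)).continuous
  have hc11 : Continuous g11 := hval.matrix_submatrix _ _
  have hc12 : Continuous g12 := hval.matrix_submatrix _ _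
  have h11 : g11 1 = 1 := by
    ext i j; simp [g11, Matrix.one_apply, Fin.ext_iff]
  have h12 : g12 1 = 0 := by
    ext i j
    show (1 : Matrix (Fin (m+n)) (Fin (m+n)) ℝ) (Fin.castAdd n i) (Fin.natAdd m j) = 0
    rw [Matrix.one_apply_ne (by simp [Fin.ext_iff]; omega)]
  have hdet : Continuous fun g => (g11 g).det := hc11.matrix_det
  have hC1 : C 1 = 0 := by
    funext i j; simp [C, h12]
  have hCc : ContinuousAt C 1 := by
    refine continuousAt_pi.2 fun i => continuousAt_pi.2 fun j => ?_
    refine ContinuousAt.mul (hdet.continuousAt.inv₀ (by simp [h11])) ?_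
    exact ((hc11.matrix_adjugate.matrix_mul hc12).matrix_elem i j).continuousAt
  have hu : Continuous (fun C : Fin m → Fin n → ℝ => uSL m n C) := uSL_cont
  have hpc : Tendsto (fun g => g * uSL m n (-(C g))) (𝓝 1) (𝓝 1) := by
    have h : ContinuousAt (fun g => g * uSL m n (-(C g))) 1 :=
      continuousAt_id.mul (hu.continuousAt.comp hCc.neg)
    have h2 := h.tendsto
    simpa [hC1, uSL_zero] using h2
  have e1 := hpc.eventually (NB_mem (d := m + n) hr)
  have e2 : ∀ᶠ g in 𝓝 (1 : SLR (m + n)), ‖C g‖ ≤ r := by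
    have := hCc.norm.tendsto
    rw [hC1, norm_zero] at this
    exact (this.eventually (gt_mem_nhds hr)).mono fun _ h => le_of_lt h
  have e3 : ∀ᶠ g in 𝓝 (1 : SLR (m + n)), (g11 g).det ≠ 0 :=
    hdet.continuousAt.eventually_ne (by simp [h11])
  filter_upwards [e1, e2, e3] with g h1 h2 h3
  refine ⟨_, h1, ?_, C g, h2, ?_⟩
  · intro i j
    have e : (g * uSL m n (-(C g))).1 (Fin.castAdd n i) (Fin.natAdd m j)
      = - (∑ k, g11 g i k * C g k j) + g12 g i j := by
      show (g.1 * uMat m n (-(C g))) _ _ = _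
      rw [Matrix.mul_apply, sum_split]
      simp only [uMat_12, uMat_22]
      simp [g11, g12, Matrix.one_apply]
    rw [e]
    have e' : ∑ k, g11 g i k * C g k j = (g11 g).det⁻¹ * (g11 g * ((g11 g).adjugate * g12 g)) i j := by
      rw [Matrix.mul_apply, Finset.mul_sum]
      exact Finset.sum_congr rfl fun k _ => by simp only [C]; ring
    rw [e', ← Matrix.mul_assoc, Matrix.mul_adjugate, Matrix.smul_mul, Matrix.one_mul, Matrix.smul_apply, smul_eq_mul, ← mul_assoc,
      inv_mul_cancel₀ h3]
    ring
  · rw [mul_assoc, ← uSL_add, neg_add_cancel, uSL_zero, mul_one]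

lemma initial {r : ℝ} (hr : 0 < r) (Q : Set (XSp (m + n))) (hQ : IsCompact Q) : ∃ S : Finset (SLR (m + n)),
    ∀ x ∈ Q, ∃ g0 ∈ S, ∃ p ∈ NB (m + n) r, p ∈ BLT m n ∧ ∃ C : Fin m → Fin n → ℝ, ‖C‖ ≤ r ∧
      x = qm (p * uSL m n C * g0) := by
  classical
  have h := decomp (m := m) (n := n) hr
  obtain ⟨U, hUs, hU, h1⟩ := eventually_nhds_iff.1 h
  have hO : ∀ g0 : SLR (m + n), IsOpen (qm '' ((fun g => g * g0) '' U)) := fun g0 =>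
    qm_open _ _ ((Homeomorph.mulRight g0).isOpenMap _ hU)
  obtain ⟨S, hS⟩ := hQ.elim_finite_subcover _ hO (by
    intro x hx
    obtain ⟨g, rfl⟩ := qm_surj x
    exact Set.mem_iUnion.2 ⟨g, ⟨g, ⟨1, h1, one_mul g⟩, rfl⟩⟩)
  refine ⟨S, fun x hx => ?_⟩
  obtain ⟨g0, hg0, hx'⟩ := Set.mem_iUnion₂.1 (hS hx)
  obtain ⟨_, ⟨g, hg, rfl⟩, rfl⟩ := hx'
  obtain ⟨p, hp, hpb, C, hC, rfl⟩ := hUs g hg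
  exact ⟨g0, hg0, p, hp, hpb, C, hC, rfl⟩

lemma act_puc (hm : 0 < m) (hn : 0 < n) (t : ℝ) (p g : SLR (m + n)) (C : Fin m → Fin n → ℝ) :
    aSL m n hm hn t • qm (p * uSL m n C * g) =
      qm ((aSL m n hm hn t * p * aSL m n hm hn (-t)) * uSL m n (Real.exp (kap m n * t) • C) * (aSL m n hm hn t * g)) := by
  rw [smul_qm]
  congr 1
  have e := aSL_uSL hm hn t C
  have e2 : (fun i j => Real.exp (kap m n * t) * C i j) = Real.exp (kap m n * t) • C := rfl
  rw [e2] at e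
  rw [aSL_neg]
  calc aSL m n hm hn t * (p * uSL m n C * g) = aSL m n hm hn t * p * (aSL m n hm hn t)⁻¹ * (aSL m n hm hn t * uSL m n C) * g := by group
    _ = _ := by rw [e]; group

lemma tree_cover (hm : 0 < m) (hn : 0 < n) (R C0 A : ℝ) (L : ℕ) (hA : 0 ≤ A)
    (hstep : ∀ h : SLR (m + n), ∃ Θ : Finset (Fin m → Fin n → ℝ), (Θ.card : ℝ) ≤ A ∧
      ∀ D, ‖D‖ ≤ 1 → ∀ p ∈ NB (m + n) (1 / (2 * (m + n : ℕ))), p ∈ BLT m n →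
        qm (p * uSL m n D * h) ∈ EE m n hm hn R C0 L → ∃ D0 ∈ Θ, ‖D - D0‖ ≤ Real.exp (-(kap m n * L)))
    (g0 : SLR (m + n)) (N : ℕ) :
    ∃ Θ : Finset (Fin m → Fin n → ℝ), (Θ.card : ℝ) ≤ A ^ N ∧
      ∀ D, ‖D‖ ≤ 1 → ∀ p ∈ NB (m + n) (1 / (2 * (m + n : ℕ))), p ∈ BLT m n →
        (∀ i : ℕ, (aAct m n hm hn)^[i * L] (qm (p * uSL m n D * g0)) ∈ EE m n hm hn R C0 L) →
        ∃ D0 ∈ Θ, ‖D - D0‖ ≤ Real.exp (-(kap m n * (N * L))) := by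
  classical
  induction N with
  | zero => exact ⟨{0}, by simp, fun D hD p hp hb _ => ⟨0, by simp, by simpa using hD⟩⟩
  | succ N ih =>
    obtain ⟨Θ, hΘ, hcov⟩ := ih
    set t : ℝ := N * L with ht
    set e := Real.exp (kap m n * t) with he
    have he0 : 0 < e := Real.exp_pos _
    choose Ψ hΨ1 hΨ2 using fun D0 : Fin m → Fin n → ℝ => hstep (uSL m n (e • D0) * (aSL m n hm hn t * g0))
    refine ⟨Θ.biUnion fun D0 => (Ψ D0).image fun D1 => D0 + e⁻¹ • D1, ?_, ?_⟩
    · refine le_trans (Nat.cast_le.2 Finset.card_biUnion_le) ?_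
      push_cast
      refine le_trans (Finset.sum_le_sum (g := fun _ => A) fun D0 _ => le_trans (Nat.cast_le.2 Finset.card_image_le) (hΨ1 D0)) ?_
      rw [Finset.sum_const, nsmul_eq_mul, pow_succ]
      gcongr
    · intro D hD p hp hb hE
      obtain ⟨D0, hD0, hle⟩ := hcov D hD p hp hb hE
      have hE1 := hE N
      rw [aAct_iter] at hE1
      have ec : ((N * L : ℕ) : ℝ) = t := by push_cast; rfl
      rw [ec, act_puc] at hE1
      have t0 : 0 ≤ t := by positivity
      obtain ⟨hq, hqb⟩ := conj_NB hm hn (r := 1 / (2 * (m + n : ℕ))) (L := 0) (t := t) (by positivity) le_rfl (by simpa using t0) hp hb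
      rw [mul_zero, Real.exp_zero, one_mul] at hq
      have e1 : Real.exp (kap m n * t) • D = e • (D - D0) + e • D0 := by
        rw [smul_sub, sub_add_cancel]
      rw [e1, uSL_add] at hE1
      have hn1 : ‖e • (D - D0)‖ ≤ 1 := by
        rw [norm_smul, Real.norm_of_nonneg he0.le]
        calc e * ‖D - D0‖ ≤ e * Real.exp (-(kap m n * t)) := by gcongr
          _ = 1 := by rw [he, ← Real.exp_add]; simp
      obtain ⟨D1, hD1, hle1⟩ := hΨ2 D0 _ hn1 _ hq hqb (by rw [← mul_assoc] at hE1 ⊢; rw [mul_assoc, ← mul_assoc] ; simpa only [mul_assoc] using hE1)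
      refine ⟨_, Finset.mem_biUnion.2 ⟨D0, hD0, Finset.mem_image.2 ⟨D1, hD1, rfl⟩⟩, ?_⟩
      have e2 : D - (D0 + e⁻¹ • D1) = e⁻¹ • (e • (D - D0) - D1) := by
        rw [smul_sub, smul_smul, inv_mul_cancel₀ he0.ne', one_smul]; abel
      rw [e2, norm_smul, norm_inv, Real.norm_of_nonneg he0.le]
      calc e⁻¹ * ‖e • (D - D0) - D1‖ ≤ e⁻¹ * Real.exp (-(kap m n * L)) := by gcongr
        _ = _ := by
          rw [he, ← Real.exp_neg, ← Real.exp_add]; congr 1; push_cast; rw [ht]; ring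

end
end

noncomputable section

section
variable {m n : ℕ}

lemma cover (hm : 0 < m) (hn : 0 < n) (R C0 A : ℝ) (L : ℕ) (hL : 0 < L) (hA : 0 ≤ A)
    (hstep : ∀ h : SLR (m + n), ∃ Θ : Finset (Fin m → Fin n → ℝ), (Θ.card : ℝ) ≤ A ∧
      ∀ D, ‖D‖ ≤ 1 → ∀ p ∈ NB (m + n) (1 / (2 * (m + n : ℕ))), p ∈ BLT m n →
        qm (p * uSL m n D * h) ∈ EE m n hm hn R C0 L → ∃ D0 ∈ Θ, ‖D - D0‖ ≤ Real.exp (-(kap m n * L)))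
    (V : Set (XSp (m + n) × XSp (m + n))) (hV : IsOpen V) (hd : ∀ x, (x, x) ∈ V) :
    ∃ B : ℝ, ∀ N : ℕ, ∃ F : Finset (Set (XSp (m + n))), (F.card : ℝ) ≤ B * A ^ N ∧
      (YY m n hm hn R C0 L ⊆ ⋃ D ∈ F, D) ∧ ∀ D ∈ F, ∀ x ∈ D ∩ YY m n hm hn R C0 L,
        ∀ x' ∈ D ∩ YY m n hm hn R C0 L, ∀ t ≤ N * L,
        ((aAct m n hm hn)^[t] x, (aAct m n hm hn)^[t] x') ∈ V := by
  classical
  have hk := kap_pos hm hn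
  obtain ⟨ρ, hρ, hVρ⟩ := V_nbhd (qm '' BddSL (m + n) (Real.exp L * R))
    ((BddSL_compact _ _).image (qm_cont _)) V hV hd
  obtain ⟨r', hr', hclose⟩ := close_cont (m := m) (n := n) hρ
  set r : ℝ := min (r' * Real.exp (-(kap m n * L))) (min (1 / (2 * (m + n : ℕ))) 1) with hr
  have hmn : (0:ℝ) < (m + n : ℕ) := by exact_mod_cast (by omega)
  have hr0 : 0 < r := by positivity
  obtain ⟨S, hS⟩ := initial hr0 (EE m n hm hn R C0 L) (EE_compact hm hn R C0 L)
  obtain ⟨Nc, f, hf⟩ := cell (E := Fin m → Fin n → ℝ) 1 r' hr'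
  refine ⟨L * S.card * Nc, fun N => ?_⟩
  choose Θ hΘ1 hΘ2 using fun g0 => tree_cover hm hn R C0 A L hA hstep g0 N
  set e := Real.exp (kap m n * (N * L)) with he
  have he0 : 0 < e := Real.exp_pos _
  let G : ℕ × (Σ _ : SLR (m + n), Fin m → Fin n → ℝ) × Fin Nc → Set (XSp (m + n)) := fun q =>
    {x | ∃ p ∈ NB (m + n) r, p ∈ BLT m n ∧ ∃ D : Fin m → Fin n → ℝ, ‖e • (D - q.2.1.2)‖ ≤ 1 ∧
      f (e • (D - q.2.1.2)) = q.2.2 ∧ (aAct m n hm hn)^[q.1] x = qm (p * uSL m n D * q.2.1.1)}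
  refine ⟨((Finset.range L) ×ˢ ((S.sigma Θ) ×ˢ Finset.univ)).image G, ?_, ?_, ?_⟩
  · refine le_trans (Nat.cast_le.2 Finset.card_image_le) ?_
    rw [Finset.card_product, Finset.card_product, Finset.card_sigma, Finset.card_range, Finset.card_fin]
    push_cast
    have : (∑ g ∈ S, ((Θ g).card : ℝ)) ≤ S.card * A ^ N := by
      refine (Finset.sum_le_sum fun g _ => hΘ1 g).trans ?_
      rw [Finset.sum_const, nsmul_eq_mul]
    calc (L:ℝ) * ((∑ g ∈ S, ((Θ g).card : ℝ)) * Nc) ≤ L * ((S.card * A ^ N) * Nc) := by gcongr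
      _ = _ := by ring
  · intro x hx
    obtain ⟨s, hs, hx⟩ := hx
    have h0 := hx 0
    rw [zero_mul, zero_add] at h0
    obtain ⟨g0, hg0, p, hp, hpb, D, hD, hxe⟩ := hS _ h0
    obtain ⟨D0, hD0, hle⟩ := hΘ2 g0 D (hD.trans ((min_le_right _ _).trans (min_le_right _ _))) p
      (NB_mono ((min_le_right _ _).trans (min_le_left _ _)) hp) hpb (by
        intro i
        rw [← hxe, ← Function.iterate_add_apply]
        exact hx i)
    refine Set.mem_iUnion₂.2 ⟨G (s, ⟨g0, D0⟩, f (e • (D - D0))), Finset.mem_image.2 ⟨_, ?_, rfl⟩, ?_⟩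
    · simp [hs, hg0, hD0]
    · refine ⟨p, hp, hpb, D, ?_, rfl, hxe⟩
      rw [norm_smul, Real.norm_of_nonneg he0.le]
      calc e * ‖D - D0‖ ≤ e * Real.exp (-(kap m n * (N * L))) := by gcongr
        _ = 1 := by rw [he, ← Real.exp_add]; simp
  · intro D' hD' x hx x' hx' t ht
    obtain ⟨⟨s, ⟨g0, D0⟩, c⟩, hmem, rfl⟩ := Finset.mem_image.1 hD'
    obtain ⟨⟨p, hp, hpb, D, hD, hfD, hxe⟩, hxY⟩ := hx
    obtain ⟨⟨p', hp', hpb', E, hE, hfE, hxe'⟩, -⟩ := hx'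
    simp only at hD hfD hxe hE hfE hxe'
    have hs : s < L := by
      have := (Finset.mem_product.1 hmem).1
      simpa using this
    set τ : ℝ := (t:ℝ) - s with hτ
    have hτ1 : -(L:ℝ) ≤ τ := by
      have : (s:ℝ) ≤ L := by exact_mod_cast hs.le
      have : (0:ℝ) ≤ t := Nat.cast_nonneg _
      rw [hτ]; linarith
    have hτ2 : τ ≤ N * L := by
      have : (t:ℝ) ≤ N * L := by exact_mod_cast ht
      have : (0:ℝ) ≤ s := Nat.cast_nonneg _
      rw [hτ]; linarith
    have hT : ∀ y : XSp (m + n), (aAct m n hm hn)^[t] y = aSL m n hm hn τ • (aAct m n hm hn)^[s] y := by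
      intro y
      rw [aAct_iter, aAct_iter, smul_smul, ← aSL_add, hτ, sub_add_cancel]
    have hrr : Real.exp (kap m n * L) * r ≤ r' := by
      calc Real.exp (kap m n * L) * r ≤ Real.exp (kap m n * L) * (r' * Real.exp (-(kap m n * L))) := by
            gcongr; exact min_le_left _ _
        _ = r' * Real.exp (kap m n * L + -(kap m n * L)) := by rw [Real.exp_add]; ring
        _ = r' := by simp
    obtain ⟨hq, -⟩ := conj_NB hm hn hr0.le (Nat.cast_nonneg L) hτ1 hp hpb
    obtain ⟨hq', -⟩ := conj_NB hm hn hr0.le (Nat.cast_nonneg L) hτ1 hp' hpb'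
    have hnorm : ‖Real.exp (kap m n * τ) • (E - D)‖ ≤ r' := by
      have h1 := hf _ _ hE hD (hfE.trans hfD.symm)
      have e1 : e • (E - D0) - e • (D - D0) = e • (E - D) := by
        rw [← smul_sub]; congr 1; abel
      rw [e1, norm_smul, Real.norm_of_nonneg he0.le] at h1
      rw [norm_smul, Real.norm_of_nonneg (Real.exp_pos _).le]
      refine le_trans ?_ h1
      rw [he]
      gcongr
    have hw := hclose _ (NB_mono hrr hq) _ (NB_mono hrr hq') _ hnorm
    have hfin := hVρ _ hw _ (YY_bdd hm hn hL hxY t)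
    have e2 : (aAct m n hm hn)^[t] x' = (aSL m n hm hn τ * p' * aSL m n hm hn (-τ) *
        uSL m n (Real.exp (kap m n * τ) • (E - D)) * (aSL m n hm hn τ * p * aSL m n hm hn (-τ))⁻¹) •
        (aAct m n hm hn)^[t] x := by
      rw [hT, hT, hxe, hxe', act_puc, act_puc, smul_qm]
      congr 1
      have e3 : Real.exp (kap m n * τ) • E = Real.exp (kap m n * τ) • (E - D) + Real.exp (kap m n * τ) • D := by
        rw [smul_sub, sub_add_cancel]
      rw [e3, uSL_add]
      group
    rw [e2]
    exact hfin

end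
end

noncomputable section

section
variable {m n : ℕ}

lemma ks_le {α : Type*} [MeasurableSpace α] (T : α → α) (μ : Measure α) (b : ℝ) (hb : 0 ≤ b)
    (h : ∀ (k : ℕ) (P : Fin k → Set α), IsFinPart P → ⨅ N : ℕ, partEnt μ (joinPart T P (N + 1)) / (N + 1) ≤ b) :
    ksEntropy T μ ≤ b :=
  Real.iSup_le (fun k => Real.iSup_le (fun P => Real.iSup_le (fun hP => h k P hP) hb) hb) hb

lemma ks_ge {α : Type*} [MeasurableSpace α] (T : α → α) (μ : Measure α) (a b : ℝ) (hb : 0 ≤ b)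
    (h : ∀ (k : ℕ) (P : Fin k → Set α), IsFinPart P → ⨅ N : ℕ, partEnt μ (joinPart T P (N + 1)) / (N + 1) ≤ b)
    {k : ℕ} (P : Fin k → Set α) (hP : IsFinPart P)
    (ha : ∀ N : ℕ, a ≤ partEnt μ (joinPart T P (N + 1)) / (N + 1)) :
    a ≤ ksEntropy T μ := by
  unfold ksEntropy
  refine le_ciSup_of_le ⟨b, ?_⟩ k (le_ciSup_of_le ⟨b, ?_⟩ P (le_ciSup_of_le ⟨b, ?_⟩ hP (le_ciInf ha)))
  · rintro _ ⟨k, rfl⟩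
    exact Real.iSup_le (fun P => Real.iSup_le (fun hP => h k P hP) hb) hb
  · rintro _ ⟨P, rfl⟩
    exact Real.iSup_le (fun hP => h k P hP) hb
  · rintro _ ⟨hP, rfl⟩
    exact h k P hP

lemma off_diag {X : Type*} [MetricSpace X] (S : Set (X × X)) (hS : IsCompact S) (h : ∀ p ∈ S, p.1 ≠ p.2) :
    ∃ ε : ℝ, 0 < ε ∧ ∀ p ∈ S, ε ≤ dist p.1 p.2 := by
  rcases S.eq_empty_or_nonempty with rfl | hne
  · exact ⟨1, one_pos, by simp⟩
  · obtain ⟨q, hq, hmin⟩ := hS.exists_isMinOn hne (f := fun p : X × X => dist p.1 p.2) (by fun_prop)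
    exact ⟨dist q.1 q.2, dist_pos.2 (h q hq), fun p hp => hmin hp⟩

lemma one_measure (hm : 0 < m) (hn : 0 < n) (R C A : ℝ) (K L : ℕ) (hK : 0 < K) (hL : 0 < L) (hA : 1 ≤ A)
    (B : (ℕ → Fin K) → ℕ → Fin m → Fin n → ℝ) (z : (ℕ → Fin K) → XSp (m + n))
    (h1 : ∀ ω i, (aAct m n hm hn)^[i * L] (z ω) ∈ EE m n hm hn R C L)
    (h2 : ∀ ω i p j, |B ω i p j| ≤ 2 * (n + 1))
    (h3 : ∀ (ω ω' : ℕ → Fin K) (i0 : ℕ), (∀ i < i0, ω i = ω' i) → ∃ g : SLR (m + n),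
        (aAct m n hm hn)^[i0 * L] (z ω) = qm (uSL m n (B ω i0) * g) ∧
        (aAct m n hm hn)^[i0 * L] (z ω') = qm (uSL m n (B ω' i0) * g))
    (h4 : ∀ (ω ω' : ℕ → Fin K) (i0 i : ℕ), (∀ k < i0 + i, ω k = ω' k) → ω (i0 + i) ≠ ω' (i0 + i) →
        ∃ p j, 4 * ((n:ℝ) + 1) ≤ Real.exp (kap m n * (L * (i + 1))) * |B ω i0 p j - B ω' i0 p j|)
    (hstep : ∀ h : SLR (m + n), ∃ Θ : Finset (Fin m → Fin n → ℝ), (Θ.card : ℝ) ≤ A ∧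
      ∀ D, ‖D‖ ≤ 1 → ∀ p ∈ NB (m + n) (1 / (2 * (m + n : ℕ))), p ∈ BLT m n →
        qm (p * uSL m n D * h) ∈ EE m n hm hn R C L → ∃ D0 ∈ Θ, ‖D - D0‖ ≤ Real.exp (-(kap m n * L))) :
    ∃ μ : Measure (XSp (m + n)), IsProbabilityMeasure μ ∧ MeasurePreserving (aAct m n hm hn) μ μ ∧
      μ (YY m n hm hn R C L)ᶜ = 0 ∧ Real.log K / L ≤ ksEntropy (aAct m n hm hn) μ ∧
      ksEntropy (aAct m n hm hn) μ ≤ Real.log A / L := by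
  letI : MetricSpace (XSp (m + n)) := TopologicalSpace.metrizableSpaceMetric (XSp (m + n))
  have hYz : ∀ ω j, (aAct m n hm hn)^[j] (z ω) ∈ YY m n hm hn R C L :=
    fun ω j => orbit_YY hm hn R C L hL (z ω) (h1 ω) j
  have hYZ : ∀ x ∈ YY m n hm hn R C L, ∀ j : ℕ, (aAct m n hm hn)^[j] x ∈ qm '' BddSL (m + n) (Real.exp L * R) :=
    fun x hx j => YY_bdd hm hn hL hx j
  have hZ : IsCompact (qm '' BddSL (m + n) (Real.exp L * R)) := (BddSL_compact _ _).image (qm_cont _)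
  have hz : ∀ ω j, (aAct m n hm hn)^[j] (z ω) ∈ qm '' BddSL (m + n) (Real.exp L * R) := fun ω j => by
    simpa using hYZ _ (hYz ω 0) j
  obtain ⟨S, hS, hSd, Cc, c, hsep⟩ := sep hm hn K L _ B z hz h2 h3 h4
  obtain ⟨ε, hε, hSε⟩ := off_diag S hS hSd
  obtain ⟨μ, hμ, hT, hsupp, k, P, hP, hlow⟩ := lower_measure (aAct_cont hm hn) _ hZ K L hK hL z hz ε hε Cc c
    (fun i0 l ω ω' ha hc hne => by
      obtain ⟨t, ht, hmem⟩ := hsep i0 l ω ω' ha hc hne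
      exact ⟨t, ht, hSε _ hmem⟩)
  have hY : μ (YY m n hm hn R C L)ᶜ = 0 := hsupp _ (YY_closed hm hn R C L) hYz
  have hup := fun (k : ℕ) (P : Fin k → Set (XSp (m + n))) (hP : IsFinPart P) =>
    upper_entropy μ hT _ hZ _ hY hYZ L hL A hA (fun ε hε => by
      obtain ⟨D, hD⟩ := cover hm hn R C A L hL (by linarith) hstep {p | dist p.1 p.2 < ε}
        (isOpen_lt (by fun_prop) continuous_const) (fun x => by simpa using hε)
      exact ⟨D, fun N => hD N⟩) P hP
  have hb : 0 ≤ Real.log A / L := div_nonneg (Real.log_nonneg hA) (Nat.cast_nonneg _)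
  exact ⟨μ, hμ, hT, hY, ks_ge _ _ _ _ hb hup P hP hlow, ks_le _ _ _ hb hup⟩

lemma measures (hm : 0 < m) (hn : 0 < n) : ∃ R C a b : ℝ, ∀ᶠ L : ℕ in atTop,
    ∃ μ : Measure (XSp (m + n)), IsProbabilityMeasure μ ∧ MeasurePreserving (aAct m n hm hn) μ μ ∧
      μ (YY m n hm hn R C L)ᶜ = 0 ∧ ((m:ℝ) + n - 1) + a / L ≤ ksEntropy (aAct m n hm hn) μ ∧
      ksEntropy (aAct m n hm hn) μ ≤ ((m:ℝ) + n - 1) + b / L := by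
  obtain ⟨R, C, c, hR, hC, hc, htree⟩ := tree hm hn
  obtain ⟨K1, hK1, href⟩ := refine_step hm hn R C hC
  have hmn : (0:ℝ) < m + n - 1 := by
    have : (1:ℝ) ≤ m := by exact_mod_cast hm
    have : (1:ℝ) ≤ n := by exact_mod_cast hn
    linarith
  have hbig : ∀ᶠ L : ℕ in atTop, 1 ≤ c * Real.exp ((m + n - 1) * L) := by
    have h : Tendsto (fun L : ℕ => c * Real.exp (((m:ℝ) + n - 1) * L)) atTop atTop :=
      (Real.tendsto_exp_atTop.comp (tendsto_natCast_atTop_atTop.const_mul_atTop hmn)).const_mul_atTop hc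
    exact h.eventually_ge_atTop 1
  refine ⟨R, C, Real.log (c / 2), Real.log K1, ?_⟩
  filter_upwards [htree, href, hbig, eventually_gt_atTop 0] with L h1 h2 h3 hL
  set x := c * Real.exp (((m:ℝ) + n - 1) * L) with hx
  have hK : 0 < ⌊x⌋₊ := Nat.floor_pos.2 h3
  obtain ⟨B, z, t1, t2, t3, t4⟩ := h1 ⌊x⌋₊ (Nat.floor_le (by positivity))
  have hA : 1 ≤ K1 * Real.exp ((m + n - 1) * L) :=
    one_le_mul_of_one_le_of_one_le hK1 (Real.one_le_exp (by positivity))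
  obtain ⟨μ, hμ, hT, hY, hlo, hup⟩ := one_measure hm hn R C _ ⌊x⌋₊ L hK hL hA B z t1 t2 t3 t4 h2
  have hL' : (0:ℝ) < L := by exact_mod_cast hL
  refine ⟨μ, hμ, hT, hY, le_trans ?_ hlo, hup.trans ?_⟩
  · have h5 : c / 2 * Real.exp (((m:ℝ) + n - 1) * L) ≤ (⌊x⌋₊ : ℝ) := by
      have h6 := Nat.lt_floor_add_one x
      have h7 : (1:ℝ) ≤ ⌊x⌋₊ := by exact_mod_cast hK
      have : c / 2 * Real.exp (((m:ℝ) + n - 1) * L) = x / 2 := by rw [hx]; ring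
      rw [this]; linarith
    have h6 := Real.log_le_log (by positivity) h5
    rw [Real.log_mul (by positivity) (by positivity), Real.log_exp] at h6
    rw [le_div_iff₀ hL', add_mul, div_mul_cancel₀ _ hL'.ne']
    linarith
  · rw [Real.log_mul (by positivity) (by positivity), Real.log_exp, div_le_iff₀ hL', add_mul, div_mul_cancel₀ _ hL'.ne']
    linarith

lemma int_bound (hm : 0 < m) (hn : 0 < n) (R C : ℝ) (f : XSp (m + n) → ℝ) (hf : Continuous f)
    (hs : HasCompactSupport f) : ∃ W : ℝ, ∀ L : ℕ, 0 < L → ∀ μ : Measure (XSp (m + n)), IsProbabilityMeasure μ →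
      MeasurePreserving (aAct m n hm hn) μ μ → μ (YY m n hm hn R C L)ᶜ = 0 → ‖∫ x, f x ∂μ‖ ≤ W / L := by
  obtain ⟨M, hM⟩ := escape hm hn R C (tsupport f) hs
  obtain ⟨b, hb⟩ := hf.bounded_above_of_compact_support hs
  refine ⟨|b| * M, fun L hL μ hμ hT hY => ?_⟩
  have h1 := hM L hL μ hμ hT hY
  have e : ∫ x, f x ∂μ = ∫ x in tsupport f, f x ∂μ :=
    (setIntegral_eq_integral_of_forall_compl_eq_zero fun x hx => image_eq_zero_of_notMem_tsupport hx).symm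
  rw [e]
  have h2 := norm_setIntegral_le_of_norm_le_const (μ := μ) (s := tsupport f) (f := f) (C := |b|) (measure_lt_top _ _)
    (fun x _ => (hb x).trans (le_abs_self b))
  refine h2.trans ?_
  have hL' : (0:ℝ) < L := by exact_mod_cast hL
  rw [le_div_iff₀ hL', mul_assoc]
  refine mul_le_mul_of_nonneg_left ?_ (abs_nonneg _)
  have h3 := ENNReal.toReal_mono (by simp) h1
  rw [ENNReal.toReal_mul] at h3
  simp only [ENNReal.toReal_natCast] at h3
  rw [mul_comm]; exact h3

end

end

/-- **Main Theorem.** There exists a sequence of `a`-invariant probability measures `(μ_k)`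
on `X_{m+n}` with `h_{μ_k}(a) → m+n-1` whose weak* limit is the zero measure. -/
theorem main_theorem (m n : ℕ) (hm : 0 < m) (hn : 0 < n) :
    ∃ μ : ℕ → Measure (XSp (m + n)),
      (∀ k, IsProbabilityMeasure (μ k)) ∧
      (∀ k, MeasurePreserving (aAct m n hm hn) (μ k) (μ k)) ∧
      Tendsto (fun k => ksEntropy (aAct m n hm hn) (μ k)) atTop (𝓝 ((m : ℝ) + n - 1)) ∧
      (∀ f : XSp (m + n) → ℝ, Continuous f → HasCompactSupport f →
        Tendsto (fun k => ∫ x, f x ∂(μ k)) atTop (𝓝 0)) := by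
  obtain ⟨R, C, a, b, hev⟩ := measures hm hn
  obtain ⟨L0, hL0⟩ := eventually_atTop.1 hev
  have hlim : ∀ w : ℝ, Tendsto (fun k : ℕ => w / ((k + (L0 + 1) : ℕ) : ℝ)) atTop (𝓝 0) := fun w =>
    (tendsto_const_div_atTop_nhds_zero_nat w).comp (tendsto_add_atTop_nat (L0 + 1))
  choose μ h1 h2 h3 h4 h5 using fun k : ℕ => hL0 (k + (L0 + 1)) (by omega)
  refine ⟨μ, h1, h2, ?_, ?_⟩
  · refine tendsto_of_tendsto_of_tendsto_of_le_of_le ?_ ?_ h4 h5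
    · simpa using (hlim a).const_add ((m:ℝ) + n - 1)
    · simpa using (hlim b).const_add ((m:ℝ) + n - 1)
  · intro f hf hs
    obtain ⟨W, hW⟩ := int_bound hm hn R C f hf hs
    exact squeeze_zero_norm (fun k => hW _ (by omega) (μ k) (h1 k) (h2 k) (h3 k)) (hlim W)
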